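/- Let F|K be an algebraic function field of arbitrary characteristic and P a place of F|K. Take any elements ζ₁,…,ζ_m in the valuation ring 𝓞_F of P on F. Then there exist a finite field extension 𝓕 of F, an extension of P to a valuation on 𝓕, and a finite purely inseparable extension 𝓚 of K inside 𝓕, such that (𝓕|𝓚,P) is uniformizable with respect to ζ₁,…,ζ_m. -/

import Mathlib

/-! Common valuation-theoretic notions, following F.-V. Kuhlmann,
"On local uniformization in arbitrary characteristic I".

A valued field `(F, P)` is modelled by a field `F` together with a
`ValuationSubring F` (the valuation ring `𝓞` of the place `P`). -/

namespace LocalUnif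

variable {F : Type*} [Field F]

/-- `x` lies in the maximal ideal of the valuation subring `O`,
i.e. the residue `xP` is `0` (equivalently `v_P x > 0`, or `x = 0`). -/
def InMax (O : ValuationSubring F) (x : F) : Prop := x = 0 ∨ x⁻¹ ∉ O

/-- `x` is a unit of the valuation subring `O`, i.e. `v_P x = 0`. -/
def IsVUnit (O : ValuationSubring F) (x : F) : Prop := x ≠ 0 ∧ x ∈ O ∧ x⁻¹ ∈ O

/-- The valuation with valuation ring `O` is trivial on the subfield `K`;
equivalently, every nonzero element of `K` is a unit of `O`. -/
def TrivialOn (O : ValuationSubring F) (K : Subfield F) : Prop :=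
  ∀ x ∈ K, x ∈ O ∧ x⁻¹ ∈ O

/-- The residue field of `O` equals (the isomorphic image of) the subfield `K`:
every element of `O` is congruent to an element of `K` modulo the maximal ideal.
(For a place `P` of `F|K` this says that `P` is a rational place, `FP = K`.) -/
def ResidueEq (O : ValuationSubring F) (K : Subfield F) : Prop :=
  ∀ x ∈ O, ∃ c ∈ K, InMax O (x - c)

/-- The residue field of `O` is algebraic over (the image of) `K`; for a place of
`F|K` this says that `P` is zero-dimensional. -/
def ResidueAlgebraic (O : ValuationSubring F) (K : Subfield F) : Prop :=
  ∀ x ∈ O, ∃ p : Polynomial F, p ≠ 0 ∧ (∀ i, p.coeff i ∈ K) ∧ InMax O (Polynomial.eval x p)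

/-- The values `v_P (x i)` are rationally independent modulo `v_P K`:
no nontrivial ℤ-linear combination of the values lies in `ℚ ⊗ v_P K`
(equivalently, in `v_P K`, by clearing denominators). -/
def ValIndepMod (O : ValuationSubring F) (K : Subfield F) {ρ : ℕ} (x : Fin ρ → F) : Prop :=
  (∀ i, x i ≠ 0) ∧
  ∀ e : Fin ρ → ℤ, (∃ c ∈ K, c ≠ 0 ∧ IsVUnit O ((∏ i, x i ^ e i) / c)) → e = 0

/-- The residues `(y i)P` are algebraically independent over the residue field `KP`:
for every polynomial with coefficients in `𝓞_K = K ∩ O`, at least one of which is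
a unit, the value of the polynomial at `y` is a unit (so its residue is nonzero). -/
def ResIndep (O : ValuationSubring F) (K : Subfield F) {τ : ℕ} (y : Fin τ → F) : Prop :=
  (∀ i, y i ∈ O) ∧
  ∀ p : MvPolynomial (Fin τ) F, (∀ m, p.coeff m ∈ K ∧ p.coeff m ∈ O) →
    (∃ m, IsVUnit O (p.coeff m)) → ¬ InMax O (MvPolynomial.eval y p)

/-- `dim_ℚ (ℚ ⊗ (v_P F / v_P K)) = ρ`: there is a maximal set of `ρ` elements of `F`
whose values are rationally independent modulo `v_P K`. -/
def RatRankEq (O : ValuationSubring F) (K : Subfield F) (ρ : ℕ) : Prop :=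
  (∃ x : Fin ρ → F, ValIndepMod O K x) ∧ ∀ x : Fin (ρ + 1) → F, ¬ ValIndepMod O K x

/-- `trdeg (FP | KP) = τ`: there is a maximal set of `τ` elements of `O` whose
residues are algebraically independent over `KP`. -/
def ResTrdegEq (O : ValuationSubring F) (K : Subfield F) (τ : ℕ) : Prop :=
  (∃ y : Fin τ → F, ResIndep O K y) ∧ ∀ y : Fin (τ + 1) → F, ¬ ResIndep O K y

/-- `trdeg (F | K) = d`. -/
def TrdegEq (K : Subfield F) (d : ℕ) : Prop :=
  ∃ t : Fin d → F, IsTranscendenceBasis ↥K t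

/-- `P` is an Abhyankar place of `F|K`:
`trdeg F|K = trdeg FP|K + dim_ℚ (ℚ ⊗ v_P F)`. -/
def IsAbhyankar (O : ValuationSubring F) (K : Subfield F) : Prop :=
  ∃ d ρ τ : ℕ, d = ρ + τ ∧ TrdegEq K d ∧ RatRankEq O K ρ ∧ ResTrdegEq O K τ

/-- The value group of `O` is archimedean ordered (rank at most 1):
for any two positive values `v_P a, v_P b` there is `n` with `n · v_P a ≥ v_P b`. -/
def RankOne (O : ValuationSubring F) : Prop :=
  ∀ a b : F, a ≠ 0 → InMax O a → b ≠ 0 → InMax O b → ∃ n : ℕ, a ^ n / b ∈ O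

/-- The value group of `O` has (rank) at least `r`: there is a chain of `r` positive
values, each infinitely larger than the previous one. -/
def RankAtLeast (O : ValuationSubring F) (r : ℕ) : Prop :=
  ∃ a : Fin r → F, (∀ i, a i ≠ 0 ∧ InMax O (a i)) ∧
    ∀ i j : Fin r, i < j → ∀ n : ℕ, a i ^ n / a j ∉ O

/-- The value group of `O` has rank exactly `r`. -/
def RankEq (O : ValuationSubring F) (r : ℕ) : Prop :=
  RankAtLeast O r ∧ ¬ RankAtLeast O (r + 1)

/-- The valuation is discrete: its value group is order isomorphic to `ℤ`,
i.e. there is a uniformizer `π` with every value an integer multiple of `v_P π`. -/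
def IsDiscrete (O : ValuationSubring F) : Prop :=
  ∃ π : F, π ≠ 0 ∧ InMax O π ∧ ∀ x : F, x ≠ 0 → ∃ n : ℤ, IsVUnit O (x / π ^ n)

/-- `F|K` is an algebraic function field: a finitely generated field extension of
transcendence degree at least 1. -/
def IsFunctionField (K : Subfield F) : Prop :=
  (∃ S : Finset F, IntermediateField.adjoin ↥K (S : Set F) = ⊤) ∧
  ∃ x : F, Transcendental ↥K x

/-- The data of a weak uniformization of `(𝓛|𝓚, P)` (both subfields of an ambient
valued field `F`, `𝓚 ⊆ 𝓛`) with uniformizing transcendence basis `t` and generators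
`η`: there are polynomials `f i` in `n` variables `X₁, …, Xₙ` with coefficients in
`𝓞_𝓚[t₁,…,tₛ]` such that (U1) `X j` does not occur in `f i` for `i < j`,
(U2) `f i (η) = 0`, and (U3) the residue of `det J_f (η)` is nonzero; moreover `t`
is a transcendence basis of `𝓛|𝓚` inside `𝓞_𝓛` and `𝓛 = 𝓚(t, η)`. -/
def UnifData (𝓛 𝓚 : Subfield F) (O : ValuationSubring F) {s n : ℕ}
    (t : Fin s → F) (η : Fin n → F) : Prop :=
  (∀ i, t i ∈ 𝓛 ∧ t i ∈ O) ∧ (∀ i, η i ∈ 𝓛 ∧ η i ∈ O) ∧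
  AlgebraicIndependent ↥𝓚 t ∧
  (∀ z ∈ 𝓛, IsAlgebraic ↥(IntermediateField.adjoin ↥𝓚 (Set.range t)) z) ∧
  Subfield.closure ((𝓚 : Set F) ∪ Set.range t ∪ Set.range η) = 𝓛 ∧
  ∃ f : Fin n → MvPolynomial (Fin n) F,
    (∀ i m, (f i).coeff m ∈
      Subring.closure ((↑(𝓚.toSubring ⊓ O.toSubring) : Set F) ∪ Set.range t)) ∧
    (∀ i j : Fin n, (i : ℕ) < (j : ℕ) → MvPolynomial.degreeOf j (f i) = 0) ∧
    (∀ i, MvPolynomial.eval η (f i) = 0) ∧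
    IsVUnit O (Matrix.det (Matrix.of fun i j : Fin n =>
      MvPolynomial.eval η (MvPolynomial.pderiv j (f i))))

/-- `(𝓛|𝓚, P)` is uniformizable with respect to `ζ₁, …, ζ_m`:
there is a weak uniformization whose generators `η` include all the `ζ k`. -/
def UnifWrt (𝓛 𝓚 : Subfield F) (O : ValuationSubring F) {m : ℕ} (ζ : Fin m → F) : Prop :=
  ∃ (s n : ℕ) (t : Fin s → F) (η : Fin n → F),
    UnifData 𝓛 𝓚 O t η ∧ ∃ σ : Fin m → Fin n, ∀ k, η (σ k) = ζ k

/-- `(𝓛|𝓚, P)` is uniformizable: uniformizable with respect to every finite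
list of elements of `𝓞_𝓛`. -/
def UnifIn (𝓛 𝓚 : Subfield F) (O : ValuationSubring F) : Prop :=
  ∀ (m : ℕ) (ζ : Fin m → F), (∀ k, ζ k ∈ 𝓛 ∧ ζ k ∈ O) → UnifWrt 𝓛 𝓚 O ζ

section Defectless

variable {K L : Type*} [Field K] [Field L]

/-- The values of the `a i` lie in pairwise distinct cosets modulo the value group of
the ground field along `φ`; thus there are at least `e` distinct cosets. -/
def ValClassIndep (φ : K →+* L) (OL : ValuationSubring L) {e : ℕ} (a : Fin e → L) : Prop :=
  (∀ i, a i ≠ 0) ∧ ∀ i j : Fin e, i ≠ j →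
    ¬ ∃ c : K, c ≠ 0 ∧ IsVUnit OL (a i / (a j * φ c))

/-- The ramification index `e = (v_P L : v_P K)` of `OL` over the ground field along `φ`. -/
def RamIdxEq (φ : K →+* L) (OL : ValuationSubring L) (e : ℕ) : Prop :=
  (∃ a : Fin e → L, ValClassIndep φ OL a) ∧ ∀ a : Fin (e + 1) → L, ¬ ValClassIndep φ OL a

/-- The residues of the `b i` are linearly independent over the residue field of the
ground field along `φ`. -/
def ResLinIndep (φ : K →+* L) (OK : ValuationSubring K) (OL : ValuationSubring L)
    {f : ℕ} (b : Fin f → L) : Prop :=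
  (∀ i, b i ∈ OL) ∧ ∀ c : Fin f → K, (∀ i, c i ∈ OK) → (∃ i, ¬ InMax OK (c i)) →
    ¬ InMax OL (∑ i, φ (c i) * b i)

/-- The inertia degree `f = [LP : KP]` of `OL` over `(K, OK)` along `φ`. -/
def InertiaDegEq (φ : K →+* L) (OK : ValuationSubring K) (OL : ValuationSubring L)
    (f : ℕ) : Prop :=
  (∃ b : Fin f → L, ResLinIndep φ OK OL b) ∧ ∀ b : Fin (f + 1) → L, ¬ ResLinIndep φ OK OL b

end Defectless

/-- `(K, OK)` is a defectless (stable) valued field: for every finite extension `L|K`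
(inside a fixed algebraic closure) the fundamental equality
`[L : K] = ∑ᵢ eᵢ fᵢ` holds, the sum running over all extensions of the valuation. -/
def IsDefectless (K : Type*) [Field K] (OK : ValuationSubring K) : Prop :=
  ∀ L : IntermediateField K (AlgebraicClosure K), FiniteDimensional K ↥L →
    ∃ (g : ℕ) (Os : Fin g → ValuationSubring ↥L) (e f : Fin g → ℕ),
      Function.Injective Os ∧
      (∀ O' : ValuationSubring ↥L, O'.comap (algebraMap K ↥L) = OK ↔ ∃ i, O' = Os i) ∧
      (∀ i, RamIdxEq (algebraMap K ↥L) (Os i) (e i)) ∧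
      (∀ i, InertiaDegEq (algebraMap K ↥L) OK (Os i) (f i)) ∧
      Module.finrank K ↥L = ∑ i, e i * f i

/-- The extension `𝓛|𝓚` of subfields of `F` is separable (in the general sense of
MacLane): every finitely generated subextension is separably generated, i.e. admits
a separating transcendence basis. -/
def IsSeparableExt (𝓚 𝓛 : Subfield F) : Prop :=
  ∀ S : Finset F, ↑S ⊆ (𝓛 : Set F) →
    ∃ (d : ℕ) (u : Fin d → F), (∀ i, u i ∈ 𝓛) ∧ AlgebraicIndependent ↥𝓚 u ∧
      ∀ x ∈ Subfield.closure ((𝓚 : Set F) ∪ ↑S),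
        IsSeparable ↥(IntermediateField.adjoin ↥𝓚 (Set.range u)) x

/-- The embedding of a subfield `K`, on which the valuation is trivial, into
the residue field of `O`. -/
noncomputable def resEmb (O : ValuationSubring F) (K : Subfield F) (h : ∀ x ∈ K, x ∈ O) :
    ↥K →+* IsLocalRing.ResidueField ↥O :=
  (IsLocalRing.residue ↥O).comp
    { toFun := fun x => (⟨x.1, h x.1 x.2⟩ : ↥O)
      map_one' := rfl
      map_mul' := fun _ _ => rfl
      map_zero' := rfl
      map_add' := fun _ _ => rfl }

end LocalUnif

section
open Polynomial
namespace LU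
variable {L : Type*} [Field L]

def EtClosed (O : ValuationSubring L) (E : Subring L) : Prop :=
  ∀ f : L[X], (∀ i, f.coeff i ∈ E) → ∀ η ∈ O, f.eval η = 0 →
    O.valuation (f.derivative.eval η) = 1 → η ∈ E

def Et (O : ValuationSubring L) (R : Subring L) : Subring L :=
  sInf {E | R ≤ E ∧ EtClosed O E}

theorem le_Et (O : ValuationSubring L) (R : Subring L) : R ≤ Et O R :=
  le_sInf fun _ h => h.1

theorem Et_closed (O : ValuationSubring L) (R : Subring L) : EtClosed O (Et O R) := by
  intro f hf η hη h0 h1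
  rw [Et, Subring.mem_sInf]
  intro E hE
  exact hE.2 f (fun i => (Subring.mem_sInf.1 (hf i)) E hE) η hη h0 h1

theorem Et_min {O : ValuationSubring L} {R E : Subring L} (h : R ≤ E) (hE : EtClosed O E) :
    Et O R ≤ E := sInf_le ⟨h, hE⟩

theorem Et_mono {O : ValuationSubring L} {R R' : Subring L} (h : R ≤ R') : Et O R ≤ Et O R' :=
  Et_min (h.trans (le_Et _ _)) (Et_closed _ _)

theorem Et_le_of_le_Et {O : ValuationSubring L} {R R' : Subring L} (h : R ≤ Et O R') :
    Et O R ≤ Et O R' := Et_min h (Et_closed _ _)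

theorem etClosed_O (O : ValuationSubring L) : EtClosed O O.toSubring :=
  fun _ _ η hη _ _ => hη

theorem Et_le_O {O : ValuationSubring L} {R : Subring L} (h : R ≤ O.toSubring) :
    Et O R ≤ O.toSubring := Et_min h (etClosed_O O)

theorem EtClosed.inv {O : ValuationSubring L} {E : Subring L} (hE : EtClosed O E) {u : L}
    (hu : u ∈ E) (h1 : O.valuation u = 1) : u⁻¹ ∈ E := by
  have hu0 : u ≠ 0 := by rintro rfl; simp at h1
  refine hE (C u * X - 1) (fun i => ?_) _ ?_ ?_ ?_
  · rw [coeff_sub, coeff_C_mul, coeff_X, coeff_one]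
    refine E.sub_mem (E.mul_mem hu ?_) ?_ <;> split_ifs <;> first | exact E.one_mem | exact E.zero_mem
  · rw [← ValuationSubring.valuation_le_one_iff, map_inv₀, h1, inv_one]
  · simp [hu0]
  · simp [h1]

theorem eval_mem {E : Subring L} {f : L[X]} (hf : ∀ i, f.coeff i ∈ E) {x : L} (hx : x ∈ E) :
    f.eval x ∈ E := by
  rw [eval_eq_sum_range]
  exact E.sum_mem fun i _ => E.mul_mem (hf i) (E.pow_mem hx _)

theorem deriv_coeff_mem {E : Subring L} {f : L[X]} (hf : ∀ i, f.coeff i ∈ E) (i : ℕ) :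
    f.derivative.coeff i ∈ E := by
  rw [coeff_derivative]
  exact E.mul_mem (hf _) (by exact_mod_cast natCast_mem E (i+1))

theorem comp_coeff_mem {E : Subring L} {f g : L[X]} (hf : ∀ i, f.coeff i ∈ E)
    (hg : ∀ i, g.coeff i ∈ E) (i : ℕ) : (f.comp g).coeff i ∈ E := by
  have hf' : f ∈ lifts E.subtype := (lifts_iff_coeff_lifts _).2 (by simpa using hf)
  have hg' : g ∈ lifts E.subtype := (lifts_iff_coeff_lifts _).2 (by simpa using hg)
  obtain ⟨f, rfl⟩ := hf'
  obtain ⟨g, rfl⟩ := hg'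
  simp only [coe_mapRingHom, ← Polynomial.map_comp, coeff_map]
  exact ((f.comp g).coeff i).2

theorem taylor2 {E : Subring L} {f : L[X]} (hf : ∀ i, f.coeff i ∈ E) {x h : L}
    (hx : x ∈ E) (hh : h ∈ E) :
    ∃ r ∈ E, f.eval (x + h) = f.eval x + f.derivative.eval x * h + r * h ^ 2 := by
  have hf' : f ∈ lifts E.subtype := (lifts_iff_coeff_lifts _).2 (by simpa using hf)
  obtain ⟨g, rfl⟩ := hf'
  let x' : E := ⟨x, hx⟩
  let h' : E := ⟨h, hh⟩
  obtain ⟨r, hr⟩ := g.binomExpansion x' h'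
  refine ⟨r, r.2, ?_⟩
  have := congrArg E.subtype hr
  rw [map_add, map_add, map_mul, map_mul, ← eval_map_apply', ← eval_map_apply', ← eval_map_apply'] at this
  simpa [derivative_map] using this
where
  eval_map_apply' {E : Subring L} {g : (↥E)[X]} {x : E} :
    (g.map E.subtype).eval (E.subtype x) = E.subtype (g.eval x) := by
    rw [eval_map, eval₂_at_apply]

theorem Et_finite {O : ValuationSubring L} {R : Subring L} {z : L} (hz : z ∈ Et O R) :
    ∃ Z : Finset L, (Z : Set L) ⊆ R ∧ z ∈ Et O (Subring.closure (Z : Set L)) := by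
  classical
  let D : Subring L :=
    { carrier := {z | ∃ Z : Finset L, (Z : Set L) ⊆ R ∧ z ∈ Et O (Subring.closure (Z : Set L))}
      mul_mem' := by
        rintro a b ⟨A, hA, ha⟩ ⟨B, hB, hb⟩
        refine ⟨A ∪ B, by simp [hA, hB], Subring.mul_mem _ (Et_mono ?_ ha) (Et_mono ?_ hb)⟩ <;>
        · apply Subring.closure_mono; simp
      one_mem' := ⟨∅, by simp, Subring.one_mem _⟩
      add_mem' := by
        rintro a b ⟨A, hA, ha⟩ ⟨B, hB, hb⟩
        refine ⟨A ∪ B, by simp [hA, hB], Subring.add_mem _ (Et_mono ?_ ha) (Et_mono ?_ hb)⟩ <;>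
        · apply Subring.closure_mono; simp
      zero_mem' := ⟨∅, by simp, Subring.zero_mem _⟩
      neg_mem' := by
        rintro a ⟨A, hA, ha⟩
        exact ⟨A, hA, Subring.neg_mem _ ha⟩ }
  suffices h : Et O R ≤ D from h hz
  apply Et_min
  · intro x hx
    exact ⟨{x}, by simpa using hx, le_Et _ _ (Subring.subset_closure (by simp))⟩
  · intro f hf η hη h0 h1
    choose A hA hfA using hf
    refine ⟨(Finset.range (f.natDegree+1)).biUnion A, ?_, ?_⟩
    · intro x hx
      simp only [Finset.coe_biUnion, Set.mem_iUnion] at hx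
      obtain ⟨i, _, hi⟩ := hx
      exact hA i hi
    · refine Et_closed _ _ f (fun i => ?_) η hη h0 h1
      by_cases hi : i < f.natDegree + 1
      · refine Et_mono (Subring.closure_mono ?_) (hfA i)
        intro x hx
        simp only [Finset.coe_biUnion, Set.mem_iUnion]
        exact ⟨i, by simpa using hi, hx⟩
      · rw [coeff_eq_zero_of_natDegree_lt (by omega)]
        exact Subring.zero_mem _

theorem Et_finite_set {O : ValuationSubring L} {R : Subring L} (S : Finset L)
    (hS : (S : Set L) ⊆ Et O R) :
    ∃ Z : Finset L, (Z : Set L) ⊆ R ∧ (S : Set L) ⊆ Et O (Subring.closure (Z : Set L)) := by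
  classical
  choose! A hA hA' using fun z (hz : z ∈ S) => Et_finite (hS hz)
  refine ⟨S.biUnion A, ?_, fun z hz => Et_mono (Subring.closure_mono ?_) (hA' z hz)⟩
  · intro x hx
    simp only [Finset.coe_biUnion, Set.mem_iUnion] at hx
    obtain ⟨i, h, hi⟩ := hx
    exact hA i h hi
  · intro x hx
    simp only [Finset.coe_biUnion, Set.mem_iUnion]
    exact ⟨z, hz, hx⟩

theorem vle {O : ValuationSubring L} {x : L} : x ∈ O ↔ O.valuation x ≤ 1 :=
  (O.valuation_le_one_iff x).symm

theorem v_eq_one_of_sub {O : ValuationSubring L} {x y : L} (hy : O.valuation y = 1)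
    (h : O.valuation (x - y) < 1) : O.valuation x = 1 := by
  have := Valuation.map_add_eq_of_lt_right O.valuation (x := x - y) (y := y) (by rw [hy]; exact h)
  simpa [hy] using this

theorem newton {O : ValuationSubring L} {E : Subring L} (hE : EtClosed O E)
    (hEO : E ≤ O.toSubring) {f : L[X]} (hf : ∀ i, f.coeff i ∈ E) {η : L} (hη : η ∈ O)
    (h0 : f.eval η = 0) (h1 : O.valuation (f.derivative.eval η) = 1)
    {q d w : L} (hq : q ∈ E) (hd : d ∈ E) (hw : w ∈ E) (hd0 : d ≠ 0)
    (hlt : O.valuation (η - q) < 1) (hfq : f.eval q = d * w) :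
    ∃ h ∈ E, η = q + d * h := by
  have hηE : η ∈ E := hE f hf η hη h0 h1
  have hdv : O.valuation d ≠ 0 := by simpa using hd0
  obtain ⟨r, hr, hr'⟩ := taylor2 hf hηE (E.sub_mem hq hηE)
  have hle : O.valuation (η - q) ≤ O.valuation d := by
    have e1 : (η - q) * (f.derivative.eval η - r * (η - q)) = - (d * w) := by
      rw [← hfq]
      have : η + (q - η) = q := by ring
      rw [this, h0] at hr'
      rw [hr']; ring
    have hu : O.valuation (f.derivative.eval η - r * (η - q)) = 1 := by
      apply v_eq_one_of_sub h1
      have : f.derivative.eval η - r * (η - q) - f.derivative.eval η = -(r * (η - q)) := by ring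
      rw [this, Valuation.map_neg, map_mul]
      exact mul_lt_one_of_nonneg_of_lt_one_right (vle.1 (hEO hr)) zero_le hlt
    have := congrArg O.valuation e1
    rw [map_mul, hu, mul_one, Valuation.map_neg, map_mul] at this
    rw [this]
    exact mul_le_of_le_one_right' (vle.1 (hEO hw))
  let g : L[X] := f.comp (C q + X)
  have hg : ∀ i, g.coeff i ∈ E := by
    apply comp_coeff_mem hf
    intro i
    rw [coeff_add, coeff_C, coeff_X]
    refine E.add_mem ?_ ?_ <;> split_ifs <;>
      first | exact E.one_mem | exact E.zero_mem | exact hq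
  let G : L[X] := C w + C (d⁻¹) * ((g - C (g.coeff 0)).comp (C d * X))
  have hg0 : g.coeff 0 = d * w := by
    rw [coeff_zero_eq_eval_zero]
    simp [g, eval_comp, hfq]
  have hgv : ∀ x, G.eval x = d⁻¹ * f.eval (q + d * x) := by
    intro x
    simp only [G, g, hg0, eval_add, eval_C, eval_mul, eval_comp, eval_sub, eval_X]
    field_simp
    ring
  refine ⟨(η - q) / d, ?_, by field_simp; ring⟩
  refine hE G (fun i => ?_) _ ?_ ?_ ?_
  · simp only [G, coeff_add, coeff_C_mul, comp_C_mul_X_coeff, coeff_sub, coeff_C]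
    rcases i with _ | i
    · simpa using hw
    · simp only [Nat.add_eq_zero_iff, one_ne_zero, and_false, if_false, zero_add, sub_zero, pow_succ]
      have : d⁻¹ * (g.coeff (i+1) * (d ^ i * d)) = g.coeff (i+1) * d ^ i := by field_simp
      rw [this]
      exact E.mul_mem (hg _) (E.pow_mem hd _)
  · rw [vle, map_div₀]
    exact div_le_one_of_le₀ hle zero_le
  · rw [hgv]
    have : q + d * ((η - q) / d) = η := by field_simp; ring
    rw [this, h0, mul_zero]
  · have : G.derivative.eval ((η - q) / d) = f.derivative.eval η := by
      simp only [G, g, derivative_add, derivative_C, derivative_mul, derivative_comp, derivative_sub,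
        derivative_X, eval_add, eval_mul, eval_comp, eval_C, eval_X, eval_sub, eval_zero, eval_one]
      have : q + d * ((η - q) / d) = η := by field_simp; ring
      rw [this]
      field_simp
      simp
    rw [this, h1]

end LU

namespace LU
variable {L : Type*} [Field L]

theorem closure_finite_gen {S T : Set L} {z : L} (hz : z ∈ Subring.closure (S ∪ T)) :
    ∃ A : Finset L, (A : Set L) ⊆ S ∧ z ∈ Subring.closure ((A : Set L) ∪ T) := by
  classical
  induction hz using Subring.closure_induction with
  | mem x hx =>
    rcases hx with hx | hx
    · exact ⟨{x}, by simpa using hx, Subring.subset_closure (by simp)⟩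
    · exact ⟨∅, by simp, Subring.subset_closure (by simp [hx])⟩
  | zero => exact ⟨∅, by simp, Subring.zero_mem _⟩
  | one => exact ⟨∅, by simp, Subring.one_mem _⟩
  | neg x _ h => obtain ⟨A, h1, h2⟩ := h; exact ⟨A, h1, Subring.neg_mem _ h2⟩
  | add x y _ _ h h' =>
    obtain ⟨A, h1, h2⟩ := h
    obtain ⟨B, h3, h4⟩ := h'
    refine ⟨A ∪ B, by simp [h1, h3], Subring.add_mem _ (Subring.closure_mono ?_ h2)
      (Subring.closure_mono ?_ h4)⟩ <;> intro x <;> simp <;> tauto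
  | mul x y _ _ h h' =>
    obtain ⟨A, h1, h2⟩ := h
    obtain ⟨B, h3, h4⟩ := h'
    refine ⟨A ∪ B, by simp [h1, h3], Subring.mul_mem _ (Subring.closure_mono ?_ h2)
      (Subring.closure_mono ?_ h4)⟩ <;> intro x <;> simp <;> tauto

theorem Et_finite_gen {O : ValuationSubring L} {S T : Set L} (Z : Finset L)
    (hZ : (Z : Set L) ⊆ Et O (Subring.closure (S ∪ T))) :
    ∃ A : Finset L, (A : Set L) ⊆ S ∧ (Z : Set L) ⊆ Et O (Subring.closure ((A : Set L) ∪ T)) := by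
  classical
  obtain ⟨Z0, h0, h1⟩ := Et_finite_set Z hZ
  choose! A hA hA' using fun z (hz : z ∈ Z0) => closure_finite_gen (h0 hz)
  refine ⟨Z0.biUnion A, ?_, h1.trans (Et_mono ?_)⟩
  · intro x hx
    simp only [Finset.coe_biUnion, Set.mem_iUnion] at hx
    obtain ⟨i, h, hi⟩ := hx
    exact hA i h hi
  · rw [Subring.closure_le]
    intro z hz
    refine Subring.closure_mono ?_ (hA' z hz)
    apply Set.union_subset_union_left
    intro x hx
    simp only [Finset.coe_biUnion, Set.mem_iUnion]
    exact ⟨z, hz, hx⟩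

theorem exists_scale {O : ValuationSubring L} {κ : Subfield L} (S : Finset L)
    (hS : ∀ s ∈ S, s ∈ κ) : ∃ e ∈ κ, e ≠ 0 ∧ e ∈ O ∧ ∀ s ∈ S, e * s ∈ O := by
  classical
  induction S using Finset.induction_on with
  | empty => exact ⟨1, κ.one_mem, one_ne_zero, O.one_mem, by simp⟩
  | insert a S _ ih =>
    obtain ⟨e, he, he0, heO, h⟩ := ih fun s hs => hS s (by simp [hs])
    rcases O.mem_or_inv_mem a with ha | ha
    · refine ⟨e, he, he0, heO, ?_⟩
      intro s hs
      rcases Finset.mem_insert.1 hs with rfl | hs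
      · exact O.mul_mem _ _ heO ha
      · exact h s hs
    · by_cases ha0 : a = 0
      · subst ha0
        refine ⟨e, he, he0, heO, ?_⟩
        intro s hs
        rcases Finset.mem_insert.1 hs with rfl | hs
        · simpa using O.zero_mem
        · exact h s hs
      · refine ⟨e * a⁻¹, κ.mul_mem he (κ.inv_mem (hS a (by simp))), mul_ne_zero he0 (inv_ne_zero ha0),
          O.mul_mem _ _ heO ha, ?_⟩
        intro s hs
        rcases Finset.mem_insert.1 hs with rfl | hs
        · rwa [mul_assoc, inv_mul_cancel₀ ha0, mul_one]
        · have := O.mul_mem _ _ (h s hs) ha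
          convert this using 1; ring

section comp
variable (O : ValuationSubring L) (κ : Subfield L) (t : Set L)

def Rd (d : L) : Subring L :=
  Subring.closure ({c | c ∈ κ ∧ c ∈ O} ∪ {y | ∃ x ∈ t, y = x / d})

def Fine (z : L) : Prop := ∀ e ∈ κ, e ≠ 0 → ∃ d ∈ κ, d ∈ O ∧ d ≠ 0 ∧ z / e ∈ Et O (Rd O κ t d)

variable {O κ t}

theorem Rd_mono {d d' : L} (hd : d ≠ 0) (h0' : d' ≠ 0) (hd' : d' ∈ κ) (hO' : d' ∈ O) :
    Rd O κ t d ≤ Rd O κ t (d * d') := by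
  rw [Rd, Subring.closure_le]
  rintro x (hx | ⟨x, hx, rfl⟩)
  · exact Subring.subset_closure (Or.inl hx)
  · have : x / d = d' * (x / (d * d')) := by field_simp
    rw [this]
    exact Subring.mul_mem _ (Subring.subset_closure (Or.inl ⟨hd', hO'⟩))
      (Subring.subset_closure (Or.inr ⟨x, hx, rfl⟩))

theorem Rd_common {ι : Type*} (s : Finset ι) (d : ι → L) (h : ∀ i ∈ s, d i ∈ κ ∧ d i ∈ O ∧ d i ≠ 0) :
    ∃ e ∈ κ, e ∈ O ∧ e ≠ 0 ∧ ∀ i ∈ s, Rd O κ t (d i) ≤ Rd O κ t e := by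
  classical
  induction s using Finset.induction_on with
  | empty => exact ⟨1, κ.one_mem, O.one_mem, one_ne_zero, by simp⟩
  | insert a s _ ih =>
    obtain ⟨e, h1, h2, h3, h4⟩ := ih fun i hi => h i (by simp [hi])
    obtain ⟨g1, g2, g3⟩ := h a (by simp)
    refine ⟨e * d a, κ.mul_mem h1 g1, O.mul_mem _ _ h2 g2, mul_ne_zero h3 g3, ?_⟩
    intro i hi
    rcases Finset.mem_insert.1 hi with rfl | hi
    · rw [mul_comm]; exact Rd_mono g3 h3 h1 h2
    · exact (h4 i hi).trans (Rd_mono h3 g3 g1 g2)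

theorem Fine.zero : Fine O κ t 0 := fun e _ _ =>
  ⟨1, κ.one_mem, O.one_mem, one_ne_zero, by simpa using Subring.zero_mem _⟩

theorem Fine.add {x y : L} (hx : Fine O κ t x) (hy : Fine O κ t y) : Fine O κ t (x + y) := by
  intro e he he0
  obtain ⟨d, h1, h2, h3, h4⟩ := hx e he he0
  obtain ⟨d', g1, g2, g3, g4⟩ := hy e he he0
  refine ⟨d * d', κ.mul_mem h1 g1, O.mul_mem _ _ h2 g2, mul_ne_zero h3 g3, ?_⟩
  rw [add_div]
  refine Subring.add_mem _ (Et_mono (Rd_mono h3 g3 g1 g2) h4) (Et_mono ?_ g4)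
  rw [mul_comm]; exact Rd_mono g3 h3 h1 h2

theorem Fine.neg {x : L} (hx : Fine O κ t x) : Fine O κ t (-x) := by
  intro e he he0
  obtain ⟨d, h1, h2, h3, h4⟩ := hx e he he0
  refine ⟨d, h1, h2, h3, ?_⟩
  rw [neg_div]; exact Subring.neg_mem _ h4

theorem Fine.mul {x y : L} (hx : Fine O κ t x) (hy : Fine O κ t y) : Fine O κ t (x * y) := by
  intro e he he0
  obtain ⟨d, h1, h2, h3, h4⟩ := hx e he he0
  obtain ⟨d', g1, g2, g3, g4⟩ := hy 1 κ.one_mem one_ne_zero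
  refine ⟨d * d', κ.mul_mem h1 g1, O.mul_mem _ _ h2 g2, mul_ne_zero h3 g3, ?_⟩
  have : x * y / e = x / e * (y / 1) := by ring
  rw [this]
  refine Subring.mul_mem _ (Et_mono (Rd_mono h3 g3 g1 g2) h4) (Et_mono ?_ g4)
  rw [mul_comm]; exact Rd_mono g3 h3 h1 h2

theorem Fine.smul {c y : L} (hc : c ∈ κ) (hy : Fine O κ t y) : Fine O κ t (c * y) := by
  intro e he he0
  by_cases h0 : c = 0
  · subst h0; rw [zero_mul]; exact Fine.zero e he he0
  obtain ⟨d', g1, g2, g3, g4⟩ := hy (e / c) (κ.div_mem he hc) (div_ne_zero he0 h0)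
  refine ⟨d', g1, g2, g3, ?_⟩
  convert g4 using 1; field_simp

variable {Ow : ValuationSubring L}

theorem lt_of_lt (hO : O ≤ Ow) {x : L} (h : Ow.valuation x < 1) : O.valuation x < 1 := by
  by_contra h'
  have hx0 : x ≠ 0 := by rintro rfl; simp at h'
  have : x⁻¹ ∈ O := by
    rw [vle, map_inv₀]; exact inv_le_one_of_one_le₀ (not_lt.1 h')
  have := vle.1 (hO this)
  rw [map_inv₀, inv_le_one₀ ((Valuation.pos_iff _).2 hx0)] at this
  exact absurd h (not_lt.2 this)

theorem vone_of_subfield (hκ : ∀ c ∈ κ, c ∈ Ow) {c : L} (hc : c ∈ κ) (h0 : c ≠ 0) :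
    Ow.valuation c = 1 := by
  apply le_antisymm (vle.1 (hκ c hc))
  have := vle.1 (hκ _ (κ.inv_mem hc))
  rwa [map_inv₀, inv_le_one₀ ((Valuation.pos_iff _).2 h0)] at this

variable (O κ t Ow) in
def Dc (hκ : ∀ c ∈ κ, c ∈ Ow) : Subring L where
  carrier := {z | ∃ c ∈ κ, Ow.valuation (z - c) < 1 ∧ Fine O κ t (z - c)}
  zero_mem' := ⟨0, κ.zero_mem, by simp, by simpa using Fine.zero⟩
  one_mem' := ⟨1, κ.one_mem, by simp, by simpa using Fine.zero⟩
  neg_mem' := by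
    rintro x ⟨c, h1, h2, h3⟩
    refine ⟨-c, κ.neg_mem h1, ?_, ?_⟩
    · rw [← Valuation.map_neg]; convert h2 using 2; ring
    · convert h3.neg using 1; ring
  add_mem' := by
    rintro x y ⟨c, h1, h2, h3⟩ ⟨d, g1, g2, g3⟩
    have e : x + y - (c + d) = (x - c) + (y - d) := by ring
    refine ⟨c + d, κ.add_mem h1 g1, ?_, ?_⟩
    · rw [e]; exact Valuation.map_add_lt _ h2 g2
    · rw [e]; exact h3.add g3
  mul_mem' := by
    rintro x y ⟨c, h1, h2, h3⟩ ⟨d, g1, g2, g3⟩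
    have e : x * y - (c * d) = (x - c) * (y - d) + (c * (y - d) + d * (x - c)) := by ring
    refine ⟨c * d, κ.mul_mem h1 g1, ?_, ?_⟩
    · rw [e]
      refine Valuation.map_add_lt _ ?_ (Valuation.map_add_lt _ ?_ ?_)
      · rw [map_mul]; exact mul_lt_one_of_nonneg_of_lt_one_right h2.le zero_le g2
      · rw [map_mul]; exact mul_lt_one_of_nonneg_of_lt_one_right (vle.1 (hκ c h1)) zero_le g2
      · rw [map_mul]; exact mul_lt_one_of_nonneg_of_lt_one_right (vle.1 (hκ d g1)) zero_le h2
    · rw [e]; exact (h3.mul g3).add ((g3.smul h1).add (h3.smul g1))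

theorem eval_sub_coeff_zero_lt {E : Subring L} (hE : E ≤ Ow.toSubring) {g : L[X]}
    (hg : ∀ i, g.coeff i ∈ E) {h : L} (hh : Ow.valuation h < 1) :
    Ow.valuation (g.eval h - g.coeff 0) < 1 := by
  have := congrArg (eval h) (divX_mul_X_add g)
  simp only [eval_add, eval_mul, eval_X, eval_C] at this
  rw [← this, add_sub_cancel_right, map_mul]
  refine mul_lt_one_of_nonneg_of_lt_one_right (vle.1 ?_) zero_le hh
  apply eval_mem (E := Ow.toSubring) _ (vle.2 hh.le)
  intro i
  rw [coeff_divX]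
  exact hE (hg _)

theorem Dc_closed (hO : O ≤ Ow) (hκ : ∀ c ∈ κ, c ∈ Ow)
    (hres : ∀ z ∈ Ow, ∃ c ∈ κ, Ow.valuation (z - c) < 1)  :
    EtClosed Ow (Dc O κ t Ow hκ) := by
  have hDO : Dc O κ t Ow hκ ≤ Ow.toSubring := by
    rintro x ⟨c, hc, h, -⟩
    have : x = (x - c) + c := by ring
    rw [this]
    exact Ow.add_mem _ _ (vle.2 h.le) (hκ c hc)
  have hκD : ∀ c ∈ κ, c ∈ Dc O κ t Ow hκ := fun c hc =>
    ⟨c, hc, by simp, by simpa using Fine.zero⟩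
  intro f hf η hη h0 h1
  obtain ⟨c, hc, hlt⟩ := hres η hη
  refine ⟨c, hc, hlt, ?_⟩
  set h := η - c with hh
  let g : L[X] := f.comp (C c + X)
  have hg : ∀ i, g.coeff i ∈ Dc O κ t Ow hκ := by
    apply comp_coeff_mem hf
    intro i
    rw [coeff_add, coeff_C, coeff_X]
    refine Subring.add_mem _ ?_ ?_ <;> split_ifs <;>
      first | exact Subring.one_mem _ | exact Subring.zero_mem _ | exact hκD c hc
  have hg0 : g.eval h = 0 := by
    simp [g, eval_comp, hh, h0]
  have hg' : g.derivative.eval h = f.derivative.eval η := by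
    simp [g, eval_comp, hh, derivative_comp]
  have hv0 := eval_sub_coeff_zero_lt hDO hg hlt
  have hv1 := eval_sub_coeff_zero_lt hDO (deriv_coeff_mem hg) hlt
  rw [hg0, zero_sub, Valuation.map_neg] at hv0
  rw [hg', coeff_derivative] at hv1
  simp only [zero_add, CharP.cast_eq_zero, mul_one] at hv1
  choose ψ hψ hψv hψF using hg
  have hψ0 : ψ 0 = 0 := by
    by_contra hne
    have h1 := vone_of_subfield hκ (hψ 0) hne
    have := v_eq_one_of_sub h1 (hψv 0)
    exact absurd hv0 (by rw [this]; simp)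
  have hd1 : Ow.valuation (f.derivative.eval η - ψ 1) < 1 := by
    have := Valuation.map_add_lt _ hv1 (hψv 1)
    simpa using this
  have hψ1 : ψ 1 ≠ 0 := by
    intro h
    rw [h, sub_zero, h1] at hd1
    exact lt_irrefl _ hd1
  intro e he he0
  classical
  obtain ⟨e', he', he'0, he'O, hS⟩ := exists_scale (O := O) (κ := κ)
    (insert e⁻¹ ((Finset.range (g.natDegree + 1)).image fun i => ψ i / ψ 1)) (by
      intro s hs
      rcases Finset.mem_insert.1 hs with rfl | hs
      · exact κ.inv_mem he
      · obtain ⟨i, _, rfl⟩ := Finset.mem_image.1 hs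
        exact κ.div_mem (hψ i) (hψ 1))
  have hkey : ∀ i, ∃ d, (d ∈ κ ∧ d ∈ O ∧ d ≠ 0) ∧
      (i < g.natDegree + 1 → g.coeff i * e' ^ i / (ψ 1 * e') ∈ Et O (Rd O κ t d)) := by
    intro i
    rcases i with _ | i
    · obtain ⟨d, d1, d2, d3, d4⟩ := hψF 0 (ψ 1 * e') (κ.mul_mem (hψ 1) he') (mul_ne_zero hψ1 he'0)
      refine ⟨d, ⟨d1, d2, d3⟩, fun _ => ?_⟩
      simpa [hψ0] using d4
    · obtain ⟨d, d1, d2, d3, d4⟩ := hψF (i+1) (ψ 1 / e' ^ i) (κ.div_mem (hψ 1) (κ.pow_mem he' _))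
        (div_ne_zero hψ1 (pow_ne_zero _ he'0))
      refine ⟨d, ⟨d1, d2, d3⟩, fun hi => ?_⟩
      have : g.coeff (i+1) * e' ^ (i+1) / (ψ 1 * e') =
        (g.coeff (i+1) - ψ (i+1)) / (ψ 1 / e' ^ i) + ψ (i+1) / ψ 1 * e' ^ i := by
        field_simp; ring
      rw [this]
      refine Subring.add_mem _ d4 (le_Et _ _ (Subring.subset_closure (Or.inl ⟨?_, ?_⟩)))
      · exact κ.mul_mem (κ.div_mem (hψ _) (hψ 1)) (κ.pow_mem he' _)
      · rcases i with _ | i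
        · simpa [hψ1] using O.one_mem
        · have h2 := hS (ψ (i+1+1) / ψ 1) (Finset.mem_insert_of_mem (Finset.mem_image.2
            ⟨i+1+1, Finset.mem_range.2 hi, rfl⟩))
          have : ψ (i+1+1) / ψ 1 * e' ^ (i+1) = (e' * (ψ (i+1+1) / ψ 1)) * e' ^ i := by ring
          rw [this]
          exact O.mul_mem _ _ h2 (pow_mem he'O i)
  choose d hd hdm using hkey
  obtain ⟨D, D1, D2, D3, D4⟩ := Rd_common (t := t) (Finset.range (g.natDegree+1)) d (fun i _ => hd i)
  refine ⟨D, D1, D2, D3, ?_⟩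
  have hwe' := vone_of_subfield hκ he' he'0
  have hroot : h / e' ∈ Et O (Rd O κ t D) := by
    refine Et_closed _ _ (C (ψ 1 * e')⁻¹ * g.comp (C e' * X)) (fun i => ?_) _ ?_ ?_ ?_
    · rw [coeff_C_mul, comp_C_mul_X_coeff]
      by_cases hi : i < g.natDegree + 1
      · have := Et_mono (D4 i (by simpa using hi)) (hdm i hi)
        rwa [div_eq_inv_mul] at this
      · rw [coeff_eq_zero_of_natDegree_lt (by omega)]
        simpa using Subring.zero_mem _
    · rw [vle]
      refine (lt_of_lt hO ?_).le
      rw [map_div₀, hwe', div_one]; exact hlt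
    · simp only [eval_mul, eval_C, eval_comp, eval_X]
      rw [mul_div_cancel₀ _ he'0, hg0, mul_zero]
    · have : (C (ψ 1 * e')⁻¹ * g.comp (C e' * X)).derivative.eval (h / e') =
        f.derivative.eval η / ψ 1 := by
        simp only [derivative_mul, derivative_C, derivative_comp, derivative_X, eval_add, eval_mul,
          eval_comp, eval_C, eval_X, eval_zero, eval_one]
        rw [mul_div_cancel₀ _ he'0, hg']
        field_simp
        simp
      rw [this]
      apply v_eq_one_of_sub (map_one _)
      apply lt_of_lt hO
      have : f.derivative.eval η / ψ 1 - 1 = (f.derivative.eval η - ψ 1) / ψ 1 := by field_simp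
      rw [this, map_div₀, vone_of_subfield hκ (hψ 1) hψ1, div_one]
      exact hd1
  have : h / e = h / e' * (e' * e⁻¹) := by field_simp
  rw [this]
  exact Subring.mul_mem _ hroot (le_Et _ _ (Subring.subset_closure
    (Or.inl ⟨κ.mul_mem he' (κ.inv_mem he), hS _ (Finset.mem_insert_self _ _)⟩)))

theorem composition {O Ow : ValuationSubring L} {κ : Subfield L} (hO : O ≤ Ow)
    (hκ : ∀ c ∈ κ, c ∈ Ow)
    (hres : ∀ z ∈ Ow, ∃ c ∈ κ, Ow.valuation (z - c) < 1) (t : Finset L) (ht : (t : Set L) ⊆ Ow)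
    (Z : Finset L) (hZO : (Z : Set L) ⊆ O)
    (hZ : (Z : Set L) ⊆ Et Ow (Subring.closure ((κ : Set L) ∪ t))) :
    ∃ (t' A : Finset L), (t' : Set L) ⊆ O ∧ t'.card ≤ t.card ∧ (∀ a ∈ A, a ∈ κ ∧ a ∈ O) ∧
      (Z : Set L) ⊆ Et O (Subring.closure ((A : Set L) ∪ t')) := by
  classical
  choose! r hr hrv using hres
  let t1 : Finset L := t.image fun x => x - r x
  have h1 : ∀ x ∈ t1, Ow.valuation x < 1 := by
    intro x hx
    obtain ⟨y, hy, rfl⟩ := Finset.mem_image.1 hx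
    exact hrv y (ht hy)
  have hle : Et Ow (Subring.closure ((κ : Set L) ∪ t)) ≤ Dc O κ (t1 : Set L) Ow hκ := by
    refine Et_min ?_ (Dc_closed hO hκ (fun z hz => ⟨r z, hr z hz, hrv z hz⟩))
    rw [Subring.closure_le]
    rintro x (hx | hx)
    · exact ⟨x, hx, by simp, by simpa using Fine.zero⟩
    · refine ⟨r x, hr x (ht hx), hrv x (ht hx), ?_⟩
      intro e he he0
      obtain ⟨d, hd, hd0, hdO, hS⟩ := exists_scale (O := O) (κ := κ) {e⁻¹} (by simpa using κ.inv_mem he)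
      refine ⟨d, hd, hdO, hd0, ?_⟩
      have : (x - r x) / e = (d * e⁻¹) * ((x - r x) / d) := by field_simp
      rw [this]
      exact Subring.mul_mem _ (le_Et _ _ (Subring.subset_closure
        (Or.inl ⟨κ.mul_mem hd (κ.inv_mem he), by simpa using hS⟩))) (le_Et _ _ (Subring.subset_closure
        (Or.inr ⟨_, Finset.mem_image_of_mem _ hx, rfl⟩)))
  have h2 : ∀ z ∈ Z, ∃ d, (d ∈ κ ∧ d ∈ O ∧ d ≠ 0) ∧ z ∈ Et O (Rd O κ (t1 : Set L) d) := by
    intro z hz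
    obtain ⟨c, hc, hcv, hF⟩ := hle (hZ hz)
    obtain ⟨d, d1, d2, d3, d4⟩ := hF 1 κ.one_mem one_ne_zero
    refine ⟨d, ⟨d1, d2, d3⟩, ?_⟩
    have e : z = c + (z - c) / 1 := by ring
    rw [e]
    refine Subring.add_mem _ (le_Et _ _ (Subring.subset_closure (Or.inl ⟨hc, ?_⟩))) d4
    have : c = z - (z - c) := by ring
    rw [this]
    exact O.toSubring.sub_mem (hZO hz) (vle.2 (lt_of_lt hO hcv).le)
  choose! d hd hd' using h2
  obtain ⟨D, D1, D2, D3, D4⟩ := Rd_common (t := (t1 : Set L)) Z d hd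
  have h3 : (Z : Set L) ⊆ Et O (Subring.closure ({c | c ∈ κ ∧ c ∈ O} ∪
      ((t1.image fun x => x / D : Finset L) : Set L))) := by
    intro z hz
    have := Et_mono (D4 z hz) (hd' z hz)
    refine Et_mono (Subring.closure_mono ?_) this
    apply Set.union_subset_union_right
    rintro y ⟨x, hx, rfl⟩
    exact Finset.mem_image_of_mem _ hx
  obtain ⟨A, hA, hA'⟩ := Et_finite_gen Z h3
  refine ⟨t1.image fun x => x / D, A, ?_, Finset.card_image_le.trans Finset.card_image_le,
    fun a ha => hA ha, hA'⟩
  intro x hx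
  obtain ⟨y, hy, rfl⟩ := Finset.mem_image.1 hx
  apply vle.2 (lt_of_lt hO _).le
  rw [map_div₀, vone_of_subfield hκ D1 D3, div_one]
  exact h1 y hy

end comp
end LU

namespace LU
variable {L : Type*} [Field L]

structure Ctx (O : ValuationSubring L) (k : Subfield L) : Prop where
  hk : ∀ c ∈ k, c ∈ O
  res : ∀ z ∈ O, ∃ c ∈ k, O.valuation (z - c) < 1
  arch : ∀ a b, O.valuation a < 1 → b ≠ 0 → ∃ n : ℕ, O.valuation (a ^ n) ≤ O.valuation b

structure Frame (O : ValuationSubring L) (k : Subfield L) (R : Subring L) : Prop where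
  hkR : ∀ c ∈ k, c ∈ R
  units : ∀ z, z ≠ 0 → ∃ c, c ∈ R ∧ c⁻¹ ∈ R ∧ c ≠ 0 ∧ O.valuation c = O.valuation z

structure Mok (O : ValuationSubring L) (k : Subfield L) (p : ℕ) (M : Subfield L) : Prop where
  hkM : ∀ c ∈ k, c ∈ M
  closed : EtClosed O (M.toSubring ⊓ O.toSubring)
  vals : ∀ z, z ≠ 0 → ∃ c, c ∈ M ∧ c ≠ 0 ∧ O.valuation c = O.valuation z
  perf : ∀ z, z ^ p ∈ M → z ∈ M

theorem taylorO {O : ValuationSubring L} {f : L[X]} (hf : ∀ i, f.coeff i ∈ O) {x h : L}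
    (hx : x ∈ O) (hh : h ∈ O) :
    ∃ r ∈ O, f.eval (x + h) = f.eval x + f.derivative.eval x * h + r * h ^ 2 :=
  taylor2 (E := O.toSubring) hf hx hh

def Rhat (O : ValuationSubring L) (R : Subring L) : Subring L where
  carrier := {u | ∀ b, b ≠ 0 → ∃ q ∈ R, O.valuation (u - q) ≤ O.valuation b}
  zero_mem' := fun b _ => ⟨0, R.zero_mem, by simp⟩
  one_mem' := fun b _ => ⟨1, R.one_mem, by simp⟩
  neg_mem' := by
    intro x hx b hb
    obtain ⟨q, hq, h⟩ := hx b hb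
    refine ⟨-q, R.neg_mem hq, ?_⟩
    rw [← Valuation.map_neg]; convert h using 2; ring
  add_mem' := by
    intro x y hx hy b hb
    obtain ⟨q, hq, h⟩ := hx b hb
    obtain ⟨q', hq', h'⟩ := hy b hb
    refine ⟨q + q', R.add_mem hq hq', ?_⟩
    have : x + y - (q + q') = (x - q) + (y - q') := by ring
    rw [this]; exact Valuation.map_add_le _ h h'
  mul_mem' := by
    intro x y hx hy b hb
    by_cases hx0 : x = 0
    · exact ⟨0, R.zero_mem, by simp [hx0]⟩
    obtain ⟨q', hq', h'⟩ := hy (b / x) (div_ne_zero hb hx0)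
    have hxy : O.valuation (x * (y - q')) ≤ O.valuation b := by
      rw [map_mul]
      calc _ ≤ O.valuation x * O.valuation (b / x) := by gcongr
        _ = _ := by rw [← map_mul]; congr 1; field_simp
    by_cases hq0 : q' = 0
    · refine ⟨0, R.zero_mem, ?_⟩
      simpa [hq0] using hxy
    obtain ⟨q, hq, h⟩ := hx (b / q') (div_ne_zero hb hq0)
    refine ⟨q * q', R.mul_mem hq hq', ?_⟩
    have : x * y - q * q' = x * (y - q') + q' * (x - q) := by ring
    rw [this]
    refine Valuation.map_add_le _ hxy ?_
    rw [map_mul]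
    calc _ ≤ O.valuation q' * O.valuation (b / q') := by gcongr
      _ = _ := by rw [← map_mul]; congr 1; field_simp

theorem le_Rhat (O : ValuationSubring L) (R : Subring L) : R ≤ Rhat O R :=
  fun x hx _ _ => ⟨x, hx, by simp⟩

section
variable {O : ValuationSubring L} {k : Subfield L}

theorem Ctx.vone (hC : Ctx O k) {c : L} (hc : c ∈ k) (h0 : c ≠ 0) : O.valuation c = 1 :=
  vone_of_subfield hC.hk hc h0

theorem Ctx.res_unit (hC : Ctx O k) {z : L} (hz : O.valuation z = 1) :
    ∃ c ∈ k, c ≠ 0 ∧ O.valuation (z - c) < 1 := by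
  obtain ⟨c, hc, h⟩ := hC.res z (vle.2 hz.le)
  refine ⟨c, hc, ?_, h⟩
  rintro rfl
  rw [sub_zero, hz] at h
  exact lt_irrefl _ h

theorem Rhat_closed (hC : Ctx O k) {R : Subring L} (hR : Frame O k R) :
    EtClosed O (Rhat O R ⊓ O.toSubring) := by
  intro f hf η hη h0 h1
  refine ⟨?_, hη⟩
  obtain ⟨s, hs, hs0, hsv⟩ := hC.res_unit h1
  obtain ⟨q0, hq0, hq0v⟩ := hC.res η hη
  have hsv1 := hC.vone hs hs0
  obtain ⟨δ, hδ1, hδ2, hδ3⟩ : ∃ δ, O.valuation δ < 1 ∧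
      O.valuation (f.derivative.eval η - s) ≤ O.valuation δ ∧ O.valuation (η - q0) ≤ O.valuation δ := by
    rcases le_total (O.valuation (f.derivative.eval η - s)) (O.valuation (η - q0)) with h | h
    · exact ⟨_, hq0v, h, le_rfl⟩
    · exact ⟨_, hsv, le_rfl, h⟩
  have key : ∀ n : ℕ, ∃ q ∈ Rhat O R ⊓ O.toSubring, O.valuation (η - q) ≤ O.valuation δ ^ (n+1) := by
    intro n
    induction n with
    | zero => exact ⟨q0, ⟨le_Rhat _ _ (hR.hkR _ hq0), hC.hk _ hq0⟩, by simpa using hδ3⟩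
    | succ n ih =>
      obtain ⟨q, hq, hqv⟩ := ih
      have hqO : q ∈ O := hq.2
      obtain ⟨r, hr, hr'⟩ := taylorO (f := f) (fun i => (hf i).2) hη (O.toSubring.sub_mem hqO hη)
      have e1 : η + (q - η) = q := by ring
      rw [e1, h0] at hr'
      have hsR : s⁻¹ ∈ Rhat O R ⊓ O.toSubring :=
        ⟨le_Rhat _ _ (hR.hkR _ (k.inv_mem hs)), hC.hk _ (k.inv_mem hs)⟩
      refine ⟨q - s⁻¹ * f.eval q, Subring.sub_mem _ hq (Subring.mul_mem _ hsR (eval_mem hf hq)), ?_⟩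
      have e2 : η - (q - s⁻¹ * f.eval q) =
          s⁻¹ * ((η - q) * (r * (η - q) - (f.derivative.eval η - s))) := by
        rw [hr']; field_simp; ring
      rw [e2, map_mul, map_inv₀, hsv1, inv_one, one_mul, map_mul, pow_succ]
      have hlt : O.valuation (η - q) ≤ O.valuation δ :=
        hqv.trans (by rw [pow_succ]; exact mul_le_of_le_one_left zero_le (pow_le_one₀ zero_le hδ1.le))
      gcongr
      refine Valuation.map_sub_le _ ?_ hδ2
      rw [map_mul]
      exact (mul_le_of_le_one_left zero_le (vle.1 hr)).trans hlt
  intro b hb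
  obtain ⟨n, hn⟩ := hC.arch δ b hδ1 hb
  obtain ⟨q, hq, hqv⟩ := key n
  obtain ⟨q', hq', hqv'⟩ := hq.1 b hb
  refine ⟨q', hq', ?_⟩
  have : η - q' = (η - q) + (q - q') := by ring
  rw [this]
  refine Valuation.map_add_le _ (hqv.trans ?_) hqv'
  rw [pow_succ]
  rw [map_pow] at hn
  exact (mul_le_of_le_one_right zero_le hδ1.le).trans hn

variable (O) in
def Uof (R : Subring L) : Subring L := Et O (R ⊓ O.toSubring)

theorem Uof_le_O {R : Subring L} : Uof O R ≤ O.toSubring := Et_le_O inf_le_right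

theorem Uof_le_Rhat (hC : Ctx O k) {R : Subring L} (hR : Frame O k R) :
    Uof O R ≤ Rhat O R :=
  (Et_min (inf_le_inf_right _ (le_Rhat O R)) (Rhat_closed hC hR)).trans inf_le_left

theorem le_Uof {R : Subring L} {x : L} (h1 : x ∈ R) (h2 : x ∈ O) : x ∈ Uof O R :=
  le_Et _ _ ⟨h1, h2⟩

theorem Uof_approx (hC : Ctx O k) {R : Subring L} (hR : Frame O k R) {c : L} (hc : c ∈ R)
    (hc' : c⁻¹ ∈ R) (hc0 : c ≠ 0) (hcv : O.valuation c ≤ 1) {u : L} (hu : u ∈ Uof O R) :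
    ∃ q ∈ R, q ∈ O ∧ ∃ h ∈ Uof O R, u = q + c * h := by
  have hcU : c ∈ Uof O R := le_Uof hc (vle.2 hcv)
  rcases hcv.eq_or_lt with hcv | hcv
  · refine ⟨0, R.zero_mem, O.zero_mem, c⁻¹ * u, Subring.mul_mem _ (le_Uof hc' ?_) hu, ?_⟩
    · rw [vle, map_inv₀, hcv, inv_one]
    · field_simp; simp
  let D : Subring L :=
    { carrier := {u | u ∈ Uof O R ∧ ∃ q ∈ R, q ∈ O ∧ ∃ h ∈ Uof O R, u = q + c * h}
      zero_mem' := ⟨Subring.zero_mem _, 0, R.zero_mem, O.zero_mem, 0, Subring.zero_mem _, by simp⟩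
      one_mem' := ⟨Subring.one_mem _, 1, R.one_mem, O.one_mem, 0, Subring.zero_mem _, by simp⟩
      neg_mem' := by
        rintro x ⟨hx, q, h1, h2, h, h3, rfl⟩
        exact ⟨Subring.neg_mem _ hx, -q, R.neg_mem h1, O.neg_mem _ h2, -h, Subring.neg_mem _ h3,
          by ring⟩
      add_mem' := by
        rintro x y ⟨hx, q, h1, h2, h, h3, rfl⟩ ⟨hx', q', h1', h2', h', h3', rfl⟩
        exact ⟨Subring.add_mem _ hx hx', q + q', R.add_mem h1 h1', O.add_mem _ _ h2 h2', h + h',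
          Subring.add_mem _ h3 h3', by ring⟩
      mul_mem' := by
        rintro x y ⟨hx, q, h1, h2, h, h3, rfl⟩ ⟨hx', q', h1', h2', h', h3', rfl⟩
        exact ⟨Subring.mul_mem _ hx hx', q * q', R.mul_mem h1 h1', O.mul_mem _ _ h2 h2',
          (q + c * h) * h' + q' * h,
          Subring.add_mem _ (Subring.mul_mem _ hx h3') (Subring.mul_mem _ (le_Uof h1' h2') h3),
            by ring⟩ }
  have hPD : R ⊓ O.toSubring ≤ D := fun x hx =>
    ⟨le_Uof hx.1 hx.2, x, hx.1, hx.2, 0, Subring.zero_mem _, by simp⟩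
  suffices h : Uof O R ≤ D from (h hu).2
  refine Et_min hPD ?_
  intro f hf η hη h0 h1
  have hfU : ∀ i, f.coeff i ∈ Uof O R := fun i => (hf i).1
  have hηU : η ∈ Uof O R := Et_closed _ _ f hfU η hη h0 h1
  refine ⟨hηU, ?_⟩
  obtain ⟨q, hq, hqv⟩ := Uof_le_Rhat hC hR hηU c hc0
  have hqO : q ∈ O := by
    have : q = η - (η - q) := by ring
    rw [this]
    exact O.toSubring.sub_mem hη (vle.2 (hqv.trans hcv.le))
  obtain ⟨hfq, q1, hq1, hq1O, u', hu', he⟩ := eval_mem hf (hPD ⟨hq, hqO⟩)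
  obtain ⟨r, hr, hr'⟩ := taylorO (f := f) (fun i => Uof_le_O (hfU i)) hη (O.toSubring.sub_mem hqO hη)
  have e1 : η + (q - η) = q := by ring
  rw [e1, h0, zero_add] at hr'
  have hfv : O.valuation (f.eval q) ≤ O.valuation c := by
    have hqv' : O.valuation (q - η) ≤ O.valuation c := by rw [Valuation.map_sub_swap]; exact hqv
    rw [hr']
    refine Valuation.map_add_le _ ?_ ?_
    · rw [map_mul, h1, one_mul]; exact hqv'
    · rw [map_mul, pow_two, map_mul]
      refine (mul_le_of_le_one_left zero_le (vle.1 hr)).trans ?_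
      exact (mul_le_of_le_one_left zero_le (hqv'.trans hcv.le)).trans hqv'
  have hq1v : O.valuation q1 ≤ O.valuation c := by
    have : q1 = f.eval q - c * u' := by rw [he]; ring
    rw [this]
    refine Valuation.map_sub_le _ hfv ?_
    rw [map_mul]
    exact mul_le_of_le_one_right zero_le (vle.1 (Uof_le_O hu'))
  have hw : q1 * c⁻¹ ∈ Uof O R := by
    refine le_Uof (R.mul_mem hq1 hc') (vle.2 ?_)
    rw [map_mul, map_inv₀, ← div_eq_mul_inv]
    exact div_le_one_of_le₀ hq1v zero_le
  obtain ⟨h, hh, hh'⟩ := newton (Et_closed O (R ⊓ O.toSubring)) Uof_le_O hfU hη h0 h1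
    (le_Uof hq hqO) hcU (Subring.add_mem _ hw hu') hc0 (hqv.trans_lt hcv) (by
      rw [he]; field_simp)
  exact ⟨q, hq, hqO, h, hh, hh'⟩

theorem Uof_div (hC : Ctx O k) {R : Subring L} (hR : Frame O k R) {c : L} (hc : c ∈ R)
    (hc' : c⁻¹ ∈ R) (hc0 : c ≠ 0) {u : L} (hu : u ∈ Uof O R) (hv : O.valuation u ≤ O.valuation c) :
    u * c⁻¹ ∈ Uof O R := by
  rcases le_total (O.valuation c) 1 with hcv | hcv
  · obtain ⟨q, hq, hqO, h, hh, rfl⟩ := Uof_approx hC hR hc hc' hc0 hcv hu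
    have e : (q + c * h) * c⁻¹ = q * c⁻¹ + h := by field_simp
    rw [e]
    refine Subring.add_mem _ (le_Uof (R.mul_mem hq hc') (vle.2 ?_)) hh
    have hqv : O.valuation q ≤ O.valuation c := by
      have : q = (q + c * h) - c * h := by ring
      rw [this]
      refine Valuation.map_sub_le _ hv ?_
      rw [map_mul]
      exact mul_le_of_le_one_right zero_le (vle.1 (Uof_le_O hh))
    rw [map_mul, map_inv₀, ← div_eq_mul_inv]
    exact div_le_one_of_le₀ hqv zero_le
  · refine Subring.mul_mem _ hu (le_Uof hc' ?_)
    rw [vle, map_inv₀]; exact inv_le_one_of_one_le₀ hcv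

def Mof (hC : Ctx O k) {R : Subring L} (hR : Frame O k R) : Subfield L where
  carrier := {z | ∃ c, c ∈ R ∧ c⁻¹ ∈ R ∧ c ≠ 0 ∧ O.valuation c ≤ 1 ∧ c * z ∈ Uof O R}
  zero_mem' := ⟨1, R.one_mem, by simpa using R.one_mem, one_ne_zero, by simp,
    by simpa using Subring.zero_mem _⟩
  one_mem' := ⟨1, R.one_mem, by simpa using R.one_mem, one_ne_zero, by simp,
    by simpa using Subring.one_mem _⟩
  neg_mem' := by
    rintro x ⟨c, h1, h2, h3, h4, h5⟩
    exact ⟨c, h1, h2, h3, h4, by rw [mul_neg]; exact Subring.neg_mem _ h5⟩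
  add_mem' := by
    rintro x y ⟨c, h1, h2, h3, h4, h5⟩ ⟨c', h1', h2', h3', h4', h5'⟩
    refine ⟨c * c', R.mul_mem h1 h1', ?_, mul_ne_zero h3 h3', ?_, ?_⟩
    · rw [mul_inv]; exact R.mul_mem h2 h2'
    · rw [map_mul]; exact mul_le_one' h4 h4'
    · have : c * c' * (x + y) = c' * (c * x) + c * (c' * y) := by ring
      rw [this]
      exact Subring.add_mem _ (Subring.mul_mem _ (le_Uof h1' (vle.2 h4')) h5)
        (Subring.mul_mem _ (le_Uof h1 (vle.2 h4)) h5')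
  mul_mem' := by
    rintro x y ⟨c, h1, h2, h3, h4, h5⟩ ⟨c', h1', h2', h3', h4', h5'⟩
    refine ⟨c * c', R.mul_mem h1 h1', ?_, mul_ne_zero h3 h3', ?_, ?_⟩
    · rw [mul_inv]; exact R.mul_mem h2 h2'
    · rw [map_mul]; exact mul_le_one' h4 h4'
    · have : c * c' * (x * y) = (c * x) * (c' * y) := by ring
      rw [this]
      exact Subring.mul_mem _ h5 h5'
  inv_mem' := by
    rintro x ⟨c, h1, h2, h3, h4, h5⟩
    by_cases hx : x = 0
    · subst hx; exact ⟨c, h1, h2, h3, h4, by simpa using h5⟩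
    obtain ⟨d, d1, d2, d3, d4⟩ := hR.units (c * x) (mul_ne_zero h3 hx)
    refine ⟨d, d1, d2, d3, ?_, ?_⟩
    · rw [d4]; exact vle.1 (Uof_le_O h5)
    · have h6 := Uof_div hC hR d1 d2 d3 h5 d4.ge
      have h7 := EtClosed.inv (Et_closed O (R ⊓ O.toSubring)) h6 (by
        rw [map_mul, map_inv₀, d4]; apply mul_inv_cancel₀; simpa using ⟨h3, hx⟩)
      have : d * x⁻¹ = c * (c * x * d⁻¹)⁻¹ := by field_simp
      rw [this]
      exact Subring.mul_mem _ (le_Uof h1 (vle.2 h4)) h7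

theorem mem_Mof {hC : Ctx O k} {R : Subring L} {hR : Frame O k R} {z : L} :
    z ∈ Mof hC hR ↔ ∃ c, c ∈ R ∧ c⁻¹ ∈ R ∧ c ≠ 0 ∧ O.valuation c ≤ 1 ∧ c * z ∈ Uof O R := Iff.rfl

variable {R : Subring L}

theorem Uof_le_Mof (hC : Ctx O k) (hR : Frame O k R) {z : L} (hz : z ∈ Uof O R) :
    z ∈ Mof hC hR :=
  ⟨1, R.one_mem, by simpa using R.one_mem, one_ne_zero, by simp, by simpa using hz⟩

theorem Mof_inf (hC : Ctx O k) (hR : Frame O k R) :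
    (Mof hC hR).toSubring ⊓ O.toSubring = Uof O R := by
  apply le_antisymm
  · rintro z ⟨⟨c, h1, h2, h3, h4, h5⟩, hz⟩
    have := Uof_div hC hR h1 h2 h3 h5 (by
      rw [map_mul]; exact mul_le_of_le_one_right zero_le (vle.1 hz))
    convert this using 1; field_simp
  · exact fun z hz => ⟨Uof_le_Mof hC hR hz, Uof_le_O hz⟩

theorem le_Mof (hC : Ctx O k) (hR : Frame O k R) {r : L} (hr : r ∈ R) : r ∈ Mof hC hR := by
  rcases le_total (O.valuation r) 1 with h | h
  · exact Uof_le_Mof hC hR (le_Uof hr (vle.2 h))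
  · have hr0 : r ≠ 0 := by rintro rfl; simp at h
    obtain ⟨d, d1, d2, d3, d4⟩ := hR.units r hr0
    refine ⟨d⁻¹, d2, by simpa using d1, inv_ne_zero d3, ?_, le_Uof (R.mul_mem d2 hr) ?_⟩
    · rw [map_inv₀, d4]; exact inv_le_one_of_one_le₀ h
    · rw [vle, map_mul, map_inv₀, d4]
      exact inv_mul_le_one

theorem Mof_decomp (hC : Ctx O k) (hR : Frame O k R) {z : L} (hz : z ∈ Mof hC hR) :
    ∃ r ∈ R, ∃ u ∈ Uof O R, z = r + u := by
  obtain ⟨c, h1, h2, h3, h4, h5⟩ := hz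
  obtain ⟨q, hq, hqO, h, hh, he⟩ := Uof_approx hC hR h1 h2 h3 h4 h5
  refine ⟨q * c⁻¹, R.mul_mem hq h2, h, hh, ?_⟩
  field_simp; rw [← he, mul_comm]

theorem Mof_min (hC : Ctx O k) (hR : Frame O k R) {M' : Subfield L}
    (hM' : EtClosed O (M'.toSubring ⊓ O.toSubring)) (h : ∀ x ∈ R, x ∈ M') :
    Mof hC hR ≤ M' := by
  have : Uof O R ≤ M'.toSubring ⊓ O.toSubring := Et_min (inf_le_inf_right _ h) hM'
  rintro z ⟨c, h1, h2, h3, h4, h5⟩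
  have h6 := M'.mul_mem (h _ h2) (this h5).1
  convert h6 using 1; field_simp

theorem v_pow_eq_one {x : L} {n : ℕ} (hn : n ≠ 0) (h : O.valuation (x ^ n) = 1) :
    O.valuation x = 1 := by
  rw [map_pow] at h
  exact (pow_eq_one_iff_of_nonneg zero_le hn).1 h

theorem v_pow_le_one {x : L} {n : ℕ} (hn : n ≠ 0) : x ^ n ∈ O ↔ x ∈ O := by
  rw [vle, vle, map_pow]
  exact pow_le_one_iff_of_nonneg zero_le hn

theorem Uof_perf (p : ℕ) [ExpChar L p] [PerfectRing L p] (hperf : ∀ z, z ^ p ∈ R → z ∈ R)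
    {z : L} (hz : z ^ p ∈ Uof O R) : z ∈ Uof O R := by
  have hp : p ≠ 0 := (expChar_pos L p).ne'
  have hle : Uof O R ≤ (Uof O R).map (frobenius L p) := by
    refine Et_min ?_ ?_
    · rintro x ⟨hx, hxO⟩
      obtain ⟨y, rfl⟩ := surjective_frobenius L p x
      rw [frobenius_def] at hx hxO
      exact ⟨y, le_Uof (hperf y hx) ((v_pow_le_one hp).1 hxO), rfl⟩
    · intro f hf η hη h0 h1
      obtain ⟨θ, rfl⟩ := surjective_frobenius L p η
      have : f ∈ lifts ((frobenius L p).comp (Uof O R).subtype) := by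
        rw [lifts_iff_coeff_lifts]
        intro i
        obtain ⟨y, hy, hy'⟩ := hf i
        exact ⟨⟨y, hy⟩, hy'⟩
      obtain ⟨g, rfl⟩ := this
      rw [coe_mapRingHom, ← Polynomial.map_map] at h0 h1
      rw [eval_map_apply, frobenius_def] at h0
      rw [derivative_map, eval_map_apply, frobenius_def] at h1
      refine ⟨θ, Et_closed _ _ (g.map (Uof O R).subtype) ?_ θ ?_ (pow_eq_zero_iff hp |>.1 h0)
        (v_pow_eq_one hp h1), rfl⟩
      · intro i; rw [coeff_map]; exact (g.coeff i).2
      · exact (v_pow_le_one hp).1 hη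
  obtain ⟨y, hy, hy'⟩ := hle hz
  rw [frobenius_def] at hy'
  have := frobenius_inj L p (a₁ := y) (a₂ := z) (by simpa [frobenius_def] using hy')
  rwa [← this]

theorem Mof_ok (hC : Ctx O k) (hR : Frame O k R) (p : ℕ) [ExpChar L p] [PerfectRing L p]
    (hperf : ∀ z, z ^ p ∈ R → z ∈ R) : Mok O k p (Mof hC hR) where
  hkM := fun c hc => le_Mof hC hR (hR.hkR c hc)
  closed := by rw [Mof_inf]; exact Et_closed _ _
  vals := fun z hz => by
    obtain ⟨c, h1, h2, h3, h4⟩ := hR.units z hz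
    exact ⟨c, le_Mof hC hR h1, h3, h4⟩
  perf := by
    have hp : p ≠ 0 := (expChar_pos L p).ne'
    rintro z ⟨c, h1, h2, h3, h4, h5⟩
    obtain ⟨d, rfl⟩ := surjective_frobenius L p c
    rw [frobenius_def] at *
    rw [← mul_pow] at h5
    refine ⟨d, hperf _ h1, hperf _ (by rw [inv_pow]; exact h2), ?_, ?_, Uof_perf p hperf h5⟩
    · rintro rfl; simp [hp] at h3
    · rw [← vle] at *; exact (v_pow_le_one hp).1 h4

theorem perf_pow {S : Set L} {p : ℕ} (hperf : ∀ z, z ^ p ∈ S → z ∈ S) (n : ℕ) :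
    ∀ z, z ^ p ^ n ∈ S → z ∈ S := by
  induction n with
  | zero => intro z hz; simpa using hz
  | succ n ih =>
    intro z hz
    rw [pow_succ, pow_mul] at hz
    exact ih _ (hperf _ hz)

theorem root_mem (hC : Ctx O k) (p : ℕ) [hp : ExpChar L p] {U : Subring L}
    (hU : EtClosed O U) (hperf : ∀ z, z ^ p ∈ U → z ∈ U) {z : L} {n : ℕ} (hn : n ≠ 0)
    (hz : z ^ n ∈ U) (hv : O.valuation z = 1) : z ∈ U := by
  obtain ⟨a, m, hm, rfl⟩ : ∃ a m : ℕ, (m : L) ≠ 0 ∧ n = p ^ a * m := by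
    rcases hp with _ | ⟨hp⟩
    · exact ⟨0, n, by exact_mod_cast hn, by simp⟩
    · obtain ⟨a, m, h1, h2⟩ := Nat.exists_eq_pow_mul_and_not_dvd hn p hp.ne_one
      exact ⟨a, m, by rwa [Ne, CharP.cast_eq_zero_iff L p], h2⟩
  rw [mul_comm, pow_mul] at hz
  have hz : z ^ m ∈ U := perf_pow (S := (U : Set L)) hperf a _ hz
  have hmv : O.valuation (m : L) = 1 := hC.vone (natCast_mem k m) hm
  have hm0 : m ≠ 0 := by rintro rfl; simp at hm
  refine hU (X ^ m - C (z ^ m)) (fun i => ?_) z (vle.2 hv.le) (by simp) ?_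
  · rw [coeff_sub, coeff_X_pow, coeff_C]
    refine Subring.sub_mem _ ?_ ?_ <;> split_ifs <;>
      first | exact Subring.one_mem _ | exact Subring.zero_mem _ | exact hz
  · rw [derivative_sub, derivative_X_pow, derivative_C, sub_zero, eval_mul, eval_C, eval_pow, eval_X,
      map_mul, hmv, map_pow, hv, one_pow, one_mul]

end
end LU

namespace LU
variable {L : Type*} [Field L] {O : ValuationSubring L} {k : Subfield L}

theorem v_prod_lt {ι : Type*} {s : Finset ι} {g : ι → L} (hle : ∀ i ∈ s, O.valuation (g i) ≤ 1)
    {j : ι} (hj : j ∈ s) (hlt : O.valuation (g j) < 1) : O.valuation (∏ i ∈ s, g i) < 1 := by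
  classical
  rw [← Finset.mul_prod_erase s g hj, map_mul]
  refine mul_lt_one_of_lt_of_le hlt ?_
  rw [map_prod]
  exact Finset.prod_le_one' fun i hi => hle i (Finset.mem_of_mem_erase hi)

theorem v_prod_one {ι : Type*} {s : Finset ι} {g : ι → L} (hle : ∀ i ∈ s, O.valuation (g i) = 1) :
    O.valuation (∏ i ∈ s, g i) = 1 := by
  rw [map_prod]
  exact Finset.prod_eq_one hle

section galois
variable {M : Subfield L} (N : IntermediateField ↥M L) [FiniteDimensional ↥M ↥N] [IsGalois ↥M ↥N]

theorem mem_of_fixed {x : ↥N} (h : ∀ σ : ↥N ≃ₐ[↥M] ↥N, σ x = x) : (x : L) ∈ M := by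
  obtain ⟨y, hy⟩ := (IsGalois.mem_range_algebraMap_iff_fixed (F := ↥M) (E := ↥N) x).2 h
  rw [← hy]
  exact y.2

variable {N}
theorem galois_H (hM : EtClosed O (M.toSubring ⊓ O.toSubring)) {z : ↥N}
    (hz : ∀ σ : ↥N ≃ₐ[↥M] ↥N, (σ z : L) ∈ O) {σ₀ : ↥N ≃ₐ[↥M] ↥N} (h1 : O.valuation (σ₀ z : L) = 1) :
    ∀ σ : ↥N ≃ₐ[↥M] ↥N, O.valuation (σ z : L) = 1 := by
  classical
  let G := ↥N ≃ₐ[↥M] ↥N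
  let S : Finset G := Finset.univ.filter fun σ => O.valuation (σ z : L) = 1
  let zT : Finset G → ↥N := fun T => ∏ σ ∈ T, σ z
  let 𝒯 := Finset.powersetCard S.card (Finset.univ : Finset G)
  let F : (↥N)[X] := ∏ T ∈ 𝒯, (X - C (zT T))
  have hzT : ∀ T, ((zT T : ↥N) : L) = ∏ σ ∈ T, (σ z : L) := fun T => by
    simp [zT]
  have hzTc : ∀ (T : Finset G) (g : G → ↥N), ((∏ σ ∈ T, g σ : ↥N) : L) = ∏ σ ∈ T, (g σ : L) := by
    intro T g; simp
  have hS𝒯 : S ∈ 𝒯 := by simp [𝒯, Finset.mem_powersetCard]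
  have hFτ : ∀ τ : G, F.map (τ : ↥N →+* ↥N) = F := by
    intro τ
    simp only [F, Polynomial.map_prod, Polynomial.map_sub, map_X, map_C]
    refine Finset.prod_bij (fun T _ => T.image (fun σ => τ * σ)) ?_ ?_ ?_ ?_
    · intro T hT
      simp only [𝒯, Finset.mem_powersetCard] at hT ⊢
      refine ⟨Finset.subset_univ _, ?_⟩
      rw [Finset.card_image_of_injective _ (mul_right_injective τ)]
      exact hT.2
    · intro T _ T' _ h
      exact Finset.image_injective (mul_right_injective τ) h
    · intro T hT
      refine ⟨T.image (fun σ => τ⁻¹ * σ), ?_, ?_⟩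
      · simp only [𝒯, Finset.mem_powersetCard] at hT ⊢
        refine ⟨Finset.subset_univ _, ?_⟩
        rw [Finset.card_image_of_injective _ (mul_right_injective τ⁻¹)]
        exact hT.2
      · rw [Finset.image_image]
        have : ((fun σ => τ * σ) ∘ fun σ => τ⁻¹ * σ) = id := by ext1 σ; exact mul_inv_cancel_left τ σ
        rw [this, Finset.image_id]
    · intro T _
      congr 2
      simp only [zT]
      rw [Finset.prod_image (fun a _ b _ h => mul_right_injective τ h)]
      rw [RingHom.coe_coe, map_prod]
      rfl
  have hcM : ∀ i, ((F.coeff i : ↥N) : L) ∈ M := by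
    intro i
    apply mem_of_fixed N
    intro τ
    have := congrArg (fun g => coeff g i) (hFτ τ)
    simpa [coeff_map] using this
  let FL : L[X] := F.map (algebraMap ↥N L)
  have hFL : FL = ∏ T ∈ 𝒯, (X - C (zT T : L)) := by
    simp [FL, F, Polynomial.map_prod]
  have hzTO : ∀ T, (zT T : L) ∈ O := by
    intro T
    rw [hzT]
    exact prod_mem fun σ _ => hz σ
  have hcO : ∀ i, FL.coeff i ∈ O := by
    have : FL ∈ lifts O.subtype := by
      rw [hFL]
      refine Subsemiring.prod_mem _ fun T _ => ?_
      refine ⟨X - C ⟨zT T, hzTO T⟩, ?_⟩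
      simp
    rw [lifts_iff_coeff_lifts] at this
    intro i
    obtain ⟨y, hy⟩ := this i
    rw [← hy]; exact y.2
  have hSv : O.valuation (zT S : L) = 1 := by
    rw [hzT]
    exact v_prod_one fun σ hσ => (Finset.mem_filter.1 hσ).2
  have hW : (zT S : L) ∈ M.toSubring ⊓ O.toSubring := by
    refine hM FL (fun i => ⟨?_, hcO i⟩) _ (hzTO S) ?_ ?_
    · simp only [FL, coeff_map]; exact hcM i
    · rw [hFL, eval_prod]
      exact Finset.prod_eq_zero hS𝒯 (by simp)
    · rw [hFL, ← Finset.mul_prod_erase _ _ hS𝒯]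
      simp only [derivative_mul, derivative_sub, derivative_X, derivative_C, eval_add, eval_mul,
        eval_sub, eval_X, eval_C, sub_self, zero_mul, add_zero, sub_zero, eval_one, one_mul]
      rw [eval_prod]
      apply v_prod_one
      intro T hT
      obtain ⟨hne, hT⟩ := Finset.mem_erase.1 hT
      have hlt : O.valuation (zT T : L) < 1 := by
        obtain ⟨σ, hσ, hσS⟩ : ∃ σ ∈ T, σ ∉ S := by
          by_contra! hcon
          apply hne
          apply Finset.eq_of_subset_of_card_le hcon
          simp only [𝒯, Finset.mem_powersetCard] at hT
          rw [hT.2]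
        rw [hzT]
        refine v_prod_lt (fun i _ => vle.1 (hz i)) hσ (lt_of_le_of_ne (vle.1 (hz σ)) ?_)
        intro h
        exact hσS (Finset.mem_filter.2 ⟨Finset.mem_univ _, h⟩)
      rw [eval_sub, eval_X, eval_C]
      apply v_eq_one_of_sub hSv
      rw [sub_sub_cancel_left, Valuation.map_neg]
      exact hlt
  have hfix : ∀ τ : G, τ (zT S) = zT S := by
    intro τ
    have := τ.commutes ⟨zT S, hW.1⟩
    exact this
  have hmul : ∀ τ σ : G, σ ∈ S → O.valuation ((τ * σ) z : L) = 1 := by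
    intro τ σ hσ
    by_contra hne
    have hlt := lt_of_le_of_ne (vle.1 (hz (τ * σ))) hne
    have e : ((zT S : ↥N) : L) = ∏ σ ∈ S, ((τ * σ) z : L) := by
      rw [← hfix τ]
      simp only [zT, map_prod, hzTc]
      rfl
    rw [e] at hSv
    have := v_prod_lt (O := O) (s := S) (g := fun σ => ((τ * σ) z : L)) (fun i _ => vle.1 (hz _)) hσ hlt
    rw [hSv] at this
    exact lt_irrefl _ this
  intro σ
  have := hmul (σ * σ₀⁻¹) σ₀ (Finset.mem_filter.2 ⟨Finset.mem_univ _, h1⟩)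
  simpa using this

theorem galois_prime (hC : Ctx O k) {p : ℕ} (hM : Mok O k p M) {σ : ↥N ≃ₐ[↥M] ↥N} {ℓ : ℕ}
    (hℓ : ℓ ≠ 1) (h : orderOf σ = ℓ) (hℓ0 : ℓ ≠ 0) : (ℓ : L) = 0 := by
  classical
  have hσ : σ ≠ 1 := by rintro rfl; simp at h; exact hℓ h.symm
  obtain ⟨x, hx⟩ : ∃ x, σ x ≠ x := by
    by_contra! hcon
    exact hσ (AlgEquiv.ext hcon)
  let z := σ x - x
  have hz0 : z ≠ 0 := sub_ne_zero.2 hx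
  have hsum : ∑ i ∈ Finset.range ℓ, (σ ^ i) z = 0 := by
    have : ∀ i, (σ ^ i) z = (σ ^ (i+1)) x - (σ ^ i) x := by
      intro i
      rw [pow_succ, AlgEquiv.mul_apply, ← map_sub]
    simp only [this]
    rw [Finset.sum_range_sub (fun i => (σ ^ i) x), ← h, pow_orderOf_eq_one]
    simp
  obtain ⟨σ₀, -, hmax⟩ := Finset.exists_max_image (Finset.univ : Finset (↥N ≃ₐ[↥M] ↥N))
    (fun σ => O.valuation (σ z : L)) ⟨1, Finset.mem_univ _⟩
  have hσ₀ : (σ₀ z : L) ≠ 0 := by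
    intro h
    apply hz0
    have : σ₀ z = 0 := by exact_mod_cast h
    simpa using this
  obtain ⟨b, hb, hb0, hbv⟩ := hM.vals _ hσ₀
  let bN : ↥N := algebraMap ↥M ↥N ⟨b, hb⟩
  have hbN : ((bN : ↥N) : L) = b := rfl
  have hbσ : ∀ τ : ↥N ≃ₐ[↥M] ↥N, τ bN = bN := fun τ => τ.commutes _
  have hw : ∀ τ : ↥N ≃ₐ[↥M] ↥N, ((τ (z / bN) : ↥N) : L) = (τ z : L) / b := by
    intro τ
    rw [map_div₀, hbσ, ← hbN]; simp
  have hvb : O.valuation b ≠ 0 := by simpa using hb0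
  have h1 := galois_H hM.closed (z := z / bN) (σ₀ := σ₀) (by
    intro τ
    rw [hw, vle, map_div₀, hbv]
    exact div_le_one_of_le₀ (hmax τ (Finset.mem_univ _)) zero_le) (by
    rw [hw, map_div₀, hbv, div_self]; rw [← hbv]; exact hvb)
  have h11 := h1 1
  obtain ⟨c, hc, hc0, hcv⟩ := hC.res_unit h11
  let cN : ↥N := algebraMap ↥M ↥N ⟨c, hM.hkM c hc⟩
  have hcN : ((cN : ↥N) : L) = c := rfl
  have hcσ : ∀ τ : ↥N ≃ₐ[↥M] ↥N, τ cN = cN := fun τ => τ.commutes _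
  have hwc : ∀ τ : ↥N ≃ₐ[↥M] ↥N, ((τ (z / bN - cN) : ↥N) : L) = (τ z : L) / b - c := by
    intro τ
    rw [map_sub, hcσ, AddSubgroupClass.coe_sub, hw, hcN]
  have hO' : ∀ τ : ↥N ≃ₐ[↥M] ↥N, ((τ (z / bN - cN) : ↥N) : L) ∈ O := by
    intro τ
    rw [hwc, ← hw]
    exact O.toSubring.sub_mem (vle.2 (h1 τ).le) (hC.hk c hc)
  have h2 : ∀ τ : ↥N ≃ₐ[↥M] ↥N, O.valuation ((τ z : L) / b - c) < 1 := by
    intro τ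
    by_contra hne
    have h3 : O.valuation ((τ (z / bN - cN) : ↥N) : L) = 1 := by
      rw [hwc]
      refine le_antisymm ?_ (not_lt.1 hne)
      rw [← hwc]; exact vle.1 (hO' τ)
    have h4 := galois_H hM.closed hO' h3 1
    rw [hwc, ← hw] at h4
    exact absurd h4 hcv.ne
  have h5 : O.valuation (∑ i ∈ Finset.range ℓ, (((σ ^ i) z : L) / b - c)) < 1 :=
    Valuation.map_sum_lt _ one_ne_zero fun i _ => h2 _
  have h6 : ∑ i ∈ Finset.range ℓ, (((σ ^ i) z : L) / b - c) = -(ℓ * c) := by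
    rw [Finset.sum_sub_distrib, ← Finset.sum_div]
    have : ∑ i ∈ Finset.range ℓ, ((σ ^ i) z : L) = 0 := by
      have := congrArg (fun x : ↥N => (x : L)) hsum
      simpa using this
    rw [this]; simp
  rw [h6, Valuation.map_neg] at h5
  by_contra hne
  have := hC.vone (k.mul_mem (natCast_mem k ℓ) hc) (mul_ne_zero hne hc0)
  rw [this] at h5
  exact lt_irrefl _ h5

theorem galois_AS (hC : Ctx O k) {p : ℕ} [hp : ExpChar L p] (hM : Mok O k p M)
    (hN : N ≠ ⊥) : p.Prime ∧ ∃ y ∈ N, y ∉ M ∧ y ^ p - y ∈ M := by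
  classical
  let G := ↥N ≃ₐ[↥M] ↥N
  have hcard : Nat.card G = Module.finrank ↥M ↥N := IsGalois.card_aut_eq_finrank _ _
  have hne1 : Nat.card G ≠ 1 := by
    rw [hcard]
    intro h
    exact hN (IntermediateField.finrank_eq_one_iff.1 h)
  have hprime : ∀ {ℓ : ℕ}, ℓ.Prime → ℓ ∣ Nat.card G → (ℓ : L) = 0 := by
    intro ℓ hℓ hd
    haveI := Fact.mk hℓ
    obtain ⟨σ, hσ⟩ := exists_prime_orderOf_dvd_card' ℓ hd
    exact galois_prime hC hM hℓ.ne_one hσ hℓ.ne_zero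
  obtain ⟨ℓ, hℓ, hℓd⟩ := Nat.exists_prime_and_dvd hne1
  rcases hp with _ | ⟨hp⟩
  · exfalso
    have := hprime hℓ hℓd
    exact hℓ.ne_zero (by exact_mod_cast this)
  have hall : ∀ {q : ℕ}, q.Prime → q ∣ Nat.card G → q = p := by
    intro q hq hd
    have := hprime hq hd
    rw [CharP.cast_eq_zero_iff L p] at this
    exact ((Nat.prime_dvd_prime_iff_eq hp hq).1 this).symm
  refine ⟨hp, ?_⟩
  haveI := Fact.mk hp
  have hpow := Nat.eq_prime_pow_of_unique_prime_dvd (Nat.card_pos (α := G)).ne' hall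
  set n := (Nat.card G).primeFactorsList.length with hn
  have hn0 : n ≠ 0 := by
    intro h; rw [h, pow_zero] at hpow; exact hne1 hpow
  obtain ⟨n', hn'⟩ := Nat.exists_eq_succ_of_ne_zero hn0
  rw [hn'] at hpow
  obtain ⟨H, hH⟩ := Sylow.exists_subgroup_card_pow_prime (G := G) p (n := n')
    (by rw [hpow]; exact pow_dvd_pow _ (Nat.le_succ _))
  have hidx : H.index = p := by
    have := H.card_mul_index
    rw [hH, hpow, pow_succ] at this
    exact Nat.eq_of_mul_eq_mul_left (pow_pos hp.pos _) this
  haveI hnor : H.Normal := by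
    apply Subgroup.normal_of_index_eq_minFac_card
    rw [hidx, hpow, hp.pow_minFac (Nat.succ_ne_zero _)]
  have hcq : Nat.card (G ⧸ H) = p := by rw [← hidx]; rfl
  haveI : IsCyclic (G ⧸ H) := isCyclic_of_prime_card hcq
  let e : G ⧸ H ≃* Multiplicative (ZMod (Nat.card (G ⧸ H))) := (zmodCyclicMulEquiv inferInstance).symm
  have hp' : ∀ m, m = p → (Multiplicative (ZMod m) ≃* Multiplicative (ZMod p)) := by
    rintro m rfl; exact MulEquiv.refl _
  let χ : G →* Multiplicative (ZMod p) :=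
    (hp' _ hcq).toMonoidHom.comp (e.toMonoidHom.comp (QuotientGroup.mk' H))
  obtain ⟨τ₀, hτ₀⟩ : ∃ τ : G, τ ∉ H := by
    by_contra! hcon
    have : H = ⊤ := (Subgroup.eq_top_iff' H).2 hcon
    rw [this, Subgroup.index_top] at hidx
    exact hp.ne_one hidx.symm
  have hχτ₀ : χ τ₀ ≠ 1 := by
    intro h
    apply hτ₀
    simpa [χ] using h
  haveI : CharP ↥N p := (RingHom.charP_iff (algebraMap ↥N L) (algebraMap ↥N L).injective p).2 inferInstance
  let c : G → ↥N := fun σ => ZMod.castHom (dvd_refl p) ↥N (χ σ).toAdd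
  have hc : ∀ σ τ, c (σ * τ) = c σ + c τ := by
    intro σ τ
    simp only [c, map_mul, toAdd_mul, map_add]
  have hcp : ∀ σ, c σ ^ p = c σ := by
    intro σ
    simp only [c]
    rw [← map_pow, ZMod.pow_card]
  have hcτ : ∀ σ (τ : G), τ (c σ) = c σ := by
    intro σ τ
    have : (τ : ↥N →+* ↥N).comp (ZMod.castHom (dvd_refl p) ↥N) = ZMod.castHom (dvd_refl p) ↥N :=
      Subsingleton.elim _ _
    exact congrArg (fun f => f (χ σ).toAdd) this
  have hc0 : c τ₀ ≠ 0 := by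
    simp only [c]
    rw [_root_.map_ne_zero]
    exact fun h => hχτ₀ (by simpa using h)
  obtain ⟨θ, hθ⟩ := Algebra.trace_surjective ↥M ↥N 1
  have hθ' : ∑ σ : G, σ θ = 1 := by
    have := trace_eq_sum_automorphisms (K := ↥M) (L := ↥N) θ
    rw [hθ, map_one] at this
    exact this.symm
  let y : ↥N := -∑ σ : G, c σ * σ θ
  have hy : ∀ τ : G, τ y = y + c τ := by
    intro τ
    simp only [y, map_neg, map_sum, map_mul, hcτ]
    have h1 : ∑ σ : G, c σ * τ (σ θ) = ∑ σ : G, (c (τ * σ) - c τ) * (τ * σ) θ := by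
      refine Finset.sum_congr rfl fun σ _ => ?_
      rw [hc, AlgEquiv.mul_apply]; ring
    have h2 := Equiv.sum_comp (Equiv.mulLeft τ) (fun σ => (c σ - c τ) * σ θ)
    simp only [Equiv.coe_mulLeft] at h2
    rw [h1, h2]
    simp only [sub_mul, Finset.sum_sub_distrib, ← Finset.mul_sum, hθ']
    ring
  refine ⟨y, y.2, ?_, ?_⟩
  · intro hyM
    have h1 : τ₀ y = y := τ₀.commutes ⟨y, hyM⟩
    rw [hy] at h1
    exact hc0 (by simpa using h1)
  · have : ((y ^ p - y : ↥N) : L) ∈ M := by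
      apply mem_of_fixed N
      intro τ
      rw [map_sub, map_pow, hy, add_pow_char, hcp]
      ring
    simpa using this

end galois
end LU

namespace LU
variable {L : Type*} [Field L] {O : ValuationSubring L} {k : Subfield L}

theorem mem_adjoin_iff {M : Subfield L} {S : Set L} {x : L} :
    x ∈ IntermediateField.adjoin ↥M S ↔ x ∈ Subfield.closure ((M : Set L) ∪ S) := by
  have : Set.range (algebraMap ↥M L) = (M : Set L) := by
    ext y; constructor
    · rintro ⟨z, rfl⟩; exact z.2
    · intro hy; exact ⟨⟨y, hy⟩, rfl⟩
  rw [← this]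
  rfl

theorem adjoin_mono_base {M M' : Subfield L} (h : M ≤ M') {S : Set L} {x : L}
    (hx : x ∈ IntermediateField.adjoin ↥M S) : x ∈ IntermediateField.adjoin ↥M' S := by
  rw [mem_adjoin_iff] at *
  exact Subfield.closure_mono (Set.union_subset_union_left _ h) hx

theorem perfectField_of [IsAlgClosed L] {p : ℕ} [hp : ExpChar L p] {M : Subfield L}
    (hperf : ∀ z, z ^ p ∈ M → z ∈ M) : PerfectField ↥M := by
  haveI : ExpChar ↥M p := (algebraMap ↥M L).expChar (algebraMap ↥M L).injective p
  haveI : PerfectRing ↥M p := by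
    apply PerfectRing.ofSurjective
    intro x
    obtain ⟨y, hy⟩ := surjective_frobenius L p (x : L)
    refine ⟨⟨y, hperf y ?_⟩, Subtype.ext hy⟩
    rw [frobenius_def] at hy
    rw [hy]; exact x.2
  exact PerfectRing.toPerfectField ↥M p

theorem AS_tower_aux [IsAlgClosed L] (hC : Ctx O k) {p : ℕ} [hp : ExpChar L p]
    (𝓜 : Set (Subfield L)) (hok : ∀ M ∈ 𝓜, Mok O k p M)
    (step : p.Prime → ∀ M ∈ 𝓜, ∀ y, y ∉ M → y ^ p - y ∈ M → ∃ M' ∈ 𝓜, M ≤ M' ∧ y ∈ M')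
    (θ : L) (h : L[X]) (h0 : h ≠ 0) (n : ℕ) :
    ∀ M ∈ 𝓜, (∀ i, h.coeff i ∈ M) → (∀ x, h.eval x = 0 → x ∈ IntermediateField.adjoin ↥M {θ}) →
      (θ ∈ IntermediateField.adjoin ↥M {x | h.eval x = 0}) →
      ∀ g : (↥M)[X], g.Monic → aeval θ g = 0 → g.natDegree ≤ n → ∃ M' ∈ 𝓜, M ≤ M' ∧ θ ∈ M' := by
  induction n using Nat.strong_induction_on with
  | _ n ih =>
  intro M hM hcoef hroots hθ g hg hgθ hgn
  have hMok := hok M hM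
  haveI := perfectField_of hMok.perf
  let N : IntermediateField ↥M L := IntermediateField.adjoin ↥M {θ}
  have hint : IsIntegral ↥M θ := ⟨g, hg, hgθ⟩
  haveI : FiniteDimensional ↥M ↥N := IntermediateField.adjoin.finiteDimensional hint
  obtain ⟨hh, hhh⟩ : ∃ H : (↥M)[X], H.map (algebraMap ↥M L) = h := by
    have : h ∈ lifts (algebraMap ↥M L) := by
      rw [lifts_iff_coeff_lifts]; intro i; exact ⟨⟨_, hcoef i⟩, rfl⟩
    exact this
  have hh0 : hh ≠ 0 := by rintro rfl; simp at hhh; exact h0 hhh.symm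
  have hrs : hh.rootSet L = {x | h.eval x = 0} := by
    ext x
    rw [mem_rootSet_of_ne hh0, Set.mem_ofPred_eq, ← hhh, eval_map_algebraMap]
  haveI : hh.IsSplittingField ↥M ↥N := by
    rw [IntermediateField.isSplittingField_iff]
    constructor
    · rw [IntermediateField.splits_iff_mem (IsAlgClosed.splits _)]
      intro x hx
      apply hroots
      have hx' : x ∈ hh.rootSet L := hx
      rw [hrs] at hx'; exact hx'
    · rw [hrs]
      apply le_antisymm
      · rw [IntermediateField.adjoin_le_iff]; rintro x rfl; exact hθ
      · rw [IntermediateField.adjoin_le_iff]; exact hroots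
  haveI : Normal ↥M ↥N := Normal.of_isSplittingField hh
  haveI : IsGalois ↥M ↥N := ⟨⟩
  by_cases hN : N = ⊥
  · refine ⟨M, hM, le_rfl, ?_⟩
    have : θ ∈ N := IntermediateField.mem_adjoin_simple_self _ _
    rw [hN, IntermediateField.mem_bot] at this
    obtain ⟨y, rfl⟩ := this
    exact y.2
  obtain ⟨hpp, y, hyN, hyM, hy⟩ := galois_AS hC hMok hN
  obtain ⟨M', hM', hle, hyM'⟩ := step hpp M hM y hyM hy
  have hyq : ∃ q : (↥M)[X], aeval θ q = y := by
    have : y ∈ N.toSubalgebra := hyN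
    rw [IntermediateField.adjoin_simple_toSubalgebra_of_isAlgebraic hint.isAlgebraic,
      Algebra.adjoin_singleton_eq_range_aeval] at this
    exact this
  obtain ⟨q0, hq0⟩ := hyq
  have hg1 : g ≠ 1 := by rintro rfl; simp at hgθ
  obtain ⟨q, hq, hqdeg⟩ : ∃ q : (↥M)[X], aeval θ q = y ∧ q.natDegree < g.natDegree := by
    refine ⟨q0 %ₘ g, ?_, natDegree_modByMonic_lt _ hg hg1⟩
    rw [← hq0]
    conv_rhs => rw [← modByMonic_add_div q0 g]
    simp [hgθ]
  let ι : ↥M →+* ↥M' := Subfield.inclusion hle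
  let Q : (↥M')[X] := q.map ι - C ⟨y, hyM'⟩
  have hQ0 : Q ≠ 0 := by
    intro hz
    have h1 : q.map ι = C ⟨y, hyM'⟩ := sub_eq_zero.1 hz
    have h2 := congrArg (fun f => coeff f 0) h1
    simp only [coeff_map, coeff_C_zero] at h2
    apply hyM
    have h3 := congrArg (fun x : ↥M' => (x : L)) h2
    change ((q.coeff 0 : ↥M) : L) = y at h3
    rw [← h3]; exact (q.coeff 0).2
  have hQdeg : Q.natDegree ≤ q.natDegree := by
    refine (natDegree_sub_le _ _).trans ?_
    simp [natDegree_map_eq_of_injective ι.injective]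
  have hQθ : aeval θ Q = 0 := by
    have h1 : aeval θ (q.map ι) = aeval θ q := by
      rw [aeval_def, eval₂_map, aeval_def]; rfl
    simp only [Q, map_sub, h1, hq, aeval_C]
    exact sub_self y
  obtain ⟨M'', hM'', hle', hθ''⟩ := ih (Q * C Q.leadingCoeff⁻¹).natDegree (by
      rw [natDegree_mul_C (inv_ne_zero (leadingCoeff_ne_zero.2 hQ0))]
      omega) M' hM' (fun i => hle (hcoef i)) (fun x hx => adjoin_mono_base hle (hroots x hx))
      (adjoin_mono_base hle hθ) _ (monic_mul_leadingCoeff_inv hQ0) (by simp [hQθ]) le_rfl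
  exact ⟨M'', hM'', hle.trans hle', hθ''⟩

theorem AS_tower [IsAlgClosed L] (hC : Ctx O k) {p : ℕ} [hp : ExpChar L p]
    (𝓜 : Set (Subfield L)) (hok : ∀ M ∈ 𝓜, Mok O k p M)
    (step : p.Prime → ∀ M ∈ 𝓜, ∀ y, y ∉ M → y ^ p - y ∈ M → ∃ M' ∈ 𝓜, M ≤ M' ∧ y ∈ M')
    {M : Subfield L} (hM : M ∈ 𝓜) {z : L} (hz : IsAlgebraic ↥M z) : ∃ M' ∈ 𝓜, M ≤ M' ∧ z ∈ M' := by
  have hMok := hok M hM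
  haveI := perfectField_of hMok.perf
  have hint := hz.isIntegral
  let f := minpoly ↥M z
  have hf0 : f ≠ 0 := minpoly.ne_zero hint
  let N : IntermediateField ↥M L := IntermediateField.adjoin ↥M (f.rootSet L)
  haveI : FiniteDimensional ↥M ↥N := by
    haveI : Finite ↑(f.rootSet L) := (rootSet_finite f L)
    apply IntermediateField.finiteDimensional_adjoin
    intro x hx
    rw [mem_rootSet_of_ne hf0] at hx
    exact IsAlgebraic.isIntegral ⟨f, hf0, hx⟩
  obtain ⟨θ, hθ⟩ := Field.exists_primitive_element ↥M ↥N
  have hθN : IntermediateField.adjoin ↥M {(θ : L)} = N := by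
    have := congrArg IntermediateField.lift hθ
    rw [IntermediateField.lift_adjoin_simple, IntermediateField.lift_top] at this
    exact this
  have hrs : f.rootSet L = {x | (f.map (algebraMap ↥M L)).eval x = 0} := by
    ext x
    rw [mem_rootSet_of_ne hf0, Set.mem_ofPred_eq, eval_map_algebraMap]
  have hθint : IsIntegral ↥M (θ : L) := (IsIntegral.of_finite ↥M θ).map N.val
  obtain ⟨M', hM', hle, hm⟩ := AS_tower_aux hC 𝓜 hok step (θ : L) (f.map (algebraMap ↥M L))
    ((Polynomial.map_ne_zero_iff (algebraMap ↥M L).injective).2 hf0) _ M hM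
    (fun i => by rw [coeff_map]; exact (f.coeff i).2)
    (fun x hx => by
      rw [hθN]; apply IntermediateField.subset_adjoin; rw [hrs]; exact hx)
    (by rw [← hrs]; exact θ.2) (minpoly ↥M (θ : L)) (minpoly.monic hθint) (minpoly.aeval _ _) le_rfl
  refine ⟨M', hM', hle, ?_⟩
  have hzN : z ∈ IntermediateField.adjoin ↥M {(θ : L)} := by
    rw [hθN]
    apply IntermediateField.subset_adjoin
    rw [mem_rootSet_of_ne hf0]
    exact minpoly.aeval _ _
  rw [mem_adjoin_iff] at hzN
  have : Subfield.closure ((M : Set L) ∪ {(θ : L)}) ≤ M' := by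
    rw [Subfield.closure_le]
    rintro x (hx | hx)
    · exact hle hx
    · rw [Set.mem_singleton_iff.1 hx]; exact hm
  exact this hzN

theorem AS_tower_finset [IsAlgClosed L] (hC : Ctx O k) {p : ℕ} [hp : ExpChar L p]
    (𝓜 : Set (Subfield L)) (hok : ∀ M ∈ 𝓜, Mok O k p M)
    (step : p.Prime → ∀ M ∈ 𝓜, ∀ y, y ∉ M → y ^ p - y ∈ M → ∃ M' ∈ 𝓜, M ≤ M' ∧ y ∈ M')
    {M : Subfield L} (hM : M ∈ 𝓜) (Z : Finset L) (hZ : ∀ z ∈ Z, IsAlgebraic ↥M z) :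
    ∃ M' ∈ 𝓜, M ≤ M' ∧ (Z : Set L) ⊆ M' := by
  classical
  induction Z using Finset.induction_on with
  | empty => exact ⟨M, hM, le_rfl, by simp⟩
  | insert a Z _ ih =>
    obtain ⟨M', hM', hle, hZ'⟩ := ih fun z hz => hZ z (by simp [hz])
    have ha : IsAlgebraic ↥M' a := by
      obtain ⟨f, hf, hfa⟩ := hZ a (by simp)
      let ι : ↥M →+* ↥M' := Subfield.inclusion hle
      refine ⟨f.map ι, (Polynomial.map_ne_zero_iff ι.injective).2 hf, ?_⟩
      rw [aeval_def, eval₂_map]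
      exact hfa
    obtain ⟨M'', hM'', hle', ha'⟩ := AS_tower hC 𝓜 hok step hM' ha
    refine ⟨M'', hM'', hle.trans hle', ?_⟩
    intro x hx
    rcases Finset.mem_insert.1 hx with rfl | hx
    · exact ha'
    · exact hle' (hZ' hx)

end LU

namespace LU

def Cone {V : Type*} [AddCommGroup V] [Module ℚ V] {r : ℕ} (b : Fin r → V) (x : V) : Prop :=
  ∃ q : Fin r → ℚ, (∀ i, 0 ≤ q i) ∧ x = ∑ i, q i • b i

section
variable {V : Type*} [AddCommGroup V] [Module ℚ V] {r : ℕ}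

theorem Cone.mono {b b' : Fin r → V} (h : ∀ i, Cone b' (b i)) {x : V} (hx : Cone b x) :
    Cone b' x := by
  choose A hA hAb using h
  obtain ⟨q, hq, rfl⟩ := hx
  refine ⟨fun j => ∑ i, q i * A i j, fun j => Finset.sum_nonneg fun i _ => mul_nonneg (hq i) (hA i j), ?_⟩
  calc ∑ i, q i • b i = ∑ i, ∑ j, (q i * A i j) • b' j := by
        refine Finset.sum_congr rfl fun i _ => ?_
        conv_lhs => rw [hAb i]
        rw [Finset.smul_sum]
        simp [mul_smul]
    _ = _ := by rw [Finset.sum_comm]; simp [Finset.sum_smul]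

theorem Cone.self (b : Fin r → V) (i : Fin r) : Cone b (b i) :=
  ⟨Pi.single i 1, fun j => by by_cases h : j = i <;> simp [Pi.single_apply, h],
    by simp [Pi.single_apply, ite_smul]⟩

theorem Cone.add {b : Fin r → V} {x y : V} (hx : Cone b x) (hy : Cone b y) : Cone b (x + y) := by
  obtain ⟨q, hq, rfl⟩ := hx
  obtain ⟨q', hq', rfl⟩ := hy
  exact ⟨fun i => q i + q' i, fun i => add_nonneg (hq i) (hq' i), by
    simp [add_smul, Finset.sum_add_distrib]⟩

theorem Cone.smul {b : Fin r → V} {x : V} (hx : Cone b x) {c : ℚ} (hc : 0 ≤ c) : Cone b (c • x) := by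
  obtain ⟨q, hq, rfl⟩ := hx
  exact ⟨fun i => c * q i, fun i => mul_nonneg hc (hq i), by
    simp [mul_smul, Finset.smul_sum]⟩

structure PosP (P : V → Prop) : Prop where
  add : ∀ a b, P a → P b → P (a + b)
  smul : ∀ (c : ℚ) a, 0 ≤ c → P a → P (c • a)
  total : ∀ a, P a ∨ P (-a)
  anti : ∀ a, P a → P (-a) → a = 0

theorem repl {P : V → Prop} {b : Fin r → V} (hb : ∀ i, P (b i)) {i j : Fin r} (hij : i ≠ j)
    {c : ℚ} (hc : 0 ≤ c) (h : P (b i - c • b j)) :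
    let b' := Function.update b i (b i - c • b j)
    (∀ l, P (b' l)) ∧ (∀ l, Cone b' (b l)) ∧
    ∀ q : Fin r → ℚ, ∑ l, q l • b l =
      ∑ l, (Function.update q j (q j + q i * c)) l • b' l := by
  classical
  intro b'
  have hbi : b' i = b i - c • b j := by simp [b']
  have hbl : ∀ l, l ≠ i → b' l = b l := fun l hl => by simp [b', hl]
  refine ⟨?_, ?_, ?_⟩
  · intro l
    by_cases hl : l = i
    · subst hl; rw [hbi]; exact h
    · rw [hbl l hl]; exact hb l
  · intro l
    by_cases hl : l = i
    · subst hl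
      have : b l = b' l + c • b' j := by rw [hbi, hbl j hij.symm]; abel
      rw [this]
      exact (Cone.self _ _).add ((Cone.self _ _).smul hc)
    · rw [← hbl l hl]; exact Cone.self _ _
  · intro q
    have h1 : ∀ l, (Function.update q j (q j + q i * c)) l • b' l
        = q l • b l + ((if l = j then (q i * c) • b j else 0) - (if l = i then (q i * c) • b j else 0)) := by
      intro l
      by_cases hl : l = i
      · subst hl
        rw [Function.update_of_ne hij, hbi, if_neg hij, if_pos rfl, smul_sub, mul_smul]; abel
      · rw [hbl l hl, if_neg hl]
        by_cases hl' : l = j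
        · subst hl'; simp [add_smul]
        · simp [hl']
    simp only [h1, Finset.sum_add_distrib, Finset.sum_sub_distrib, Finset.sum_ite_eq',
      Finset.mem_univ, if_true, sub_self, add_zero]

theorem toric_one {P : V → Prop} (hP : PosP P) (n : ℕ) : ∀ (b : Fin r → V), (∀ i, P (b i)) →
    ∀ (q : Fin r → ℚ), (Finset.univ.filter fun i => q i ≠ 0).card ≤ n → P (∑ i, q i • b i) →
    ∃ b' : Fin r → V, (∀ i, P (b' i)) ∧ (∀ i, Cone b' (b i)) ∧ Cone b' (∑ i, q i • b i) := by
  classical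
  have P0 : P 0 := by rcases hP.total 0 with h | h <;> simpa using h
  have hsum : ∀ (b : Fin r → V), (∀ i, P (b i)) → ∀ x, Cone b x → P x := by
    rintro b hb _ ⟨q, hq, rfl⟩
    exact Finset.sum_induction _ P hP.add P0 fun i _ => hP.smul _ _ (hq i) (hb i)
  induction n with
  | zero =>
    intro b hb q hq hz
    refine ⟨b, hb, Cone.self b, q, fun i => ?_, rfl⟩
    simp only [Nat.le_zero, Finset.card_eq_zero, Finset.filter_eq_empty_iff] at hq
    have := hq (Finset.mem_univ i)
    push Not at this
    exact this.ge
  | succ n ih =>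
    intro b hb q hq hz
    by_cases h1 : ∀ i, 0 ≤ q i
    · exact ⟨b, hb, Cone.self b, q, h1, rfl⟩
    by_cases h2 : ∀ i, q i ≤ 0
    · refine ⟨b, hb, Cone.self b, fun _ => 0, fun _ => le_rfl, ?_⟩
      have : P (-∑ i, q i • b i) := hsum b hb _ ⟨fun i => - q i, fun i => by simpa using h2 i, by simp⟩
      simp [hP.anti _ hz this]
    push Not at h1 h2
    obtain ⟨j, hj⟩ := h1
    obtain ⟨i, hi⟩ := h2
    have hij : i ≠ j := by rintro rfl; exact absurd hi (by linarith)
    have key : ∀ i j : Fin r, i ≠ j → q i ≠ 0 → q j ≠ 0 → 0 ≤ - q j / q i →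
        P (b i - (- q j / q i) • b j) →
        ∃ b' : Fin r → V, (∀ i, P (b' i)) ∧ (∀ i, Cone b' (b i)) ∧ Cone b' (∑ i, q i • b i) := by
      intro i j hij hi hj hc h
      obtain ⟨h1, h2, h3⟩ := repl hb hij hc h
      obtain ⟨b'', g1, g2, g3⟩ := ih _ h1 (Function.update q j (q j + q i * (- q j / q i))) (by
        have hz : q j + q i * (- q j / q i) = 0 := by field_simp; ring
        rw [hz]
        have : (Finset.univ.filter fun l => Function.update q j 0 l ≠ 0) ⊂
            (Finset.univ.filter fun i => q i ≠ 0) := by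
          rw [Finset.ssubset_iff]
          refine ⟨j, by simp, ?_⟩
          intro l hl
          simp only [Finset.mem_insert, Finset.mem_filter, Finset.mem_univ, true_and] at hl ⊢
          rcases hl with rfl | hl
          · exact hj
          · by_cases hlj : l = j
            · subst hlj; exact hj
            · simpa [hlj] using hl
        have := Finset.card_lt_card this
        omega) (by rw [← h3]; exact hz)
      rw [← h3] at g3
      exact ⟨b'', g1, fun l => (h2 l).mono g2, g3⟩
    rcases hP.total (b i - (- q j / q i) • b j) with h | h
    · exact key i j hij hi.ne' hj.ne (div_nonneg (by linarith) hi.le) h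
    · refine key j i hij.symm hj.ne hi.ne' (by
        rw [neg_div, ← div_neg]; exact div_nonneg hi.le (by linarith)) ?_
      have := hP.smul (- q i / q j) _ (by
        rw [neg_div, ← div_neg]; exact div_nonneg hi.le (by linarith)) h
      convert this using 1
      have hi0 := hi.ne'
      have hj0 := hj.ne
      rw [smul_neg, smul_sub, smul_smul]
      have : (- q i / q j) * (- q j / q i) = 1 := by field_simp
      rw [this, one_smul]; abel

theorem toric [FiniteDimensional ℚ V] {P : V → Prop} (hP : PosP P) (S : Finset V)
    (hS : ∀ a ∈ S, P a) :
    ∃ b : Fin (Module.finrank ℚ V) → V, (∀ i, P (b i)) ∧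
      ∀ a ∈ S, ∃ n : Fin (Module.finrank ℚ V) → ℕ, a = ∑ i, n i • b i := by
  classical
  have h1 : ∃ b : Fin (Module.finrank ℚ V) → V, (∀ i, P (b i)) ∧
      (∀ x, ∃ q : Fin (Module.finrank ℚ V) → ℚ, x = ∑ i, q i • b i) ∧ ∀ a ∈ S, Cone b a := by
    induction S using Finset.induction_on with
    | empty =>
      let B := Module.finBasis ℚ V
      refine ⟨fun i => if P (B i) then B i else - B i, ?_, ?_, by simp⟩
      · intro i
        dsimp only
        split_ifs with h
        · exact h
        · exact (hP.total _).resolve_left h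
      · intro x
        refine ⟨fun i => if P (B i) then B.repr x i else - B.repr x i, ?_⟩
        conv_lhs => rw [← B.sum_repr x]
        refine Finset.sum_congr rfl fun i _ => ?_
        dsimp only
        split_ifs <;> simp
    | insert a S _ ih =>
      obtain ⟨b, hb, hsp, hc⟩ := ih fun x hx => hS x (by simp [hx])
      obtain ⟨q, hq⟩ := hsp a
      obtain ⟨b', h1, h2, h3⟩ := toric_one hP _ b hb q le_rfl (by rw [← hq]; exact hS a (by simp))
      refine ⟨b', h1, ?_, ?_⟩
      · intro x
        obtain ⟨q', rfl⟩ := hsp x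
        choose A hA hAb using h2
        refine ⟨fun j => ∑ i, q' i * A i j, ?_⟩
        calc ∑ i, q' i • b i = ∑ i, ∑ j, (q' i * A i j) • b' j := by
              refine Finset.sum_congr rfl fun i _ => ?_
              conv_lhs => rw [hAb i]
              rw [Finset.smul_sum]
              simp [mul_smul]
          _ = _ := by rw [Finset.sum_comm]; simp [Finset.sum_smul]
      · intro x hx
        rcases Finset.mem_insert.1 hx with rfl | hx
        · rw [hq]; exact h3
        · exact (hc x hx).mono h2
  obtain ⟨b, hb, -, hc⟩ := h1
  have hc' : ∀ a, ∃ q : Fin (Module.finrank ℚ V) → ℚ, a ∈ S → (∀ i, 0 ≤ q i) ∧ a = ∑ i, q i • b i := by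
    intro a
    by_cases h : a ∈ S
    · obtain ⟨q, hq⟩ := hc a h; exact ⟨q, fun _ => hq⟩
    · exact ⟨0, fun h' => absurd h' h⟩
  choose q hq using hc'
  let N : ℕ := ∏ a ∈ S, ∏ i, (q a i).den
  have hN : (N : ℚ) ≠ 0 := by
    simp only [N]
    exact_mod_cast Finset.prod_ne_zero_iff.2 fun a _ => Finset.prod_ne_zero_iff.2 fun i _ => (q a i).den_ne_zero
  refine ⟨fun i => (1 / (N : ℚ)) • b i, fun i => hP.smul _ _ (by positivity) (hb i), ?_⟩
  intro a ha
  obtain ⟨h0, h1⟩ := hq a ha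
  have : ∀ i, ∃ n : ℕ, q a i = n * (1 / (N : ℚ)) := by
    intro i
    have hd : (q a i).den ∣ N :=
      (Finset.dvd_prod_of_mem (fun i => (q a i).den) (Finset.mem_univ i)).trans
        (Finset.dvd_prod_of_mem (fun a => ∏ i, (q a i).den) ha)
    obtain ⟨m, hm⟩ := hd
    refine ⟨(q a i).num.toNat * m, ?_⟩
    have hnum : (((q a i).num.toNat : ℕ) : ℚ) = (q a i).num := by
      have := Int.toNat_of_nonneg (Rat.num_nonneg.2 (h0 i))
      exact_mod_cast this
    rw [mul_one_div, eq_div_iff hN]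
    push_cast
    rw [hnum, hm]
    push_cast
    rw [← mul_assoc, Rat.mul_den_eq_num]
  choose n hn using this
  refine ⟨n, ?_⟩
  conv_lhs => rw [h1]
  refine Finset.sum_congr rfl fun i _ => ?_
  rw [hn i, mul_smul, Nat.cast_smul_eq_nsmul]
end

theorem exists_psi {L : Type*} [Field L] [IsAlgClosed L] (u : L) (hu : u ≠ 0) :
    ∃ ψ : ℚ → L, ψ 1 = u ∧ ψ 0 = 1 ∧ ∀ a b, ψ (a + b) = ψ a * ψ b := by
  letI : DivisibleBy (Additive Lˣ) ℤ := AddCommGroup.divisibleByIntOfSMulTopEqTop _ (by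
    intro n hn
    rw [eq_top_iff]
    rintro x -
    have : ∃ y : Lˣ, y ^ n = x.toMul := by
      obtain ⟨y, hy⟩ := IsAlgClosed.exists_pow_nat_eq ((x.toMul : Lˣ) : L) (Int.natAbs_pos.2 hn)
      have hy0 : y ≠ 0 := by
        rintro rfl
        rw [zero_pow (Int.natAbs_pos.2 hn).ne'] at hy
        exact (Units.ne_zero _) hy.symm
      rcases Int.natAbs_eq n with h | h
      · refine ⟨Units.mk0 y hy0, Units.ext ?_⟩
        rw [h, zpow_natCast, Units.val_pow_eq_pow_val]; exact hy
      · refine ⟨(Units.mk0 y hy0)⁻¹, Units.ext ?_⟩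
        rw [h, zpow_neg, inv_zpow, inv_inv, zpow_natCast, Units.val_pow_eq_pow_val]; exact hy
    obtain ⟨y, hy⟩ := this
    exact ⟨Additive.ofMul y, trivial, congrArg Additive.ofMul hy⟩)
  let f : ℤ →+ Additive Lˣ := zmultiplesHom _ (Additive.ofMul (Units.mk0 u hu))
  obtain ⟨g, hg⟩ := (Module.Baer.of_divisible (Additive Lˣ)).extension_property_addMonoidHom
    (Int.castAddHom ℚ) (Int.cast_injective) f
  refine ⟨fun q => ((g q).toMul : Lˣ), ?_, by simp, by simp⟩
  have := DFunLike.congr_fun hg 1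
  simp [f] at this
  simp [this]

end LU

namespace LU
variable {L : Type*} [Field L] {O : ValuationSubring L} {k : Subfield L}

theorem AS_mem {E : Subring L} (hE : EtClosed O E) (hEO : E ≤ O.toSubring) {p : ℕ} (hp : p.Prime)
    (hp0 : (p : L) = 0) {y : L} (hy : y ^ p - y ∈ E) : y ∈ E := by
  have hyO : y ∈ O := by
    rw [vle]
    by_contra h
    push Not at h
    have h1 : O.valuation y < O.valuation (y ^ p) := by
      rw [map_pow]
      exact lt_self_pow₀ h hp.one_lt
    have h2 : O.valuation (y ^ p - y) = O.valuation (y ^ p) := Valuation.map_sub_eq_of_lt_left _ h1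
    have h3 := vle.1 (hEO hy)
    rw [h2] at h3
    exact absurd (h.trans h1) (not_lt.2 h3)
  refine hE (X ^ p - X - C (y ^ p - y)) ?_ y hyO (by simp) ?_
  · intro i
    simp only [coeff_sub, coeff_X_pow, coeff_X, coeff_C]
    refine Subring.sub_mem _ (Subring.sub_mem _ ?_ ?_) ?_ <;> split_ifs <;>
      first | exact Subring.zero_mem _ | exact Subring.one_mem _ | exact hy
  · have : derivative (X ^ p - X - C (y ^ p - y)) = -1 := by
      simp only [derivative_sub, derivative_X_pow, derivative_X, derivative_C, hp0, C_0]
      ring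
    rw [this]; simp

theorem AS_surj [IsAlgClosed L] {p : ℕ} (hp : p.Prime) (u : L) : ∃ w : L, w ^ p - w = u := by
  obtain ⟨w, hw⟩ := IsAlgClosed.exists_root (X ^ p - X - C u : L[X]) (by
    have h1 : (X ^ p - X - C u : L[X]).degree = p := by
      rw [sub_sub]
      rw [degree_sub_eq_left_of_degree_lt, degree_X_pow]
      rw [degree_X_pow, degree_X_add_C]; exact_mod_cast hp.one_lt
    rw [h1]; exact_mod_cast hp.pos.ne')
  refine ⟨w, ?_⟩
  simp [IsRoot] at hw
  exact sub_eq_zero.1 hw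

section
variable {V : Type*} [AddCommGroup V] [Module ℚ V]

structure Chi (O : ValuationSubring L) (χ : V → L) : Prop where
  zero : χ 0 = 1
  add : ∀ a b, χ (a + b) = χ a * χ b
  inj : ∀ a, O.valuation (χ a) = 1 → a = 0
  surj : ∀ z, z ≠ 0 → ∃ a, O.valuation (χ a) = O.valuation z

def Rchi (k : Subfield L) (χ : V → L) : Subring L := (Algebra.adjoin ↥k (Set.range χ)).toSubring

namespace Chi
variable {χ : V → L}

theorem neg_mul (h : Chi O χ) (a : V) : χ (-a) * χ a = 1 := by
  rw [← h.add, neg_add_cancel, h.zero]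

theorem ne_zero (h : Chi O χ) (a : V) : χ a ≠ 0 := right_ne_zero_of_mul_eq_one (h.neg_mul a)

theorem inv (h : Chi O χ) (a : V) : (χ a)⁻¹ = χ (-a) := by
  rw [inv_eq_iff_eq_inv]
  exact eq_inv_of_mul_eq_one_right (h.neg_mul a)

theorem nsmul (h : Chi O χ) (a : V) (n : ℕ) : χ (n • a) = χ a ^ n := by
  induction n with
  | zero => simp [h.zero]
  | succ n ih => rw [succ_nsmul, h.add, ih, pow_succ]

theorem v_inj (h : Chi O χ) {a b : V} (hv : O.valuation (χ a) = O.valuation (χ b)) : a = b := by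
  have := h.inj (a - b) (by
    rw [sub_eq_add_neg, h.add, ← h.inv, map_mul, map_inv₀, hv]
    apply mul_inv_cancel₀
    simpa using h.ne_zero b)
  exact sub_eq_zero.1 this

theorem mem (_h : Chi O χ) (a : V) : χ a ∈ Rchi k χ := Algebra.subset_adjoin ⟨a, rfl⟩

theorem kmem (_h : Chi O χ) {c : L} (hc : c ∈ k) : c ∈ Rchi k χ :=
  (Algebra.adjoin ↥k (Set.range χ)).algebraMap_mem ⟨c, hc⟩

theorem frame (h : Chi O χ) : Frame O k (Rchi k χ) where
  hkR := fun _ hc => h.kmem hc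
  units := fun z hz => by
    obtain ⟨a, ha⟩ := h.surj z hz
    exact ⟨χ a, h.mem a, by rw [h.inv]; exact h.mem _, h.ne_zero a, ha⟩

theorem toSub (h : Chi O χ) {z : L} (hz : z ∈ Rchi k χ) : z ∈ Submodule.span ↥k (Set.range χ) := by
  rw [← Algebra.adjoin_eq_span_of_subset]
  · exact hz
  · have : (Submonoid.closure (Set.range χ) : Set L) ⊆ Set.range χ := by
      let S : Submonoid L := ⟨⟨Set.range χ, by
        rintro _ _ ⟨a, rfl⟩ ⟨b, rfl⟩; exact ⟨a + b, h.add a b⟩⟩, ⟨0, h.zero⟩⟩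
      have : Submonoid.closure (Set.range χ) ≤ S := Submonoid.closure_le.2 le_rfl
      exact this
    exact this.trans Submodule.subset_span

theorem span_repr {G : Set V} {z : L} (hz : z ∈ Submodule.span ↥k (χ '' G)) :
    ∃ (s : Finset V) (c : V → L), ↑s ⊆ G ∧ (∀ a ∈ s, c a ∈ k ∧ c a ≠ 0) ∧ z = ∑ a ∈ s, c a * χ a := by
  rw [Finsupp.mem_span_image_iff_linearCombination] at hz
  obtain ⟨f, hf, rfl⟩ := hz
  refine ⟨f.support, fun a => f a, hf, fun a ha => ⟨(f a).2, ?_⟩, ?_⟩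
  · rw [Finsupp.mem_support_iff] at ha
    exact fun h => ha (Subtype.ext h)
  · rw [Finsupp.linearCombination_apply]; rfl

theorem repr (h : Chi O χ) {z : L} (hz : z ∈ Rchi k χ) :
    ∃ (s : Finset V) (c : V → L), (∀ a ∈ s, c a ∈ k ∧ c a ≠ 0) ∧ z = ∑ a ∈ s, c a * χ a := by
  have := h.toSub hz
  rw [← Set.image_univ] at this
  obtain ⟨s, c, -, h⟩ := span_repr this
  exact ⟨s, c, h⟩

theorem perf (h : Chi O χ) (p : ℕ) [ExpChar L p] [PerfectRing L p]
    (hk : ∀ z, z ^ p ∈ k → z ∈ k) (z : L) (hz : z ^ p ∈ Rchi k χ) : z ∈ Rchi k χ := by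
  obtain ⟨s, c, hc, he⟩ := h.repr hz
  have hp := (expChar_pos L p).ne'
  choose d hd using surjective_frobenius L p
  have hz' : z = ∑ a ∈ s, d (c a) * χ ((1 / (p : ℚ)) • a) := by
    apply frobenius_inj L p
    rw [frobenius_def, he, map_sum]
    refine Finset.sum_congr rfl fun a _ => ?_
    rw [map_mul, hd, frobenius_def, ← h.nsmul, ← Nat.cast_smul_eq_nsmul ℚ, smul_smul]
    rw [mul_one_div_cancel (by exact_mod_cast hp), one_smul]
  rw [hz']
  refine Subring.sum_mem _ fun a ha => Subring.mul_mem _ (h.kmem (hk _ ?_)) (h.mem _)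
  rw [← frobenius_def, hd]; exact (hc a ha).1

theorem dominant (h : Chi O χ) (hC : Ctx O k) {s : Finset V} {c : V → L}
    (hc : ∀ a ∈ s, c a ∈ k ∧ c a ≠ 0) {a0 : V} (_ha0 : a0 ∈ s)
    (hmax : ∀ a ∈ s, O.valuation (χ a) ≤ O.valuation (χ a0)) :
    ∀ a ∈ s, a ≠ a0 → O.valuation (c a * χ a) < O.valuation (χ a0) := by
  intro a ha hne
  rw [map_mul, hC.vone (hc a ha).1 (hc a ha).2, one_mul]
  exact lt_of_le_of_ne (hmax a ha) fun e => hne (h.v_inj e)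

theorem le_one_of_mem (h : Chi O χ) (hC : Ctx O k) {s : Finset V} {c : V → L}
    (hc : ∀ a ∈ s, c a ∈ k ∧ c a ≠ 0) (hO : ∑ a ∈ s, c a * χ a ∈ O) :
    ∀ a ∈ s, O.valuation (χ a) ≤ 1 := by
  classical
  intro a ha
  obtain ⟨a0, ha0, hmax⟩ := Finset.exists_max_image s (fun a => O.valuation (χ a)) ⟨a, ha⟩
  refine (hmax a ha).trans ?_
  have hd := h.dominant hC hc ha0 hmax
  rw [← Finset.add_sum_erase _ _ ha0] at hO
  have h0 : O.valuation (c a0 * χ a0) = O.valuation (χ a0) := by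
    rw [map_mul, hC.vone (hc a0 ha0).1 (hc a0 ha0).2, one_mul]
  have h1 : O.valuation (∑ a ∈ s.erase a0, c a * χ a) < O.valuation (c a0 * χ a0) := by
    rw [h0]
    refine Valuation.map_sum_lt _ (by simpa using h.ne_zero a0) fun x hx => ?_
    exact hd x (Finset.mem_of_mem_erase hx) (Finset.ne_of_mem_erase hx)
  rw [vle, Valuation.map_add_eq_of_lt_left _ h1, h0] at hO
  exact hO

theorem posP (h : Chi O χ) : PosP (fun a : V => O.valuation (χ a) ≤ 1) where
  add := fun a b ha hb => by rw [h.add, map_mul]; exact mul_le_one' ha hb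
  smul := fun c a hc ha => by
    have h1 : χ (c • a) ^ c.den = χ a ^ c.num.toNat := by
      rw [← h.nsmul, ← h.nsmul, ← Nat.cast_smul_eq_nsmul ℚ, ← Nat.cast_smul_eq_nsmul ℚ, smul_smul]
      congr 2
      have := Int.toNat_of_nonneg (Rat.num_nonneg.2 hc)
      have hh : ((c.num.toNat : ℕ) : ℚ) = c.num := by exact_mod_cast this
      rw [hh, mul_comm]; exact Rat.mul_den_eq_num c
    rw [← vle, ← v_pow_le_one c.den_ne_zero, h1, vle, map_pow]
    exact pow_le_one₀ zero_le ha
  total := fun a => by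
    rw [← h.inv, map_inv₀]
    rcases le_total (O.valuation (χ a)) 1 with h | h
    · exact Or.inl h
    · exact Or.inr (inv_le_one_of_one_le₀ h)
  anti := fun a ha hb => by
    apply h.inj
    rw [← h.inv, map_inv₀] at hb
    have h0 : 0 < O.valuation (χ a) := (Valuation.pos_iff _).2 (h.ne_zero a)
    exact le_antisymm ha ((inv_le_one₀ h0).1 hb)

theorem extract [FiniteDimensional ℚ V] (h : Chi O χ) (hC : Ctx O k) (Z : Finset L)
    (hZ : (Z : Set L) ⊆ Uof O (Rchi k χ)) :
    ∃ t : Finset L, (t : Set L) ⊆ O ∧ t.card ≤ Module.finrank ℚ V ∧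
      (Z : Set L) ⊆ Et O (Subring.closure ((k : Set L) ∪ t)) := by
  classical
  let T : Set L := {x | ∃ a, x = χ a ∧ O.valuation (χ a) ≤ 1}
  have h1 : Rchi k χ ⊓ O.toSubring ≤ Subring.closure (T ∪ (k : Set L)) := by
    rintro z ⟨hz, hzO⟩
    obtain ⟨s, c, hc, rfl⟩ := h.repr hz
    have := h.le_one_of_mem hC hc hzO
    refine Subring.sum_mem _ fun a ha => Subring.mul_mem _ (Subring.subset_closure (Or.inr (hc a ha).1))
      (Subring.subset_closure (Or.inl ⟨a, rfl, this a ha⟩))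
  obtain ⟨A, hA, hZA⟩ := Et_finite_gen (S := T) (T := (k : Set L)) Z (fun z hz => Et_mono h1 (hZ hz))
  have hA' : ∀ x, ∃ a, x ∈ A → x = χ a ∧ O.valuation (χ a) ≤ 1 := by
    intro x
    by_cases hx : x ∈ A
    · obtain ⟨a, ha⟩ := hA hx; exact ⟨a, fun _ => ha⟩
    · exact ⟨0, fun h => absurd h hx⟩
  choose e he using hA'
  obtain ⟨b, hb, hbn⟩ := toric h.posP (A.image e) (by
    intro a ha
    obtain ⟨x, hx, rfl⟩ := Finset.mem_image.1 ha
    exact (he x hx).2)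
  refine ⟨Finset.univ.image fun i => χ (b i), ?_, ?_, ?_⟩
  · intro x hx
    obtain ⟨i, -, rfl⟩ := Finset.mem_image.1 hx
    exact vle.2 (hb i)
  · exact Finset.card_image_le.trans (by simp)
  · refine hZA.trans (Et_mono ?_)
    rw [Subring.closure_le]
    rintro x (hx | hx)
    · rw [(he x hx).1]
      obtain ⟨n, hn⟩ := hbn (e x) (Finset.mem_image_of_mem _ hx)
      rw [hn]
      have : ∀ s : Finset (Fin (Module.finrank ℚ V)), χ (∑ i ∈ s, n i • b i) ∈ Subring.closure ((k : Set L) ∪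
          ↑(Finset.univ.image fun i => χ (b i))) := by
        intro s
        induction s using Finset.induction_on with
        | empty => rw [Finset.sum_empty, h.zero]; exact Subring.one_mem _
        | insert i s hi ih =>
          rw [Finset.sum_insert hi, h.add, h.nsmul]
          refine mul_mem (pow_mem ?_ _) ih
          apply Subring.subset_closure
          exact Or.inr (Finset.mem_image_of_mem _ (Finset.mem_univ i))
      exact this _
    · exact Subring.subset_closure (Or.inl hx)

end Chi
end
end LU

namespace LU
variable {L : Type*} [Field L] {O : ValuationSubring L} {k : Subfield L}
variable {V : Type*} [AddCommGroup V] [Module ℚ V]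

namespace Chi
variable {χ : V → L}

theorem move (h : Chi O χ) (p : ℕ) [ExpChar L p] [PerfectRing L p]
    (hk : ∀ z, z ^ p ∈ k → z ∈ k) (hp : p.Prime) (n : ℕ) : ∀ (a : V) (c : L), c ∈ k →
    (∃ c' ∈ k, ∃ w ∈ Rchi k χ, c * χ a = c' * χ (((p : ℚ) ^ n) • a) + (w ^ p - w)) ∧
    (∃ c' ∈ k, ∃ w ∈ Rchi k χ, c * χ a = c' * χ (((p : ℚ) ^ (-n : ℤ)) • a) + (w ^ p - w)) := by
  have hp0 : (p : ℚ) ≠ 0 := by exact_mod_cast hp.ne_zero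
  have hadd : ∀ x y : L, (x + y) ^ p = x ^ p + y ^ p := fun x y => add_pow_expChar x y p
  have hneg : ∀ x : L, (-x) ^ p = - x ^ p := fun x => by
    have := map_neg (frobenius L p) x
    simpa [frobenius_def] using this
  induction n with
  | zero =>
    intro a c hc
    exact ⟨⟨c, hc, 0, Subring.zero_mem _, by simp [hp.ne_zero]⟩,
      ⟨c, hc, 0, Subring.zero_mem _, by simp [hp.ne_zero]⟩⟩
  | succ n ih =>
    intro a c hc
    constructor
    · obtain ⟨c', hc', w, hw, e⟩ := (ih a c hc).1
      refine ⟨c' ^ p, k.pow_mem hc' p, w - c' * χ (((p : ℚ) ^ n) • a),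
        Subring.sub_mem _ hw (Subring.mul_mem _ (h.kmem hc') (h.mem _)), ?_⟩
      have : χ (((p : ℚ) ^ (n + 1)) • a) = χ (((p : ℚ) ^ n) • a) ^ p := by
        rw [← h.nsmul, ← Nat.cast_smul_eq_nsmul ℚ, smul_smul, pow_succ']
      rw [this, e, sub_eq_add_neg w, hadd, hneg]; ring
    · obtain ⟨c', hc', w, hw, e⟩ := (ih a c hc).2
      obtain ⟨d, hd⟩ := surjective_frobenius L p c'
      rw [frobenius_def] at hd
      have hdk : d ∈ k := hk d (by rw [hd]; exact hc')
      refine ⟨d, hdk, w + d * χ (((p : ℚ) ^ (-(n + 1 : ℕ) : ℤ)) • a),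
        Subring.add_mem _ hw (Subring.mul_mem _ (h.kmem hdk) (h.mem _)), ?_⟩
      have : χ (((p : ℚ) ^ (-n : ℤ)) • a) = χ (((p : ℚ) ^ (-(n + 1 : ℕ) : ℤ)) • a) ^ p := by
        rw [← h.nsmul, ← Nat.cast_smul_eq_nsmul ℚ, smul_smul]
        congr 2
        rw [← zpow_one_add₀ hp0]; congr 1; push_cast; ring
      rw [e, this, ← hd, hadd]; ring

theorem move' (h : Chi O χ) (p : ℕ) [ExpChar L p] [PerfectRing L p]
    (hk : ∀ z, z ^ p ∈ k → z ∈ k) (hp : p.Prime) (n : ℤ) (a : V) (c : L) (hc : c ∈ k) :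
    (∃ c' ∈ k, ∃ w ∈ Rchi k χ, c * χ a = c' * χ (((p : ℚ) ^ n) • a) + (w ^ p - w)) := by
  rcases Int.eq_nat_or_neg n with ⟨m, rfl | rfl⟩
  · simpa using (h.move p hk hp m a c hc).1
  · exact (h.move p hk hp m a c hc).2

theorem reduce [IsAlgClosed L] (h : Chi O χ) (hC : Ctx O k) (p : ℕ) [hchar : ExpChar L p]
    (hk : ∀ z, z ^ p ∈ k → z ∈ k) (hp : p.Prime) {y0 : L}
    (hg : y0 ^ p - y0 ∈ Mof hC h.frame) :
    ∃ lam : V →ₗ[ℚ] ℚ, ∃ w ∈ Mof hC h.frame, ∃ (s : Finset V) (c : V → L),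
      (∀ a ∈ s, 1 < O.valuation (χ a) ∧ lam a ≠ 0 ∧ padicValRat p (lam a) = 0) ∧
      (∀ a ∈ s, c a ∈ k ∧ c a ≠ 0) ∧ (y0 - w) ^ p - (y0 - w) = ∑ a ∈ s, c a * χ a := by
  classical
  haveI : Fact p.Prime := ⟨hp⟩
  have hadd : ∀ x y : L, (x + y) ^ p = x ^ p + y ^ p := fun x y => add_pow_expChar x y p
  have hsub : ∀ x y : L, (x - y) ^ p = x ^ p - y ^ p := fun x y => sub_pow_expChar x y
  have hp0 : (p : L) = 0 := by
    have := hchar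
    rcases this with _ | ⟨_⟩
    · exact absurd hp Nat.not_prime_one
    · exact CharP.cast_eq_zero L p
  have hpq : (p : ℚ) ≠ 0 := by exact_mod_cast hp.ne_zero
  obtain ⟨r, hr, u, hu, e⟩ := Mof_decomp hC h.frame hg
  obtain ⟨s0, c0, hc0, rfl⟩ := h.repr hr
  haveI : Finite {a // a ∈ s0 ∧ a ≠ 0} :=
    (s0.finite_toSet.subset (fun a (ha : a ∈ s0 ∧ a ≠ 0) => ha.1)).to_subtype
  obtain ⟨lam, hlam⟩ := Module.exists_dual_forall_apply_ne_zero (K := ℚ)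
    (fun a : {a // a ∈ s0 ∧ a ≠ 0} => (a : V)) (fun a => a.2.2)
  let M := Mof hC h.frame
  let G : Set V := {a | 1 < O.valuation (χ a) ∧ lam a ≠ 0 ∧ padicValRat p (lam a) = 0}
  let D : Submodule ↥k L := Submodule.span ↥k (χ '' G)
  let Q : L → Prop := fun x => ∃ ρ ∈ D, ∃ w ∈ M, x = ρ + (w ^ p - w)
  have hQadd : ∀ x y, Q x → Q y → Q (x + y) := by
    rintro _ _ ⟨ρ, hρ, w, hw, rfl⟩ ⟨ρ', hρ', w', hw', rfl⟩
    exact ⟨ρ + ρ', D.add_mem hρ hρ', w + w', M.add_mem hw hw', by rw [hadd]; ring⟩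
  have hQU : ∀ u ∈ Uof O (Rchi k χ), Q u := by
    intro u hu
    obtain ⟨w, hw⟩ := AS_surj hp u
    have : w ∈ Uof O (Rchi k χ) := AS_mem (Et_closed _ _) Uof_le_O hp hp0 (by rw [hw]; exact hu)
    exact ⟨0, D.zero_mem, w, Uof_le_Mof hC h.frame this, by rw [hw]; ring⟩
  have hQ1 : ∀ a ∈ s0, Q (c0 a * χ a) := by
    intro a ha
    by_cases hv : O.valuation (χ a) ≤ 1
    · apply hQU
      refine le_Uof (Subring.mul_mem _ (h.kmem (hc0 a ha).1) (h.mem a)) ?_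
      exact O.mul_mem _ _ (hC.hk _ (hc0 a ha).1) (vle.2 hv)
    · have ha0 : a ≠ 0 := by rintro rfl; rw [h.zero] at hv; simp at hv
      have hl := hlam ⟨a, ha, ha0⟩
      simp only at hl
      obtain ⟨c', hc', w, hw, e'⟩ := h.move' p hk hp (- padicValRat p (lam a)) a (c0 a) (hc0 a ha).1
      refine ⟨_, ?_, w, le_Mof hC h.frame hw, e'⟩
      refine D.smul_mem ⟨c', hc'⟩ (Submodule.subset_span ⟨_, ⟨?_, ?_, ?_⟩, rfl⟩)
      · by_contra hv'
        push Not at hv'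
        apply hv
        have := h.posP.smul ((p : ℚ) ^ (padicValRat p (lam a))) _ (by positivity) hv'
        rw [smul_smul, ← zpow_add₀ hpq] at this
        simpa using this
      · rw [map_smul, smul_eq_mul]
        exact mul_ne_zero (zpow_ne_zero _ hpq) hl
      · rw [map_smul, smul_eq_mul, padicValRat.mul (zpow_ne_zero _ hpq) hl, padicValRat.zpow]
        rw [padicValRat.self hp.one_lt]; ring
  have hQ0 : Q 0 := hQU 0 (Subring.zero_mem _)
  have hQ : Q (y0 ^ p - y0) := by
    rw [e]
    exact hQadd _ _ (Finset.sum_induction _ Q hQadd hQ0 hQ1) (hQU u hu)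
  obtain ⟨ρ, hρ, w, hw, e2⟩ := hQ
  obtain ⟨s, c, hsG, hc, rfl⟩ := span_repr hρ
  refine ⟨lam, w, hw, s, c, fun a ha => hsG ha, hc, ?_⟩
  rw [hsub]
  have : y0 ^ p - w ^ p - (y0 - w) = (y0 ^ p - y0) - (w ^ p - w) := by ring
  rw [this, e2]; ring

end Chi
end LU

namespace LU
variable {L : Type*} [Field L] {O : ValuationSubring L} {k : Subfield L}
variable {V : Type*} [AddCommGroup V] [Module ℚ V]

theorem psi_int {ψ : ℚ → L} (h0 : ψ 0 = 1) (hadd : ∀ a b, ψ (a + b) = ψ a * ψ b) (q : ℚ) (n : ℕ) :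
    ψ (n * q) = ψ q ^ n := by
  induction n with
  | zero => simp [h0]
  | succ n ih => push_cast; rw [add_mul, one_mul, hadd, ih, pow_succ]

theorem psi_one {ψ : ℚ → L} (h0 : ψ 0 = 1) (hadd : ∀ a b, ψ (a + b) = ψ a * ψ b)
    (hv : O.valuation (ψ 1) = 1) (q : ℚ) : O.valuation (ψ q) = 1 := by
  have hneg : ∀ q, ψ (-q) * ψ q = 1 := fun q => by rw [← hadd, neg_add_cancel, h0]
  apply v_pow_eq_one q.den_ne_zero
  rw [← psi_int h0 hadd, mul_comm, Rat.mul_den_eq_num]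
  have hn : ∀ n : ℕ, O.valuation (ψ n) = 1 := fun n => by
    have := psi_int h0 hadd 1 n
    rw [mul_one] at this
    rw [this, map_pow, hv, one_pow]
  rcases Int.eq_nat_or_neg q.num with ⟨m, e | e⟩
  · rw [e]; exact_mod_cast hn m
  · rw [e]
    have := congrArg O.valuation (hneg m)
    rw [map_mul, hn m, mul_one, map_one] at this
    push_cast; exact this

theorem psi_root_mem {E : Subring L} (hE : EtClosed O E) {s : L} (hs : O.valuation s = 1)
    {N : ℕ} (_hN : N ≠ 0) (hNv : O.valuation (N : L) = 1) (hsN : O.valuation (s ^ N - 1) < 1)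
    {ι : Type*} (S : Finset ι) (d : ι → L) (n : ι → ℕ) (e : ℕ) (he : e ≠ 0)
    (hd : ∀ j ∈ S, d j ∈ E ∧ O.valuation (d j) < 1) {δ : L} (hδ : δ ∈ E)
    (hδv : O.valuation δ < 1)
    (heq : (1 - δ) * s ^ e = s ^ (N + e) + ∑ j ∈ S, d j * s ^ (n j)) : s ∈ E := by
  have hsO : s ∈ O := vle.2 hs.le
  have hnat : ∀ m : ℕ, O.valuation (m : L) ≤ 1 := fun m => vle.1 (natCast_mem O m)
  have hsp : ∀ m : ℕ, O.valuation (s ^ m) = 1 := fun m => by rw [map_pow, hs, one_pow]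
  refine hE (X ^ (N + e) + ∑ j ∈ S, C (d j) * X ^ (n j) - C (1 - δ) * X ^ e) ?_ s hsO ?_ ?_
  · intro i
    simp only [coeff_sub, coeff_add, finsetSum_coeff, coeff_C_mul, coeff_X_pow]
    refine sub_mem (add_mem ?_ (sum_mem fun j hj => mul_mem (hd j hj).1 ?_))
      (mul_mem (sub_mem (one_mem _) hδ) ?_) <;> split_ifs <;>
      first | exact zero_mem _ | exact one_mem _
  · simp only [eval_sub, eval_add, eval_finsetSum, eval_mul, eval_C, eval_pow, eval_X]
    rw [heq, sub_self]
  · simp only [derivative_sub, derivative_add, derivative_sum, derivative_mul, derivative_C,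
      derivative_X_pow, zero_mul, zero_add, eval_sub, eval_add, eval_finsetSum, eval_mul, eval_C,
      eval_pow, eval_X]
    obtain ⟨e, rfl⟩ := Nat.exists_eq_succ_of_ne_zero he
    have h1 : ((N + (e + 1) : ℕ) : L) * s ^ (N + (e + 1) - 1) +
        ∑ j ∈ S, d j * ((n j : L) * s ^ (n j - 1)) - (1 - δ) * (((e + 1 : ℕ) : L) * s ^ (e + 1 - 1))
        - N * s ^ e = ((N + (e + 1) : ℕ) : L) * s ^ e * (s ^ N - 1) +
        ∑ j ∈ S, d j * ((n j : L) * s ^ (n j - 1)) + δ * (((e + 1 : ℕ) : L) * s ^ e) := by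
      have e1 : N + (e + 1) - 1 = e + N := by omega
      rw [e1, Nat.add_sub_cancel, pow_add]; push_cast; ring
    have h2 : ∀ (m : ℕ) (i : ℕ), O.valuation ((m : L) * s ^ i) ≤ 1 := fun m i => by
      rw [map_mul, hsp, mul_one]; exact hnat m
    refine v_eq_one_of_sub (y := N * s ^ e) (by rw [map_mul, hNv, hsp, one_mul]) ?_
    erw [h1]
    refine Valuation.map_add_lt _ (Valuation.map_add_lt _ ?_ (Valuation.map_sum_lt _ one_ne_zero ?_)) ?_
    · rw [map_mul]; exact mul_lt_one_of_nonneg_of_lt_one_right (h2 _ _) zero_le hsN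
    · intro j hj
      rw [map_mul]; exact mul_lt_one_of_nonneg_of_lt_one_left zero_le (hd j hj).2 (h2 _ _)
    · rw [map_mul]; exact mul_lt_one_of_nonneg_of_lt_one_left zero_le hδv (h2 _ _)

theorem den_prime {p : ℕ} (hp : p.Prime) {q : ℚ} (hq : padicValRat p q = 0) (_hq0 : q ≠ 0) :
    ¬ p ∣ q.den := by
  intro h
  haveI : Fact p.Prime := ⟨hp⟩
  have h1 : ¬ (p : ℤ) ∣ q.num := by
    intro h2
    have h3 : p ∣ q.num.natAbs := Int.natCast_dvd.1 h2
    have := Nat.dvd_gcd h3 h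
    rw [q.reduced.gcd_eq_one] at this
    exact hp.one_lt.ne' (Nat.dvd_one.1 this)
  rw [padicValRat_def, padicValInt.eq_zero_of_not_dvd h1] at hq
  have := one_le_padicValNat_of_dvd (p := p) q.den_ne_zero h
  omega

namespace Chi
variable {χ : V → L}

theorem twist (h : Chi O χ) {ψ : ℚ → L} (h0 : ψ 0 = 1) (hadd : ∀ a b, ψ (a + b) = ψ a * ψ b)
    (hv : O.valuation (ψ 1) = 1) (lam : V →ₗ[ℚ] ℚ) : Chi O (fun a => χ a * ψ (lam a)) where
  zero := by simp [h.zero, h0]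
  add := fun a b => by rw [h.add, map_add, hadd]; ring
  inj := fun a ha => by
    rw [map_mul, psi_one h0 hadd hv, mul_one] at ha; exact h.inj a ha
  surj := fun z hz => by
    obtain ⟨a, ha⟩ := h.surj z hz
    exact ⟨a, by rw [map_mul, psi_one h0 hadd hv, mul_one, ha]⟩

theorem step [IsAlgClosed L] (h : Chi O χ) (hC : Ctx O k) (p : ℕ) [hchar : ExpChar L p]
    (hk : ∀ z, z ^ p ∈ k → z ∈ k) (hp : p.Prime) {y0 : L} (hy0 : y0 ∉ Mof hC h.frame)
    (hg : y0 ^ p - y0 ∈ Mof hC h.frame) :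
    ∃ χ' : V → L, ∃ h' : Chi O χ', Mof hC h.frame ≤ Mof hC h'.frame ∧ y0 ∈ Mof hC h'.frame := by
  classical
  haveI : Fact p.Prime := ⟨hp⟩
  obtain ⟨lam, w, hw, s, c, hs, hc, he⟩ := h.reduce hC p hk hp hg
  have hcp : CharP L p := by
    have := hchar
    rcases this with _ | ⟨_⟩
    · exact absurd hp Nat.not_prime_one
    · assumption
  have hp0 : (p : L) = 0 := CharP.cast_eq_zero L p
  set y := y0 - w with hy
  have hyM : y ∉ Mof hC h.frame := fun hh => hy0 (by
    have := (Mof hC h.frame).add_mem hh hw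
    rwa [hy, sub_add_cancel] at this)
  have hsne : s.Nonempty := by
    by_contra hne
    rw [Finset.not_nonempty_iff_eq_empty] at hne
    apply hyM
    apply Uof_le_Mof
    apply AS_mem (Et_closed _ _) Uof_le_O hp hp0
    rw [he, hne]; exact Subring.zero_mem _
  obtain ⟨a0, ha0, hmax⟩ := Finset.exists_max_image s (fun a => O.valuation (χ a)) hsne
  have hdom := h.dominant hC hc ha0 hmax
  have hχ0 := h.ne_zero a0
  have hc00 := (hc a0 ha0).2
  have hca0 : O.valuation (c a0 * χ a0) = O.valuation (χ a0) := by
    rw [map_mul, hC.vone (hc a0 ha0).1 hc00, one_mul]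
  have hrest : O.valuation (∑ a ∈ s.erase a0, c a * χ a) < O.valuation (χ a0) :=
    Valuation.map_sum_lt _ (by simpa using hχ0) fun x hx =>
      hdom x (Finset.mem_of_mem_erase hx) (Finset.ne_of_mem_erase hx)
  have he2 : y ^ p - y = c a0 * χ a0 + ∑ a ∈ s.erase a0, c a * χ a := by
    rw [he]; exact (Finset.add_sum_erase s (fun a => c a * χ a) ha0).symm
  have hvg : O.valuation (y ^ p - y) = O.valuation (χ a0) := by
    rw [he2, Valuation.map_add_eq_of_lt_left _ (by rw [hca0]; exact hrest), hca0]
  have hvy : 1 < O.valuation y := by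
    by_contra hle
    push Not at hle
    have : O.valuation (y ^ p - y) ≤ 1 :=
      Valuation.map_sub_le _ (by rw [map_pow]; exact pow_le_one₀ zero_le hle) hle
    rw [hvg] at this
    exact absurd (hs a0 ha0).1 (not_lt.2 this)
  have hvlt : O.valuation y < O.valuation (y ^ p) := by
    rw [map_pow]; exact lt_self_pow₀ hvy hp.one_lt
  have hvyp : O.valuation (y ^ p) = O.valuation (χ a0) := by
    rw [← hvg, Valuation.map_sub_eq_of_lt_left _ hvlt]
  have hyp0 : y ^ p ≠ 0 := by
    intro e; rw [e, map_zero] at hvlt; exact not_lt_zero hvlt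
  have hyy0 : y ≠ 0 := fun e => hyp0 (by rw [e, zero_pow hp.ne_zero])
  set u := c a0 * χ a0 / y ^ p with hu
  have hvχpos : 0 < O.valuation (χ a0) := (Valuation.pos_iff _).2 hχ0
  have hu1 : O.valuation (u - 1) < 1 := by
    have : u - 1 = -(y + ∑ a ∈ s.erase a0, c a * χ a) / y ^ p := by
      rw [hu]; field_simp; rw [← sub_eq_zero]; linear_combination -he2
    rw [this, map_div₀, Valuation.map_neg, hvyp, div_lt_one₀ hvχpos]
    exact Valuation.map_add_lt _ (hvyp ▸ hvlt) hrest
  have huv : O.valuation u = 1 := v_eq_one_of_sub (y := 1) (by simp) hu1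
  have hu0 : u ≠ 0 := by intro e; rw [e, map_zero] at huv; exact zero_ne_one huv
  obtain ⟨ψ, hψ1, hψ0, hψadd⟩ := exists_psi u hu0
  have hψv : O.valuation (ψ 1) = 1 := by rw [hψ1, huv]
  have hψvq := psi_one hψ0 hψadd hψv
  have hψneg : ∀ q, ψ (-q) * ψ q = 1 := fun q => by rw [← hψadd, neg_add_cancel, hψ0]
  have hl0 := (hs a0 ha0).2.1
  let lam' : V →ₗ[ℚ] ℚ := (-(1 / lam a0)) • lam
  let χ' : V → L := fun a => χ a * ψ (lam' a)
  have h' : Chi O χ' := h.twist hψ0 hψadd hψv lam'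
  have hvχ' : ∀ a, O.valuation (χ' a) = O.valuation (χ a) := fun a => by
    simp only [χ']; rw [map_mul, hψvq, mul_one]
  have hχψ : ∀ a, χ a = χ' a * ψ (lam a / lam a0) := by
    intro a
    have : lam' a = - (lam a / lam a0) := by simp [lam']; ring
    simp only [χ', this]
    rw [mul_assoc, hψneg, mul_one]
  have hyp : y ^ p = c a0 * χ' a0 := by
    have h1 := hχψ a0
    rw [div_self hl0, hψ1] at h1
    rw [hu] at h1
    field_simp at h1
    rw [mul_comm]; exact h1
  let R' := Rchi k χ'
  have hyR : y ∈ R' := h'.perf p hk y (by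
    rw [hyp]; exact mul_mem (h'.kmem (hc a0 ha0).1) (h'.mem _))
  have hypinv : (y ^ p)⁻¹ ∈ R' := by
    rw [hyp, mul_inv, h'.inv]
    exact mul_mem (h'.kmem (k.inv_mem (hc a0 ha0).1)) (h'.mem _)
  let q : V → ℚ := fun a => lam a / lam a0
  have hq0 : ∀ a ∈ s, q a ≠ 0 := fun a ha => div_ne_zero (hs a ha).2.1 hl0
  have hqp : ∀ a ∈ s, padicValRat p (q a) = 0 := fun a ha => by
    simp only [q]
    rw [padicValRat.div (hs a ha).2.1 hl0, (hs a ha).2.2, (hs a0 ha0).2.2, sub_zero]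
  let N : ℕ := ∏ a ∈ s, (q a).den
  have hNp : ¬ p ∣ N := by
    simp only [N]
    rw [hp.prime.dvd_finsetProd_iff]
    rintro ⟨a, ha, hd⟩
    exact den_prime hp (hqp a ha) (hq0 a ha) hd
  have hN0 : N ≠ 0 := fun e => hNp (by rw [e]; exact dvd_zero p)
  have hNL : (N : L) ≠ 0 := fun e => hNp ((CharP.cast_eq_zero_iff L p N).1 e)
  have hNv : O.valuation (N : L) = 1 := hC.vone (natCast_mem k N) hNL
  have hNq : (N : ℚ) ≠ 0 := by exact_mod_cast hN0
  have hn : ∀ a, ∃ n : ℤ, a ∈ s → q a = n * (1 / (N : ℚ)) := by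
    intro a
    by_cases ha : a ∈ s
    · obtain ⟨m, hm⟩ : (q a).den ∣ N := Finset.dvd_prod_of_mem (fun a => (q a).den) ha
      refine ⟨(q a).num * m, fun _ => ?_⟩
      rw [mul_one_div, eq_div_iff hNq, hm]
      push_cast
      rw [← mul_assoc, Rat.mul_den_eq_num]
    · exact ⟨0, fun hh => absurd hh ha⟩
  choose n hn using hn
  let σ := ψ (1 / (N : ℚ))
  have hσN : σ ^ N = u := by
    rw [← hψ1, ← psi_int hψ0 hψadd]; congr 1; field_simp
  have hσv : O.valuation σ = 1 := hψvq _
  have hσ0 : σ ≠ 0 := by intro e; rw [e, map_zero] at hσv; exact zero_ne_one hσv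
  obtain ⟨e, he0, hee⟩ : ∃ e : ℕ, e ≠ 0 ∧ ∀ a ∈ s, 0 ≤ n a + e := by
    refine ⟨∑ a ∈ s, (n a).natAbs + 1, by omega, fun a ha => ?_⟩
    have := Finset.single_le_sum (f := fun a => (n a).natAbs) (fun _ _ => Nat.zero_le _) ha
    omega
  let m : V → ℕ := fun a => (n a + e).toNat
  have hm : ∀ a ∈ s, ψ (q a) * σ ^ e = σ ^ (m a) := by
    intro a ha
    rw [← psi_int hψ0 hψadd, ← psi_int hψ0 hψadd, ← hψadd]
    congr 1
    have h1 : ((m a : ℕ) : ℚ) = n a + e := by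
      have := Int.toNat_of_nonneg (hee a ha)
      exact_mod_cast this
    rw [h1, hn a ha]; ring
  have hUc : EtClosed O (Uof O R') := Et_closed _ _
  have hσU : σ ∈ Uof O R' := by
    refine psi_root_mem hUc hσv hN0 hNv (by rw [hσN]; exact hu1) (s.erase a0)
      (fun a => c a * χ' a * (y ^ p)⁻¹) m e he0 ?_ (δ := y * (y ^ p)⁻¹) ?_ ?_ ?_
    · intro a ha
      have ha' := Finset.mem_of_mem_erase ha
      have h1 : O.valuation (c a * χ' a * (y ^ p)⁻¹) < 1 := by
        rw [map_mul, map_inv₀, hvyp, map_mul, hvχ', ← map_mul, ← div_eq_mul_inv, div_lt_one₀ hvχpos]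
        exact hdom a ha' (Finset.ne_of_mem_erase ha)
      exact ⟨le_Uof (mul_mem (mul_mem (h'.kmem (hc a ha').1) (h'.mem a)) hypinv) (vle.2 h1.le), h1⟩
    · refine le_Uof (mul_mem hyR hypinv) (vle.2 ?_)
      rw [map_mul, map_inv₀, ← div_eq_mul_inv]; exact div_le_one_of_le₀ hvlt.le zero_le
    · rw [map_mul, map_inv₀, ← div_eq_mul_inv, div_lt_one₀ (hvyp ▸ hvχpos)]; exact hvlt
    · have h1 : 1 - y * (y ^ p)⁻¹ = u + ∑ a ∈ s.erase a0, c a * χ' a * ψ (q a) * (y ^ p)⁻¹ := by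
        have h2 : (y ^ p - y) * (y ^ p)⁻¹ = 1 - y * (y ^ p)⁻¹ := by field_simp
        rw [← h2, he2, add_mul, hu, ← div_eq_mul_inv, Finset.sum_mul]
        congr 1
        refine Finset.sum_congr rfl fun a _ => ?_
        rw [hχψ a]; ring
      rw [h1, add_mul, ← hσN, pow_add, Finset.sum_mul]
      congr 1
      refine Finset.sum_congr rfl fun a ha => ?_
      rw [← hm a (Finset.mem_of_mem_erase ha)]; ring
  have hRp := h'.perf p hk
  have huU : u ∈ Uof O R' := by rw [← hσN]; exact pow_mem hσU N
  have hψU : ∀ q, ψ q ∈ Uof O R' := by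
    have hnat : ∀ n : ℕ, ψ n ∈ Uof O R' := fun n => by
      have := psi_int hψ0 hψadd 1 n
      rw [mul_one, hψ1] at this
      rw [this]; exact pow_mem huU n
    intro q
    refine root_mem hC p hUc (fun z hz => Uof_perf p hRp hz) q.den_ne_zero ?_ (hψvq q)
    rw [← psi_int hψ0 hψadd, mul_comm, Rat.mul_den_eq_num]
    rcases Int.eq_nat_or_neg q.num with ⟨j, e | e⟩
    · rw [e]; exact_mod_cast hnat j
    · rw [e]
      have h1 : ψ (-(j : ℚ)) = (ψ j)⁻¹ := eq_inv_of_mul_eq_one_left (hψneg j)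
      push_cast
      rw [h1]
      exact hUc.inv (hnat j) (hψvq j)
  have hMle : Mof hC h.frame ≤ Mof hC h'.frame := by
    refine Mof_min hC h.frame (Mof_ok hC h'.frame p hRp).closed ?_
    intro x hx
    obtain ⟨s', c', hc', rfl⟩ := h.repr hx
    refine sum_mem fun a ha => mul_mem (le_Mof hC h'.frame (h'.kmem (hc' a ha).1)) ?_
    rw [hχψ a]
    exact mul_mem (le_Mof hC h'.frame (h'.mem a)) (Uof_le_Mof hC h'.frame (hψU _))
  refine ⟨χ', h', hMle, ?_⟩
  have : y0 = y + w := by rw [hy]; ring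
  rw [this]
  exact add_mem (le_Mof hC h'.frame hyR) (hMle hw)

theorem abhyankar [IsAlgClosed L] [FiniteDimensional ℚ V] (h : Chi O χ) (hC : Ctx O k)
    (hk : ∀ p : ℕ, p ≠ 0 → ∀ z, z ^ p ∈ k → z ∈ k) (Z : Finset L) (hZO : (Z : Set L) ⊆ O)
    (hZ : ∀ z ∈ Z, IsAlgebraic ↥(Subfield.closure ((k : Set L) ∪ Set.range χ)) z) :
    ∃ t : Finset L, (t : Set L) ⊆ O ∧ t.card ≤ Module.finrank ℚ V ∧
      (Z : Set L) ⊆ Et O (Subring.closure ((k : Set L) ∪ t)) := by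
  obtain ⟨p, hp⟩ := ExpChar.exists L
  have hkp := hk p (expChar_pos L p).ne'
  let 𝓜 : Set (Subfield L) := {M | ∃ χ : V → L, ∃ h : Chi O χ, M = Mof hC h.frame}
  have hle : Subfield.closure ((k : Set L) ∪ Set.range χ) ≤ Mof hC h.frame := by
    rw [Subfield.closure_le]
    rintro x (hx | ⟨a, rfl⟩)
    · exact le_Mof hC h.frame (h.kmem hx)
    · exact le_Mof hC h.frame (h.mem a)
  obtain ⟨M', ⟨χ', h', rfl⟩, -, hZM⟩ := AS_tower_finset hC (p := p) 𝓜
    (by rintro _ ⟨χ, h, rfl⟩; exact Mof_ok hC h.frame p (h.perf p hkp))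
    (by
      rintro hpp _ ⟨χ, h, rfl⟩ y hy hy'
      obtain ⟨χ', h', h1, h2⟩ := h.step hC p hkp hpp hy hy'
      exact ⟨_, ⟨χ', h', rfl⟩, h1, h2⟩)
    ⟨χ, h, rfl⟩ Z (by
      intro z hz
      obtain ⟨f, hf, hfz⟩ := hZ z hz
      let ι := Subfield.inclusion hle
      refine ⟨f.map ι, (Polynomial.map_ne_zero_iff ι.injective).2 hf, ?_⟩
      rw [aeval_def, eval₂_map]
      exact hfz)
  refine h'.extract hC Z fun z hz => ?_
  rw [SetLike.mem_coe, ← Mof_inf hC h'.frame]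
  exact ⟨hZM hz, hZO hz⟩

end Chi
end LU

namespace LU
variable {L : Type*} [Field L] {O : ValuationSubring L} {k : Subfield L}

structure Base (O : ValuationSubring L) (k B : Subfield L) : Prop where
  hkB : k ≤ B
  alg : ∀ z, IsAlgebraic ↥B z → z ∈ B
  vals : ∀ z, z ≠ 0 → ∃ c, c ∈ B ∧ c ≠ 0 ∧ O.valuation c = O.valuation z

theorem algClosed_of [IsAlgClosed L] {B : Subfield L} (hB : ∀ z, IsAlgebraic ↥B z → z ∈ B) :
    IsAlgClosed ↥B := by
  refine IsAlgClosed.of_exists_root _ fun f hf hirr => ?_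
  obtain ⟨z, hz⟩ := IsAlgClosed.exists_aeval_eq_zero L f (by
    exact (degree_pos_of_irreducible hirr).ne')
  refine ⟨⟨z, hB z ⟨f, hf.ne_zero, hz⟩⟩, ?_⟩
  apply Subtype.ext
  have := Polynomial.aeval_algebraMap_apply L (⟨z, hB z ⟨f, hf.ne_zero, hz⟩⟩ : ↥B) f
  rw [coe_aeval_eq_eval] at this
  exact this.symm.trans hz

namespace Base
variable {B : Subfield L}

theorem closer (hB : Base O k B) (hC : Ctx O k) {s : L} (hs : s ∉ B) (a : ↥B) :
    ∃ a' : ↥B, O.valuation (s - a') < O.valuation (s - a) := by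
  have hsa : s - a ≠ 0 := fun e => hs (by rw [sub_eq_zero.1 e]; exact a.2)
  obtain ⟨b, hb, hb0, hv⟩ := hB.vals _ hsa
  have hvb : 0 < O.valuation b := (Valuation.pos_iff _).2 hb0
  obtain ⟨c, hc, -, h⟩ := hC.res_unit (z := (s - a) / b) (by
    rw [map_div₀, ← hv, div_self hvb.ne'])
  refine ⟨⟨a + b * c, B.add_mem a.2 (B.mul_mem hb (hB.hkB hc))⟩, ?_⟩
  have : s - (a + b * c) = b * ((s - a) / b - c) := by field_simp; ring
  change O.valuation (s - (a + b * c)) < _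
  rw [this, map_mul, ← hv]
  exact mul_lt_of_lt_one_right hvb h

def Near (O : ValuationSubring L) (B : Subfield L) (s : L) (P : ↥B → Prop) : Prop :=
  ∃ a0 : ↥B, ∀ a : ↥B, O.valuation (s - a) ≤ O.valuation (s - a0) → P a

theorem Near.and {s : L} {P Q : ↥B → Prop} (h : Near O B s P) (h' : Near O B s Q) :
    Near O B s fun a => P a ∧ Q a := by
  obtain ⟨a, ha⟩ := h
  obtain ⟨a', ha'⟩ := h'
  rcases le_total (O.valuation (s - a)) (O.valuation (s - a')) with h | h
  · exact ⟨a, fun x hx => ⟨ha x hx, ha' x (hx.trans h)⟩⟩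
  · exact ⟨a', fun x hx => ⟨ha x (hx.trans h), ha' x hx⟩⟩

theorem Near.mono {s : L} {P Q : ↥B → Prop} (h : Near O B s P) (h' : ∀ a, P a → Q a) :
    Near O B s Q := by
  obtain ⟨a, ha⟩ := h
  exact ⟨a, fun x hx => h' x (ha x hx)⟩

theorem Near.all {s : L} {ι : Type*} (S : Finset ι) {P : ι → ↥B → Prop}
    (h : ∀ i ∈ S, Near O B s (P i)) : Near O B s fun a => ∀ i ∈ S, P i a := by
  classical
  induction S using Finset.induction_on with
  | empty => exact ⟨0, by simp⟩
  | insert i S _ ih =>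
    refine ((h i (by simp)).and (ih fun j hj => h j (by simp [hj]))).mono ?_
    rintro a ⟨h1, h2⟩ j hj
    rcases Finset.mem_insert.1 hj with rfl | hj
    · exact h1
    · exact h2 j hj

def NearPoly (O : ValuationSubring L) (B : Subfield L) (s : L) (Q : (↥B)[X]) (a : ↥B) : Prop :=
  O.valuation (Q.eval a : ↥B) = O.valuation (aeval s Q) ∧
    ∀ b : ↥B, O.valuation (b : L) = O.valuation (s - a) →
      ∃ W ∈ Subring.closure ({x : L | x ∈ B ∧ x ∈ O} ∪ {(s - a) / b}), aeval s Q = (Q.eval a : ↥B) * W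

theorem near_poly [IsAlgClosed L] (hB : Base O k B) (hC : Ctx O k) {s : L} (hs : s ∉ B) (n : ℕ) :
    ∀ Q : (↥B)[X], Q.natDegree ≤ n → Near O B s (NearPoly O B s Q) := by
  haveI := algClosed_of hB.alg
  induction n with
  | zero =>
    intro Q hQ
    rw [Nat.le_zero, natDegree_eq_zero] at hQ
    obtain ⟨c, rfl⟩ := hQ
    refine ⟨0, fun a _ => ⟨?_, fun b _ => ⟨1, one_mem _, ?_⟩⟩⟩
    · rw [eval_C, aeval_C]; rfl
    · rw [eval_C, aeval_C, mul_one]; rfl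
  | succ n ih =>
    intro Q hQ
    by_cases hd : Q.natDegree = 0
    · exact ih Q (by omega)
    obtain ⟨α, hα⟩ := IsAlgClosed.exists_root Q (by
      intro h; exact hd (natDegree_eq_of_degree_eq_some h))
    obtain ⟨Q', rfl⟩ := dvd_iff_isRoot.2 hα
    have hQ'0 : Q' ≠ 0 := by rintro rfl; simp at hd
    have hdeg : Q'.natDegree ≤ n := by
      rw [natDegree_mul (X_sub_C_ne_zero α) hQ'0, natDegree_X_sub_C] at hQ; omega
    have h1 : Near O B s (NearPoly O B s (X - C α)) := by
      obtain ⟨a0, ha0⟩ := hB.closer hC hs α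
      refine ⟨a0, fun a ha => ?_⟩
      have hlt := ha.trans_lt ha0
      have hva : O.valuation ((a : L) - α) = O.valuation (s - α) := by
        have : (a : L) - α = (s - α) - (s - a) := by ring
        rw [this]; exact Valuation.map_sub_eq_of_lt_left _ hlt
      have hsα : O.valuation (s - α) ≠ 0 := (zero_le.trans_lt hlt).ne'
      have hne : (a : L) - α ≠ 0 := by
        intro e; rw [e, map_zero] at hva; exact hsα hva.symm
      have hsa : s - a ≠ 0 := fun e => hs (by rw [sub_eq_zero.1 e]; exact a.2)
      refine ⟨?_, fun b hb => ?_⟩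
      · have h2 : ((aeval s) (X - C α : (↥B)[X]) : L) = s - α := by simp; rfl
        have h3 : (((X - C α : (↥B)[X]).eval a : ↥B) : L) = a - α := by simp
        rw [h2, h3]; exact hva
      · have hb0 : (b : L) ≠ 0 := by
          intro e; rw [e, map_zero] at hb
          exact hsa ((Valuation.zero_iff _).1 hb.symm)
        refine ⟨1 + (b / ((a : L) - α)) * ((s - a) / b), add_mem (one_mem _) (mul_mem
          (Subring.subset_closure (Or.inl ⟨B.div_mem b.2 (B.sub_mem a.2 α.2), ?_⟩))
          (Subring.subset_closure (Or.inr rfl))), ?_⟩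
        · rw [vle, map_div₀, hb, hva]; exact div_le_one_of_le₀ hlt.le zero_le
        · have h2 : ((aeval s) (X - C α : (↥B)[X]) : L) = s - α := by simp; rfl
          have h3 : (((X - C α : (↥B)[X]).eval a : ↥B) : L) = a - α := by simp
          rw [h2, h3]; field_simp; ring
    refine (h1.and (ih Q' hdeg)).mono ?_
    rintro a ⟨⟨h1, h2⟩, h3, h4⟩
    refine ⟨?_, fun b hb => ?_⟩
    · rw [eval_mul, map_mul, map_mul, ← h1, ← h3, ← map_mul]; rfl
    · obtain ⟨W, hW, e⟩ := h2 b hb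
      obtain ⟨W', hW', e'⟩ := h4 b hb
      refine ⟨W * W', mul_mem hW hW', ?_⟩
      rw [map_mul, e, e', eval_mul, Subfield.coe_mul]; ring

noncomputable def Bt (B : Subfield L) (t : L) : Subring L := (aeval t : (↥B)[X] →ₐ[↥B] L).range.toSubring

theorem mem_Bt {t z : L} : z ∈ Bt B t ↔ ∃ Q : (↥B)[X], aeval t Q = z := Iff.rfl

theorem self_mem_Bt {t : L} : t ∈ Bt B t := ⟨X, by simp⟩

theorem B_mem_Bt {t c : L} (hc : c ∈ B) : c ∈ Bt B t := ⟨C ⟨c, hc⟩, by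
  change aeval t (C _) = c
  rw [aeval_C]; rfl⟩

theorem Bt_le {t : L} {S : Subring L} (h1 : ∀ c ∈ B, c ∈ S) (h2 : t ∈ S) {z : L} (hz : z ∈ Bt B t) :
    z ∈ S := by
  obtain ⟨Q, rfl⟩ := hz
  change aeval t Q ∈ S
  rw [aeval_eq_sum_range]
  exact sum_mem fun i _ => by
    rw [Algebra.smul_def]; exact mul_mem (h1 _ (Q.coeff i).2) (pow_mem h2 i)

def Rt (B : Subfield L) (p : ℕ) [ExpChar L p] (t : L) : Subring L where
  carrier := {z | ∃ n : ℕ, z ^ p ^ n ∈ Bt B t}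
  zero_mem' := ⟨0, by simpa using zero_mem _⟩
  one_mem' := ⟨0, by simpa using one_mem _⟩
  neg_mem' := by
    rintro x ⟨n, hn⟩
    refine ⟨n, ?_⟩
    have := map_neg (iterateFrobenius L p n) x
    simp only [iterateFrobenius_def] at this
    rw [this]; exact neg_mem hn
  add_mem' := by
    rintro x y ⟨n, hn⟩ ⟨m, hm⟩
    refine ⟨n + m, ?_⟩
    rw [add_pow_expChar_pow]
    refine add_mem ?_ ?_
    · rw [pow_add, pow_mul]; exact pow_mem hn _
    · rw [add_comm n m, pow_add, pow_mul]; exact pow_mem hm _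
  mul_mem' := by
    rintro x y ⟨n, hn⟩ ⟨m, hm⟩
    refine ⟨n + m, ?_⟩
    rw [mul_pow]
    refine mul_mem ?_ ?_
    · rw [pow_add, pow_mul]; exact pow_mem hn _
    · rw [add_comm n m, pow_add, pow_mul]; exact pow_mem hm _

variable (p : ℕ) [hp : ExpChar L p]

theorem Bt_le_Rt {t z : L} (hz : z ∈ Bt B t) : z ∈ Rt B p t := ⟨0, by simpa using hz⟩

theorem Rt_perf {t z : L} (hz : z ^ p ∈ Rt B p t) : z ∈ Rt B p t := by
  obtain ⟨n, hn⟩ := hz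
  exact ⟨n + 1, by rw [pow_succ', pow_mul]; exact hn⟩

theorem frame (hB : Base O k B) (t : L) : Frame O k (Rt B p t) where
  hkR := fun _ hc => Bt_le_Rt p (B_mem_Bt (hB.hkB hc))
  units := fun z hz => by
    obtain ⟨c, hc, hc0, hv⟩ := hB.vals z hz
    exact ⟨c, Bt_le_Rt p (B_mem_Bt hc), Bt_le_Rt p (B_mem_Bt (B.inv_mem hc)), hc0, hv⟩

theorem root_Bt [IsAlgClosed L] (hB : Base O k B) {t s r : L} {n N : ℕ} (hr : r ^ p ^ n ∈ Bt B t)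
    (hn : n ≤ N) (hs : s ^ p ^ N = t) : r ∈ Bt B s := by
  haveI := algClosed_of hB.alg
  have hr' : r ^ p ^ N ∈ Bt B t := by
    obtain ⟨m, rfl⟩ := Nat.exists_eq_add_of_le hn
    rw [pow_add, pow_mul]; exact pow_mem hr _
  obtain ⟨Q, hQ⟩ := hr'
  change aeval t Q = _ at hQ
  have hpos : 0 < p ^ N := pow_pos (expChar_pos L p) N
  choose d hd using fun x : ↥B => IsAlgClosed.exists_pow_nat_eq x hpos
  refine ⟨∑ i ∈ Finset.range (Q.natDegree + 1), C (d (Q.coeff i)) * X ^ i, ?_⟩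
  change aeval s _ = r
  apply iterateFrobenius_inj L p N
  have hs1 := aeval_eq_sum_range (p := Q) t
  rw [iterateFrobenius_def _ _ r, ← hQ, hs1, map_sum, map_sum]
  refine Finset.sum_congr rfl fun i _ => ?_
  rw [iterateFrobenius_def, map_mul, aeval_C, map_pow, aeval_X, mul_pow, ← map_pow, hd,
    ← pow_mul, mul_comm i, pow_mul, hs, Algebra.smul_def]

theorem extract [IsAlgClosed L] (hB : Base O k B) (hC : Ctx O k) {t : L} (ht : t ∉ B) (Z : Finset L)
    (hZ : (Z : Set L) ⊆ Uof O (Rt B p t)) :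
    ∃ x ∈ O, (Z : Set L) ⊆ Et O (Subring.closure ({x : L | x ∈ B ∧ x ∈ O} ∪ {x})) := by
  classical
  have h0 : Rt B p t ⊓ O.toSubring ≤ Subring.closure ({z | z ∈ Rt B p t ∧ z ∈ O} ∪ ∅) :=
    fun z hz => Subring.subset_closure (Or.inl hz)
  obtain ⟨A, hA, hZA⟩ := Et_finite_gen (S := {z | z ∈ Rt B p t ∧ z ∈ O}) (T := ∅) Z
    (fun z hz => Et_mono h0 (hZ hz))
  have hA' : ∀ z, ∃ n : ℕ, z ∈ A → z ^ p ^ n ∈ Bt B t := by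
    intro z
    by_cases hz : z ∈ A
    · obtain ⟨n, hn⟩ := (hA hz).1; exact ⟨n, fun _ => hn⟩
    · exact ⟨0, fun h => absurd h hz⟩
  choose n hn using hA'
  let N := ∑ z ∈ A, n z
  obtain ⟨s, hs⟩ := IsAlgClosed.exists_pow_nat_eq t (pow_pos (expChar_pos L p) N)
  have hsB : s ∉ B := fun h => ht (by rw [← hs]; exact pow_mem h _)
  have hQ : ∀ z, ∃ Q : (↥B)[X], z ∈ A → aeval s Q = z := by
    intro z
    by_cases hz : z ∈ A
    · obtain ⟨Q, hQ⟩ := root_Bt p hB (hn z hz)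
        (Finset.single_le_sum (f := n) (fun _ _ => Nat.zero_le _) hz) hs
      exact ⟨Q, fun _ => hQ⟩
    · exact ⟨0, fun h => absurd h hz⟩
  choose Q hQ using hQ
  obtain ⟨a, ha⟩ := Near.all (O := O) (B := B) (s := s) A (P := fun z => NearPoly O B s (Q z))
    fun z _ => near_poly hB hC hsB _ (Q z) le_rfl
  have ha := ha a le_rfl
  have hsa : s - a ≠ 0 := fun e => hsB (by rw [sub_eq_zero.1 e]; exact a.2)
  obtain ⟨b, hb, hb0, hv⟩ := hB.vals _ hsa
  have hvb : 0 < O.valuation b := (Valuation.pos_iff _).2 hb0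
  refine ⟨(s - a) / b, ?_, hZA.trans (Et_mono ?_)⟩
  · rw [vle, map_div₀, ← hv, div_self hvb.ne']
  · rw [Subring.closure_le]
    rintro z (hz | hz)
    · obtain ⟨h1, h2⟩ := ha z hz
      obtain ⟨W, hW, e⟩ := h2 ⟨b, hb⟩ hv
      rw [hQ z hz] at e h1
      rw [e]
      refine mul_mem (Subring.subset_closure (Or.inl ⟨SetLike.coe_mem _, ?_⟩)) hW
      rw [vle, h1]; exact vle.1 (hA hz).2
    · exact absurd hz (Set.notMem_empty z)

end Base
end LU

namespace LU
variable {L : Type*} [Field L] {O : ValuationSubring L} {k : Subfield L}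
namespace Base
variable {B : Subfield L}

theorem AS_shift {p : ℕ} [ExpChar L p] {S : Subring L} {z : L} (hz : z ∈ S) (j : ℕ) :
    ∃ w ∈ S, z ^ p ^ j = z + (w ^ p - w) := by
  have hp0 := (expChar_pos L p).ne'
  induction j with
  | zero => exact ⟨0, zero_mem _, by simp [hp0]⟩
  | succ j ih =>
    obtain ⟨w, hw, e⟩ := ih
    refine ⟨w + z ^ p ^ j, add_mem hw (pow_mem hz _), ?_⟩
    rw [add_pow_expChar, pow_succ, pow_mul]
    linear_combination e

theorem AS_sum {p : ℕ} [ExpChar L p] {ι : Type*} (S : Finset ι) (w : ι → L) :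
    (∑ i ∈ S, w i) ^ p - ∑ i ∈ S, w i = ∑ i ∈ S, (w i ^ p - w i) := by
  rw [Finset.sum_sub_distrib]
  congr 1
  exact map_sum (frobenius L p) w S

theorem taylor_expand (G : (↥B)[X]) (s : L) (a : ↥B) :
    aeval s G = ∑ i ∈ Finset.range (G.natDegree + 1),
      (((hasseDeriv i G).eval a : ↥B) : L) * (s - a) ^ i := by
  have h1 : aeval s G = aeval (s - a) (taylor a G) := by
    rw [taylor_apply, aeval_comp]
    congr 2
    rw [map_add, aeval_X, aeval_C]
    change s = s - a + a
    ring
  rw [h1, aeval_eq_sum_range, natDegree_taylor]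
  refine Finset.sum_congr rfl fun i _ => ?_
  rw [taylor_coeff, Algebra.smul_def]; rfl

theorem normal_form [IsAlgClosed L] (p : ℕ) [ExpChar L p] (hp : p.Prime) (hB : Base O k B)
    (hC : Ctx O k) {s : L} (hs : s ∉ B) (G : (↥B)[X]) :
    ∃ (S : Finset ℕ) (γ : ℕ → O.ValueGroup), (∀ m ∈ S, ¬ p ∣ m) ∧
    Near O B s fun a => ∃ c : ℕ → ↥B, ∃ w ∈ Bt B s,
      (∀ m ∈ S, O.valuation (c m : L) = γ m) ∧
      aeval s G = (w ^ p - w) + ∑ m ∈ S, (c m : L) * (s - a) ^ m := by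
  classical
  haveI := algClosed_of hB.alg
  haveI : ExpChar ↥B p := (algebraMap ↥B L).expChar (algebraMap ↥B L).injective p
  set D := G.natDegree with hD
  have hdec : ∀ i : ℕ, ∃ jm : ℕ × ℕ, ¬ p ∣ jm.2 ∧ i + 1 = p ^ jm.1 * jm.2 := by
    intro i
    obtain ⟨j, m, h1, h2⟩ := Nat.exists_eq_pow_mul_and_not_dvd (Nat.succ_ne_zero i) p hp.ne_one
    exact ⟨(j, m), h1, h2⟩
  choose jm hm hi using hdec
  have hj : ∀ i ∈ Finset.range D, (jm i).1 ≤ D := by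
    intro i hiD
    have h1 : (jm i).1 < p ^ (jm i).1 := Nat.lt_pow_self hp.one_lt
    have h2 : p ^ (jm i).1 ≤ i + 1 := Nat.le_of_dvd (Nat.succ_pos _) ⟨_, hi i⟩
    have := Finset.mem_range.1 hiD
    omega
  let fib : ℕ → Finset ℕ := fun m => (Finset.range D).filter fun i => (jm i).2 = m
  let Q : ℕ → (↥B)[X] := fun m => ∑ i ∈ fib m, (hasseDeriv (i + 1) G) ^ p ^ (D - (jm i).1)
  have hpos : 0 < p ^ D := pow_pos hp.pos D
  choose ρ hρ using fun m => IsAlgClosed.exists_pow_nat_eq (aeval s (Q m)) hpos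
  refine ⟨(Finset.range D).image fun i => (jm i).2, fun m => O.valuation (ρ m), ?_, ?_⟩
  · intro m hmS
    obtain ⟨i, -, rfl⟩ := Finset.mem_image.1 hmS
    exact hm i
  refine (Near.all (O := O) (B := B) (s := s) ((Finset.range D).image fun i => (jm i).2)
    (P := fun m => NearPoly O B s (Q m)) fun m _ => near_poly hB hC hs _ (Q m) le_rfl).mono ?_
  intro a ha
  choose r hr using fun i => IsAlgClosed.exists_pow_nat_eq ((hasseDeriv (i + 1) G).eval a)
    (pow_pos hp.pos (jm i).1)
  have hr' : ∀ i, ((r i : ↥B) : L) ^ p ^ (jm i).1 = (((hasseDeriv (i + 1) G).eval a : ↥B) : L) := by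
    intro i; rw [← hr i]; rfl
  have hsa : s - a ∈ Bt B s := sub_mem self_mem_Bt (B_mem_Bt a.2)
  choose w hw hwe using fun i => AS_shift (p := p) (z := ((r i : ↥B) : L) * (s - a) ^ (jm i).2)
    (mul_mem (B_mem_Bt (r i).2) (pow_mem hsa _)) (jm i).1
  obtain ⟨w0, hw0⟩ := AS_surj hp ((hasseDeriv 0 G).eval a)
  have hw0' : (w0 : L) ^ p - w0 = (((hasseDeriv 0 G).eval a : ↥B) : L) := by rw [← hw0]; rfl
  refine ⟨fun m => ∑ i ∈ fib m, r i, (∑ i ∈ Finset.range D, w i) + w0,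
    add_mem (sum_mem fun i _ => hw i) (B_mem_Bt w0.2), ?_, ?_⟩
  · intro m hmS
    have h1 := (ha m hmS).1
    rw [← hρ m, map_pow] at h1
    have h2 : (∑ i ∈ fib m, r i) ^ p ^ D = (Q m).eval a := by
      have := map_sum (iterateFrobenius ↥B p D) r (fib m)
      simp only [iterateFrobenius_def] at this
      rw [this, eval_finsetSum]
      refine Finset.sum_congr rfl fun i hi' => ?_
      rw [eval_pow, ← hr i, ← pow_mul, ← pow_add, Nat.add_sub_cancel' (hj i (Finset.mem_filter.1 hi').1)]
    rw [← h2, SubmonoidClass.coe_pow, map_pow] at h1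
    exact (pow_left_inj₀ zero_le zero_le hpos.ne').1 h1
  · rw [taylor_expand G s a, Finset.sum_range_succ', pow_zero, mul_one, ← hw0']
    have h3 : ∀ i ∈ Finset.range D, (((hasseDeriv (i + 1) G).eval a : ↥B) : L) * (s - a) ^ (i + 1) =
        ((r i : ↥B) : L) * (s - a) ^ (jm i).2 + (w i ^ p - w i) := by
      intro i _
      rw [← hwe, mul_pow, hr', ← pow_mul, mul_comm (jm i).2, ← hi]
    rw [Finset.sum_congr rfl h3, Finset.sum_add_distrib, ← AS_sum, add_pow_expChar]
    rw [← Finset.sum_fiberwise_of_maps_to (g := fun i => (jm i).2) (t := (Finset.range D).image fun i => (jm i).2)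
      (fun i hi => Finset.mem_image_of_mem _ hi)]
    have h4 : ∀ m, (((∑ i ∈ fib m, r i : ↥B)) : L) * (s - a) ^ m =
        ∑ i ∈ Finset.range D with (jm i).2 = m, ((r i : ↥B) : L) * (s - a) ^ (jm i).2 := by
      intro m
      rw [AddSubmonoidClass.coe_finsetSum, Finset.sum_mul]
      refine Finset.sum_congr rfl fun i hi' => ?_
      rw [(Finset.mem_filter.1 hi').2]
    simp only [h4]
    ring

end Base
end LU

namespace LU
variable {L : Type*} [Field L] {O : ValuationSubring L} {k : Subfield L}

theorem dom {Γ : Type*} [LinearOrderedCommGroupWithZero Γ] (S : Finset ℕ) (γ : ℕ → Γ) (N : Set Γ)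
    (hne : N.Nonempty) (h0 : 0 ∉ N) (hcl : ∀ δ ∈ N, ∃ δ' ∈ N, δ' < δ)
    (hbig : ∀ δ ∈ N, ∃ m ∈ S, 1 < γ m * δ ^ m) :
    ∃ δ ∈ N, ∃ m0 ∈ S, 1 < γ m0 * δ ^ m0 ∧ ∀ m ∈ S, m ≠ m0 → γ m * δ ^ m < γ m0 * δ ^ m0 := by
  classical
  have hS : ∀ δ ∈ N, ∃ m ∈ S, ∀ m' ∈ S, γ m' * δ ^ m' ≤ γ m * δ ^ m := by
    intro δ hδ
    obtain ⟨m, hm, -⟩ := hbig δ hδ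
    exact Finset.exists_max_image S (fun m => γ m * δ ^ m) ⟨m, hm⟩
  have hex : ∃ m, m ∈ S ∧ ∃ δ ∈ N, ∀ m' ∈ S, γ m' * δ ^ m' ≤ γ m * δ ^ m := by
    obtain ⟨δ, hδ⟩ := hne
    obtain ⟨m, hm, h⟩ := hS δ hδ
    exact ⟨m, hm, δ, hδ, h⟩
  let m0 := Nat.find hex
  obtain ⟨hm0, δ, hδ, hmax⟩ := Nat.find_spec hex
  change m0 ∈ S at hm0
  change ∀ m' ∈ S, γ m' * δ ^ m' ≤ γ m0 * δ ^ m0 at hmax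
  obtain ⟨δ', hδ', hlt⟩ := hcl δ hδ
  have hδ0 : δ ≠ 0 := fun e => h0 (e ▸ hδ)
  have hδ'0 : δ' ≠ 0 := fun e => h0 (e ▸ hδ')
  have hpos : 0 < γ m0 * δ ^ m0 := by
    obtain ⟨m, hm, h⟩ := hbig δ hδ
    exact zero_le.trans_lt (h.trans_le (hmax m hm))
  have hε : δ' = δ * (δ' / δ) := by field_simp
  set ε := δ' / δ with hεd
  have hε1 : ε < 1 := (div_lt_one₀ (zero_lt_iff.2 hδ0)).2 hlt
  have hε0 : 0 < ε := zero_lt_iff.2 (div_ne_zero hδ'0 hδ0)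
  have hlarge : ∀ m ∈ S, m0 < m → γ m * δ' ^ m < γ m0 * δ' ^ m0 := by
    intro m hm hmm
    rw [hε, mul_pow, mul_pow, ← mul_assoc, ← mul_assoc]
    calc γ m * δ ^ m * ε ^ m ≤ γ m0 * δ ^ m0 * ε ^ m := mul_le_mul_left (hmax m hm) _
      _ < _ := mul_lt_mul_of_pos_left (pow_lt_pow_right_of_lt_one₀ hε0 hε1 hmm) hpos
  obtain ⟨m1, hm1, hmax1⟩ := hS δ' hδ'
  have hle : m0 ≤ m1 := Nat.find_min' hex ⟨hm1, δ', hδ', hmax1⟩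
  have heq : m1 = m0 := by
    by_contra hne
    exact absurd (hlarge m1 hm1 (lt_of_le_of_ne hle (Ne.symm hne))) (not_lt.2 (hmax1 m0 hm0))
  rw [heq] at hmax1
  refine ⟨δ', hδ', m0, hm0, ?_, fun m hm hne => ?_⟩
  · obtain ⟨m, hm, h⟩ := hbig δ' hδ'
    exact h.trans_le (hmax1 m hm)
  · refine lt_of_le_of_ne (hmax1 m hm) fun e => ?_
    have h2 : m0 ≤ m := Nat.find_min' hex ⟨hm, δ', hδ', fun m' hm' => by rw [e]; exact hmax1 m' hm'⟩
    exact (hlarge m hm (lt_of_le_of_ne h2 (Ne.symm hne))).ne e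

namespace Base
variable {B : Subfield L}

theorem etale_mem {E : Subring L} (hE : EtClosed O E) (hC : Ctx O k) {x e : L}
    (hx : O.valuation x = 1) {m0 : ℕ} (hm0 : (m0 : L) ≠ 0) (S : Finset ℕ) (d : ℕ → L)
    (hd : ∀ m ∈ S, d m ∈ E ∧ O.valuation (d m) < 1) (he : e ∈ E)
    (heq : x ^ m0 + ∑ m ∈ S, d m * x ^ m = e) : x ∈ E := by
  have hxO : x ∈ O := vle.2 hx.le
  refine hE (X ^ m0 + ∑ m ∈ S, C (d m) * X ^ m - C e) (fun i => ?_) x hxO ?_ ?_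
  · rw [coeff_sub, coeff_add, finsetSum_coeff, coeff_X_pow, coeff_C]
    refine sub_mem (add_mem ?_ (sum_mem fun m hm => ?_)) ?_
    · split_ifs; exacts [one_mem _, zero_mem _]
    · rw [coeff_C_mul, coeff_X_pow]
      refine mul_mem (hd m hm).1 ?_
      split_ifs; exacts [one_mem _, zero_mem _]
    · split_ifs; exacts [he, zero_mem _]
  · simp only [eval_sub, eval_add, eval_finsetSum, eval_mul, eval_C, eval_pow, eval_X]
    rw [heq, sub_self]
  · have h1 : O.valuation ((m0 : L) * x ^ (m0 - 1)) = 1 := by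
      rw [map_mul, map_pow, hx, one_pow, mul_one]
      exact hC.vone (natCast_mem k m0) hm0
    refine v_eq_one_of_sub h1 ?_
    have h2 : (derivative (X ^ m0 + ∑ m ∈ S, C (d m) * X ^ m - C e)).eval x - (m0 : L) * x ^ (m0 - 1)
        = ∑ m ∈ S, d m * ((m : L) * x ^ (m - 1)) := by
      simp only [derivative_sub, derivative_add, derivative_sum, derivative_C_mul, derivative_X_pow,
        derivative_C, sub_zero, eval_add, eval_finsetSum, eval_mul, eval_C, eval_pow, eval_X,
        map_natCast, eval_natCast]
      ring
    rw [h2]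
    refine Valuation.map_sum_lt _ one_ne_zero fun m hm => ?_
    rw [map_mul]
    have h3 : O.valuation ((m : L) * x ^ (m - 1)) ≤ 1 :=
      vle.1 (mul_mem (hC.hk _ (natCast_mem k m)) (pow_mem hxO _))
    exact (mul_le_of_le_one_right zero_le h3).trans_lt (hd m hm).2

theorem step [IsAlgClosed L] (p : ℕ) [ExpChar L p] [PerfectRing L p] (hp : p.Prime) (hB : Base O k B)
    (hC : Ctx O k) {t y : L} (ht : t ∉ B) (hy : y ∉ Mof hC (frame p hB t))
    (hyM : y ^ p - y ∈ Mof hC (frame p hB t)) :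
    ∃ t' ∉ B, Mof hC (frame p hB t) ≤ Mof hC (frame p hB t') ∧ y ∈ Mof hC (frame p hB t') := by
  classical
  haveI : CharP L p := by
    rcases ‹ExpChar L p› with _ | _
    · exact absurd hp Nat.not_prime_one
    · assumption
  have hp0 : (p : L) = 0 := CharP.cast_eq_zero L p
  obtain ⟨r, ⟨n, hrn⟩, u, hu, e1⟩ := Mof_decomp hC (frame p hB t) hyM
  obtain ⟨w, hw⟩ := AS_surj hp u
  have hwU : w ∈ Uof O (Rt B p t) := AS_mem (Et_closed _ _) Uof_le_O hp hp0 (by rw [hw]; exact hu)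
  have hwM := Uof_le_Mof hC (frame p hB t) hwU
  obtain ⟨s, hs⟩ := IsAlgClosed.exists_pow_nat_eq t (pow_pos (expChar_pos L p) n)
  have hsB : s ∉ B := fun h => ht (by rw [← hs]; exact pow_mem h _)
  obtain ⟨G, hG⟩ := root_Bt p hB hrn le_rfl hs
  change aeval s G = r at hG
  have hsR : ∀ z ∈ Bt B s, z ∈ Rt B p t := fun z hz => Bt_le (fun c hc => Bt_le_Rt p (B_mem_Bt hc))
    (⟨n, by rw [hs]; exact self_mem_Bt⟩ : s ∈ Rt B p t) hz
  obtain ⟨S, γ, hS, a0, hnear⟩ := normal_form p hp hB hC hsB G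
  have hne : ∀ a : ↥B, s - a ≠ 0 := fun a e => hsB (by rw [sub_eq_zero.1 e]; exact a.2)
  obtain ⟨_, ⟨a, ha, rfl⟩, m0, hm0, hbig, hdom⟩ := dom S γ
      {δ | ∃ a : ↥B, O.valuation (s - a) ≤ O.valuation (s - a0) ∧ O.valuation (s - a) = δ}
      ⟨_, a0, le_rfl, rfl⟩ (by
        rintro ⟨a, -, e⟩
        exact hne a ((Valuation.zero_iff _).1 e)) (by
        rintro _ ⟨a, ha, rfl⟩
        obtain ⟨a', ha'⟩ := hB.closer hC hsB a
        exact ⟨_, ⟨a', (ha'.le.trans ha), rfl⟩, ha'⟩) (by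
        rintro _ ⟨a, ha, rfl⟩
        by_contra hcon
        push Not at hcon
        obtain ⟨c, w', hw', hc, e2⟩ := hnear a ha
        apply hy
        have h1 : y - w - w' ∈ Uof O (Rt B p t) := by
          refine AS_mem (Et_closed _ _) Uof_le_O hp hp0 ?_
          have : (y - w - w') ^ p - (y - w - w') = ∑ m ∈ S, (c m : L) * (s - a) ^ m := by
            rw [sub_pow_expChar, sub_pow_expChar]
            linear_combination e1 - hw + e2 - hG
          rw [this]
          refine sum_mem fun m hm => le_Uof (hsR _ (mul_mem (B_mem_Bt (c m).2)
            (pow_mem (sub_mem self_mem_Bt (B_mem_Bt a.2)) _))) ?_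
          rw [vle, map_mul, map_pow, hc m hm]
          exact hcon m hm
        have h2 := add_mem (add_mem (Uof_le_Mof hC (frame p hB t) h1)
          (le_Mof hC (frame p hB t) (hsR _ hw'))) hwM
        convert h2 using 1; ring)
  obtain ⟨c, w', hw', hc, e2⟩ := hnear a ha
  obtain ⟨b, hb, hb0, hbv⟩ := hB.vals _ (hne a)
  have hm0p : (m0 : L) ≠ 0 := by
    rw [Ne, CharP.cast_eq_zero_iff L p]; exact hS m0 hm0
  have hcm0 : (c m0 : L) ≠ 0 := by
    intro e
    rw [← hc m0 hm0, e, map_zero, zero_mul] at hbig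
    exact absurd hbig (not_lt.2 zero_le)
  set q := y - w - w' with hq
  have hqe : q ^ p - q = ∑ m ∈ S, (c m : L) * (s - a) ^ m := by
    rw [hq, sub_pow_expChar, sub_pow_expChar]
    linear_combination e1 - hw + e2 - hG
  have hw'M := le_Mof hC (frame p hB t) (hsR _ hw')
  have hqB : q ∉ B := by
    intro h
    apply hy
    have h2 := add_mem (add_mem (le_Mof hC (frame p hB t) (Bt_le_Rt p (B_mem_Bt h))) hw'M) hwM
    convert h2 using 1; rw [hq]; ring
  set x := (s - a) / b with hx
  have hsx : s - a = b * x := by rw [hx]; field_simp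
  have hvx : O.valuation x = 1 := by
    rw [hx, map_div₀, ← hbv]; exact div_self ((Valuation.pos_iff _).2 hb0).ne'
  have hcc : (c m0 : L) * b ^ m0 ≠ 0 := mul_ne_zero hcm0 (pow_ne_zero _ hb0)
  have hxU : x ∈ Uof O (Rt B p q) := by
    have hdlt : ∀ m ∈ S.erase m0, O.valuation ((c m : L) * b ^ m / (c m0 * b ^ m0)) < 1 := by
      intro m hm
      rw [map_div₀, div_lt_one₀ ((Valuation.pos_iff _).2 hcc), map_mul, map_mul, map_pow, map_pow,
        hbv, hc m (Finset.mem_of_mem_erase hm), hc m0 hm0]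
      exact hdom m (Finset.mem_of_mem_erase hm) (Finset.ne_of_mem_erase hm)
    have heq : x ^ m0 + ∑ m ∈ S.erase m0, ((c m : L) * b ^ m / (c m0 * b ^ m0)) * x ^ m =
        (q ^ p - q) * (c m0 * b ^ m0)⁻¹ := by
      rw [hqe, ← Finset.add_sum_erase _ _ hm0, add_mul, Finset.sum_mul]
      congr 1
      · rw [hsx, mul_pow]; field_simp
      · refine Finset.sum_congr rfl fun m _ => ?_
        rw [hsx, mul_pow]; field_simp
    refine etale_mem (Et_closed O _) hC hvx hm0p (S.erase m0) _ (fun m hm => ⟨le_Uof (Bt_le_Rt p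
      (B_mem_Bt (div_mem (mul_mem (c m).2 (pow_mem hb _)) (mul_mem (c m0).2 (pow_mem hb _)))))
      (vle.2 (hdlt m hm).le), hdlt m hm⟩) (le_Uof (Bt_le_Rt p (mul_mem (sub_mem (pow_mem self_mem_Bt _)
      self_mem_Bt) (B_mem_Bt (inv_mem (mul_mem (c m0).2 (pow_mem hb _)))))) ?_) heq
    rw [← heq]
    have hxO : x ∈ O := vle.2 hvx.le
    exact add_mem (pow_mem hxO _) (sum_mem fun m hm => mul_mem (vle.2 (hdlt m hm).le) (pow_mem hxO _))
  have hBM : ∀ z ∈ B, z ∈ Mof hC (frame p hB q) := fun z hz => le_Mof hC _ (Bt_le_Rt p (B_mem_Bt hz))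
  have hsM : s ∈ Mof hC (frame p hB q) := by
    have : s = a + b * x := by rw [← hsx]; ring
    rw [this]
    exact add_mem (hBM _ a.2) (mul_mem (hBM _ hb) (Uof_le_Mof hC _ hxU))
  have hok := Mof_ok hC (frame p hB q) p fun z => Rt_perf p
  have hle : Mof hC (frame p hB t) ≤ Mof hC (frame p hB q) := by
    refine Mof_min hC (frame p hB t) hok.closed ?_
    rintro z ⟨n', hz⟩
    have hz' : z ^ p ^ n' ∈ (Mof hC (frame p hB q)).toSubring :=
      Bt_le hBM (by rw [← hs]; exact pow_mem hsM _) hz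
    exact perf_pow hok.perf n' z hz'
  refine ⟨q, hqB, hle, ?_⟩
  have h2 := add_mem (add_mem (le_Mof hC (frame p hB q) (Bt_le_Rt p self_mem_Bt)) (hle hw'M)) (hle hwM)
  convert h2 using 1; rw [hq]; ring

theorem immediate [IsAlgClosed L] (hB : Base O k B) (hC : Ctx O k) {t0 : L} (ht0 : t0 ∉ B)
    (Z : Finset L) (hZO : (Z : Set L) ⊆ O)
    (hZ : ∀ z ∈ Z, IsAlgebraic ↥(Subfield.closure ((B : Set L) ∪ {t0})) z) :
    ∃ x ∈ O, (Z : Set L) ⊆ Et O (Subring.closure ({x : L | x ∈ B ∧ x ∈ O} ∪ {x})) := by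
  obtain ⟨p, hpe⟩ := ExpChar.exists L
  haveI := hpe
  haveI : PerfectRing L p := inferInstance
  obtain ⟨M', ⟨t, ht, rfl⟩, -, hsub⟩ := AS_tower_finset hC (p := p)
    {M | ∃ t ∉ B, M = Mof hC (frame p hB t)} (by
      rintro _ ⟨t, ht, rfl⟩
      exact Mof_ok hC (frame p hB t) p fun z => Rt_perf p) (by
      rintro hp _ ⟨t, ht, rfl⟩ y hy hyM
      obtain ⟨t', h1, h2, h3⟩ := step p hp hB hC ht hy hyM
      exact ⟨_, ⟨t', h1, rfl⟩, h2, h3⟩) (M := Mof hC (frame p hB t0)) ⟨t0, ht0, rfl⟩ Z (by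
      intro z hz
      have hle : Subfield.closure ((B : Set L) ∪ {t0}) ≤ Mof hC (frame p hB t0) := by
        rw [Subfield.closure_le]
        rintro z (hz | hz)
        · exact le_Mof hC _ (Bt_le_Rt p (B_mem_Bt hz))
        · rw [Set.mem_singleton_iff.1 hz]
          exact le_Mof hC _ (Bt_le_Rt p self_mem_Bt)
      obtain ⟨f, hf, hfz⟩ := hZ z hz
      refine ⟨f.map (Subfield.inclusion hle), (Polynomial.map_ne_zero_iff
        (Subfield.inclusion hle).injective).2 hf, ?_⟩
      rw [aeval_def, eval₂_map]
      exact hfz)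
  exact extract p hB hC ht Z fun z hz => by
    rw [SetLike.mem_coe, ← Mof_inf hC (frame p hB t)]; exact ⟨hsub hz, hZO hz⟩

end Base
end LU

namespace LU
variable {L : Type*} [Field L] {O : ValuationSubring L} {κ : Subfield L}

theorem alg_in_O (hκ : ∀ c ∈ κ, c ∈ O) {z : L} (hz : IsAlgebraic ↥κ z) : z ∈ O := by
  obtain ⟨f, hf, hfz⟩ := hz.isIntegral
  let φ : ↥κ →+* ↥O := ⟨⟨⟨fun c => ⟨c.1, hκ _ c.2⟩, rfl⟩, fun _ _ => rfl⟩, rfl, fun _ _ => rfl⟩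
  have : IsIntegral ↥O z := by
    refine ⟨f.map φ, hf.map φ, ?_⟩
    rw [eval₂_map]
    exact hfz
  obtain ⟨y, hy⟩ := IsIntegrallyClosed.isIntegral_iff.1 this
  rw [← hy]; exact y.2

theorem alg_vone (hκ : ∀ c ∈ κ, c ∈ O) {z : L} (hz : IsAlgebraic ↥κ z) (h0 : z ≠ 0) :
    O.valuation z = 1 := by
  refine le_antisymm (vle.1 (alg_in_O hκ hz)) ?_
  have := vle.1 (alg_in_O hκ hz.inv)
  rw [map_inv₀] at this
  exact (inv_le_one₀ ((Valuation.pos_iff _).2 h0)).1 this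

theorem sep_mem (p : ℕ) [ExpChar L p] {E : Subring L} (hE : EtClosed O E) (hκE : ∀ c ∈ κ, c ∈ E)
    (hκ : ∀ c ∈ κ, c ∈ O) {z : L} (hz : IsAlgebraic ↥κ z) : ∃ n : ℕ, z ^ p ^ n ∈ E := by
  haveI : ExpChar ↥κ p := (algebraMap ↥κ L).expChar (algebraMap ↥κ L).injective p
  obtain ⟨g, hg, n, hn⟩ := (minpoly.irreducible hz.isIntegral).hasSeparableContraction p
  refine ⟨n, ?_⟩
  have h0 : aeval (z ^ p ^ n) g = 0 := by
    have := minpoly.aeval ↥κ z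
    rwa [← hn, expand_aeval] at this
  have hzn : IsAlgebraic ↥κ (z ^ p ^ n) := hz.pow _
  have h1 := hg.aeval_derivative_ne_zero h0
  refine hE (g.map (algebraMap ↥κ L)) (fun i => ?_) _ (alg_in_O hκ hzn) ?_ ?_
  · rw [coeff_map]; exact hκE _ (g.coeff i).2
  · rw [eval_map_algebraMap, h0]
  · rw [derivative_map, eval_map_algebraMap]
    refine alg_vone hκ ?_ h1
    have := Polynomial.aeval_algebraMap_apply L
      (⟨z ^ p ^ n, mem_algebraicClosure_iff.2 hzn⟩ : algebraicClosure ↥κ L) g.derivative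
    change aeval (z ^ p ^ n) (derivative g) = _ at this
    rw [this]
    exact mem_algebraicClosure_iff.1 (SetLike.coe_mem _)

theorem top_case [IsAlgClosed L] (κ : Subfield L) (hκp : ∀ p : ℕ, p ≠ 0 → ∀ z, z ^ p ∈ κ → z ∈ κ)
    (T : Finset L) (hT : ∀ z : L, IsAlgebraic ↥(Subfield.closure ((κ : Set L) ∪ T)) z) (Z : Finset L) :
    ∃ t : Finset L, t.card ≤ T.card ∧
      (Z : Set L) ⊆ Et (⊤ : ValuationSubring L) (Subring.closure ((κ : Set L) ∪ t)) := by
  classical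
  obtain ⟨p, hpe⟩ := ExpChar.exists L
  haveI := hpe
  haveI : PerfectRing L p := inferInstance
  have hp0 := (expChar_pos L p).ne'
  let R0 := Subring.closure ((κ : Set L) ∪ T)
  let R : Subring L :=
    { carrier := {z | ∃ n : ℕ, z ^ p ^ n ∈ R0}
      zero_mem' := ⟨0, by simpa using zero_mem _⟩
      one_mem' := ⟨0, by simpa using one_mem _⟩
      neg_mem' := by
        rintro x ⟨n, hn⟩
        refine ⟨n, ?_⟩
        have := map_neg (iterateFrobenius L p n) x
        simp only [iterateFrobenius_def] at this
        rw [this]; exact neg_mem hn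
      add_mem' := by
        rintro x y ⟨n, hn⟩ ⟨m, hm⟩
        refine ⟨n + m, ?_⟩
        rw [add_pow_expChar_pow]
        refine add_mem ?_ ?_
        · rw [pow_add, pow_mul]; exact pow_mem hn _
        · rw [add_comm n m, pow_add, pow_mul]; exact pow_mem hm _
      mul_mem' := by
        rintro x y ⟨n, hn⟩ ⟨m, hm⟩
        refine ⟨n + m, ?_⟩
        rw [mul_pow]
        refine mul_mem ?_ ?_
        · rw [pow_add, pow_mul]; exact pow_mem hn _
        · rw [add_comm n m, pow_add, pow_mul]; exact pow_mem hm _ }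
  have hRperf : ∀ z, z ^ p ∈ R → z ∈ R := by
    rintro z ⟨n, hn⟩
    exact ⟨n + 1, by rw [pow_succ', pow_mul]; exact hn⟩
  let E := Uof (⊤ : ValuationSubring L) R
  have hEc : EtClosed (⊤ : ValuationSubring L) E := Et_closed _ _
  have htop : ∀ z : L, z ∈ (⊤ : ValuationSubring L) := fun z => ValuationSubring.mem_top z
  have hv1 : ∀ z : L, z ≠ 0 → (⊤ : ValuationSubring L).valuation z = 1 := by
    intro z hz
    refine le_antisymm (vle.1 (htop z)) ?_
    have := vle.1 (htop z⁻¹)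
    rw [map_inv₀] at this
    exact (inv_le_one₀ ((Valuation.pos_iff _).2 hz)).1 this
  let EF : Subfield L := { E with
    inv_mem' := by
      intro z hz
      by_cases h0 : z = 0
      · rw [h0, inv_zero]; exact zero_mem E
      · exact hEc.inv hz (hv1 z h0) }
  have hle : Subfield.closure ((κ : Set L) ∪ T) ≤ EF := by
    rw [Subfield.closure_le]
    intro z hz
    exact le_Uof (R := R) ⟨0, by simpa using Subring.subset_closure hz⟩ (htop z)
  have hall : ∀ z, z ∈ E := by
    intro z
    obtain ⟨n, hn⟩ := sep_mem p hEc (fun c hc => hle hc) (fun c _ => htop c) (hT z)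
    exact perf_pow (S := (E : Set L)) (fun z hz => Uof_perf p hRperf hz) n z hn
  obtain ⟨A, hA, hZA⟩ := Et_finite_set Z (fun z _ => hall z)
  have hA' : ∀ z, ∃ n : ℕ, z ∈ A → z ^ p ^ n ∈ R0 := by
    intro z
    by_cases hz : z ∈ A
    · obtain ⟨n, hn⟩ := (hA hz).1; exact ⟨n, fun _ => hn⟩
    · exact ⟨0, fun h => absurd h hz⟩
  choose n hn using hA'
  let N := ∑ z ∈ A, n z
  have hNpos : 0 < p ^ N := pow_pos (expChar_pos L p) N
  choose rt hrt using fun x : L => IsAlgClosed.exists_pow_nat_eq x hNpos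
  refine ⟨T.image rt, Finset.card_image_le, hZA.trans (Et_mono ?_)⟩
  rw [Subring.closure_le]
  intro z hz
  have h1 : z ^ p ^ N ∈ R0 := by
    obtain ⟨m, hm⟩ := Nat.exists_eq_add_of_le
      (Finset.single_le_sum (f := n) (fun _ _ => Nat.zero_le _) hz)
    change N = _ at hm
    rw [hm, pow_add, pow_mul]; exact pow_mem (hn z hz) _
  have h2 : R0 ≤ (Subring.closure ((κ : Set L) ∪ (T.image rt : Finset L))).map
      (iterateFrobenius L p N) := by
    rw [Subring.closure_le]
    rintro x (hx | hx)
    · refine ⟨rt x, Subring.subset_closure (Or.inl (hκp _ hNpos.ne' _ (by rw [hrt]; exact hx))), ?_⟩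
      rw [iterateFrobenius_def, hrt]
    · refine ⟨rt x, Subring.subset_closure (Or.inr (Finset.mem_image_of_mem _ hx)), ?_⟩
      rw [iterateFrobenius_def, hrt]
  obtain ⟨y, hy, e⟩ := h2 h1
  have : y = z := iterateFrobenius_inj L p N (by rw [e, iterateFrobenius_def])
  rw [← this]; exact hy

end LU

namespace LU
variable {L : Type*} [Field L] {O : ValuationSubring L}

theorem v_eq_one_iff {x : L} : O.valuation x = 1 ↔ x ≠ 0 ∧ x ∈ O ∧ x⁻¹ ∈ O := by
  constructor
  · intro h
    refine ⟨?_, vle.2 h.le, vle.2 ?_⟩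
    · rintro rfl; simp at h
    · rw [map_inv₀, h, inv_one]
  · rintro ⟨h0, h1, h2⟩
    refine le_antisymm (vle.1 h1) ?_
    have := vle.1 h2
    rw [map_inv₀] at this
    exact (inv_le_one₀ ((Valuation.pos_iff _).2 h0)).1 this

theorem Et_map {M : Type*} [Field M] (φ : M →+* L) (R : Subring M) :
    (Et (O.comap φ) R).map φ ≤ Et O (R.map φ) := by
  rw [Subring.map_le_iff_le_comap]
  refine Et_min (Subring.map_le_iff_le_comap.1 (le_Et _ _)) ?_
  intro f hf η hη h0 h1
  refine Et_closed O (R.map φ) (f.map φ) (fun i => by rw [coeff_map]; exact hf i) (φ η) hη ?_ ?_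
  · rw [eval_map_apply, h0, map_zero]
  · rw [derivative_map, eval_map_apply]
    rw [v_eq_one_iff] at h1 ⊢
    exact ⟨(map_ne_zero φ).2 h1.1, h1.2.1, by rw [← map_inv₀]; exact h1.2.2⟩

theorem exists_kappa {k0 : Type*} [Field k0] [Algebra k0 L] [IsAlgClosed L] (Ow : ValuationSubring L)
    (hk : ∀ c : k0, algebraMap k0 L c ∈ Ow) :
    ∃ κ : IntermediateField k0 L, (∀ c ∈ κ, c ∈ Ow) ∧ (∀ z : L, IsAlgebraic ↥κ z → z ∈ κ) ∧
      ∀ z ∈ Ow, ∃ c ∈ κ, Ow.valuation (z - c) < 1 := by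
  obtain ⟨κ, -, hκ⟩ := zorn_le_nonempty₀ {κ : IntermediateField k0 L | ∀ c ∈ κ, c ∈ Ow} (by
    intro C hC hch κ0 hκ0
    haveI : Nonempty ↥C := ⟨⟨κ0, hκ0⟩⟩
    refine ⟨⨆ κ : ↥C, (κ : IntermediateField k0 L), ?_, fun κ hκ => le_iSup (fun κ : ↥C => (κ : IntermediateField k0 L)) ⟨κ, hκ⟩⟩
    intro c hc
    rw [← SetLike.mem_coe, IntermediateField.coe_iSup_of_directed hch.directed, Set.mem_iUnion] at hc
    obtain ⟨κ, hc⟩ := hc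
    exact hC κ.2 c hc) (⊥ : IntermediateField k0 L) (by
    intro c hc
    obtain ⟨c, rfl⟩ := IntermediateField.mem_bot.1 hc
    exact hk c)
  have hκO : ∀ c ∈ κ, c ∈ Ow := hκ.prop
  have hmax : ∀ κ' : IntermediateField k0 L, κ ≤ κ' → (∀ c ∈ κ', c ∈ Ow) → κ' ≤ κ := fun κ' h1 h2 =>
    hκ.le_of_ge h2 h1
  have halg : ∀ z : L, IsAlgebraic ↥κ z → z ∈ κ := by
    intro z hz
    refine hmax ((algebraicClosure ↥κ L).restrictScalars k0) ?_ ?_ (mem_algebraicClosure_iff.2 hz)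
    · intro c hc
      exact mem_algebraicClosure_iff.2 (isAlgebraic_algebraMap (⟨c, hc⟩ : ↥κ))
    · intro c hc
      exact alg_in_O (κ := κ.toSubfield) hκO (mem_algebraicClosure_iff.1 hc)
  refine ⟨κ, hκO, halg, ?_⟩
  intro z hz
  by_contra hcon
  push Not at hcon
  haveI : IsAlgClosed ↥κ := algClosed_of (B := κ.toSubfield) halg
  have h1 : ∀ (n : ℕ) (f : (↥κ)[X]), f ≠ 0 → f.natDegree ≤ n → Ow.valuation (aeval z f) = 1 := by
    intro n
    induction n with
    | zero =>
      intro f hf hn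
      rw [Nat.le_zero, natDegree_eq_zero] at hn
      obtain ⟨c, rfl⟩ := hn
      rw [aeval_C]
      refine vone_of_subfield (κ := κ.toSubfield) hκO c.2 ?_
      intro e
      exact hf (by rw [show c = 0 from Subtype.ext e, C_0])
    | succ n ih =>
      intro f hf hn
      by_cases hd : f.natDegree = 0
      · exact ih f hf (by omega)
      obtain ⟨α, hα⟩ := IsAlgClosed.exists_root f (by
        intro h; exact hd (natDegree_eq_of_degree_eq_some h))
      obtain ⟨g, rfl⟩ := dvd_iff_isRoot.2 hα
      have hg0 : g ≠ 0 := right_ne_zero_of_mul hf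
      rw [natDegree_mul (X_sub_C_ne_zero α) hg0, natDegree_X_sub_C] at hn
      rw [map_mul, map_mul, ih g hg0 (by omega), mul_one, map_sub, aeval_X, aeval_C]
      exact le_antisymm (vle.1 (sub_mem hz (hκO _ α.2))) (hcon _ α.2)
  have h2 : (IntermediateField.adjoin ↥κ {z}).restrictScalars k0 ≤ κ := by
    refine hmax _ ?_ ?_
    · intro c hc
      exact (IntermediateField.adjoin ↥κ {z}).algebraMap_mem ⟨c, hc⟩
    · intro c hc
      have hc : c ∈ IntermediateField.adjoin ↥κ {z} := hc
      obtain ⟨f, g, rfl⟩ := (IntermediateField.mem_adjoin_simple_iff _ _).1 hc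
      by_cases hf : f = 0
      · rw [hf, map_zero, zero_div]; exact zero_mem Ow
      by_cases hg : g = 0
      · rw [hg, map_zero, div_zero]; exact zero_mem Ow
      rw [vle, map_div₀, h1 _ f hf le_rfl, h1 _ g hg le_rfl, div_one]
  have h3 := hcon z (h2 (IntermediateField.mem_adjoin_simple_self ↥κ z))
  rw [sub_self, map_zero] at h3
  exact absurd h3 (not_le.2 zero_lt_one)

theorem arch_of {k : Subfield L} (hk : ∀ c ∈ k, c ∈ O)
    (h : ∀ Ow : ValuationSubring L, O ≤ Ow → Ow ≠ ⊤ → ∀ z ∈ Ow, ∃ c ∈ k, Ow.valuation (z - c) < 1)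
    (hO : O ≠ ⊤) : Ctx O k where
  hk := hk
  res := h O le_rfl hO
  arch := by
    intro a b ha hb
    by_contra hcon
    push Not at hcon
    have ha0 : a ≠ 0 := by
      rintro rfl
      have := hcon 1
      rw [pow_one, map_zero] at this
      exact absurd this (not_lt.2 zero_le)
    have haO : a ∈ O := vle.2 ha.le
    let Ow : ValuationSubring L :=
      { carrier := {z | ∃ n : ℕ, z * a ^ n ∈ O}
        zero_mem' := ⟨0, by simpa using zero_mem O⟩
        one_mem' := ⟨0, by simpa using one_mem O⟩
        neg_mem' := by
          rintro x ⟨n, hn⟩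
          exact ⟨n, by rw [neg_mul]; exact neg_mem hn⟩
        add_mem' := by
          rintro x y ⟨n, hn⟩ ⟨m, hm⟩
          refine ⟨n + m, ?_⟩
          have : (x + y) * a ^ (n + m) = x * a ^ n * a ^ m + y * a ^ m * a ^ n := by ring
          rw [this]
          exact add_mem (mul_mem hn (pow_mem haO _)) (mul_mem hm (pow_mem haO _))
        mul_mem' := by
          rintro x y ⟨n, hn⟩ ⟨m, hm⟩
          refine ⟨n + m, ?_⟩
          have : (x * y) * a ^ (n + m) = (x * a ^ n) * (y * a ^ m) := by ring
          rw [this]; exact mul_mem hn hm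
        mem_or_inv_mem' := by
          intro x
          rcases O.mem_or_inv_mem x with h | h
          · exact Or.inl ⟨0, by simpa using h⟩
          · exact Or.inr ⟨0, by simpa using h⟩ }
    have hle : O ≤ Ow := fun x hx => ⟨0, by simpa using hx⟩
    have hne : Ow ≠ ⊤ := by
      intro e
      obtain ⟨n, hn⟩ : b⁻¹ ∈ Ow := by rw [e]; exact ValuationSubring.mem_top _
      have h1 := hcon n
      rw [vle, map_mul, map_inv₀, inv_mul_le_iff₀ ((Valuation.pos_iff _).2 hb), mul_one] at hn
      exact absurd h1 (not_lt.2 hn)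
    obtain ⟨c, hc, hlt⟩ := h Ow hle hne a⁻¹ ⟨1, by
      rw [pow_one, inv_mul_cancel₀ ha0]; exact one_mem O⟩
    have h1 := lt_of_lt hle hlt
    have h2 : a⁻¹ ∈ O := by
      have : a⁻¹ = (a⁻¹ - c) + c := by ring
      rw [this]; exact add_mem (vle.2 h1.le) (hk c hc)
    rw [vle, map_inv₀] at h2
    exact absurd ha (not_lt.2 ((inv_le_one₀ ((Valuation.pos_iff _).2 ha0)).1 h2))

end LU

set_option maxHeartbeats 400000

namespace LU
variable {L : Type*} [Field L] {O : ValuationSubring L}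

def Indep (O : ValuationSubring L) {r : ℕ} (x : Fin r → L) : Prop :=
  (∀ i, x i ≠ 0) ∧ ∀ e : Fin r → ℤ, O.valuation (∏ i, x i ^ e i) = 1 → e = 0

theorem Indep.algInd {k0 : Type*} [Field k0] [Algebra k0 L] (hk : ∀ c : k0, algebraMap k0 L c ∈ O)
    {r : ℕ} {x : Fin r → L} (hx : Indep O x) : AlgebraicIndependent k0 x := by
  classical
  rw [algebraicIndependent_iff]
  intro p hp
  by_contra hp0
  rw [MvPolynomial.aeval_def, MvPolynomial.eval₂_eq'] at hp
  obtain ⟨m, hm, hmax⟩ := Finset.exists_max_image p.support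
    (fun d => O.valuation (algebraMap k0 L (p.coeff d) * ∏ i, x i ^ d i))
    (MvPolynomial.support_nonempty.2 hp0)
  have hv : ∀ d ∈ p.support, O.valuation (algebraMap k0 L (p.coeff d) * ∏ i, x i ^ d i) =
      O.valuation (∏ i, x i ^ d i) := by
    intro d hd
    rw [map_mul, v_eq_one_iff.2 ⟨(_root_.map_ne_zero _).2 (MvPolynomial.mem_support_iff.1 hd), hk _, by
      rw [← map_inv₀]; exact hk _⟩, one_mul]
  have hne : ∀ d : Fin r →₀ ℕ, (∏ i, x i ^ d i) ≠ 0 := fun d =>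
    Finset.prod_ne_zero_iff.2 fun i _ => pow_ne_zero _ (hx.1 i)
  have hlt := Valuation.map_sum_eq_of_lt O.valuation (s := p.support) (j := m)
    (f := fun d => algebraMap k0 L (p.coeff d) * ∏ i, x i ^ d i) hm (by
      intro d hd
      rw [Finset.mem_sdiff, Finset.mem_singleton] at hd
      refine lt_of_le_of_ne (hmax d hd.1) ?_
      rw [hv d hd.1, hv m hm]
      intro e
      have h1 := hx.2 (fun i => (d i : ℤ) - m i) (by
        have : (∏ i, x i ^ ((d i : ℤ) - m i)) = (∏ i, x i ^ d i) / ∏ i, x i ^ m i := by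
          rw [← Finset.prod_div_distrib]
          refine Finset.prod_congr rfl fun i _ => ?_
          rw [zpow_sub₀ (hx.1 i), zpow_natCast, zpow_natCast]
        rw [this, map_div₀, e, div_self ((Valuation.ne_zero_iff _).2 (hne m))])
      apply hd.2
      ext i
      have := congrFun h1 i
      simp only [Pi.zero_apply] at this
      omega)
  rw [hp, map_zero, hv m hm] at hlt
  exact (Valuation.ne_zero_iff _).2 (hne m) hlt.symm

theorem zpow_of_add {V : Type*} [AddCommGroup V] {g : V → L} (h0 : g 0 = 1)
    (ha : ∀ a b, g (a + b) = g a * g b) (a : V) (n : ℤ) : g (n • a) = g a ^ n := by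
  have hne : g a ≠ 0 := by
    intro h
    have := ha a (-a)
    rw [add_neg_cancel, h0, h, zero_mul] at this
    exact one_ne_zero this
  induction n using Int.induction_on with
  | zero => simp [h0]
  | succ n ih => rw [add_zsmul, one_zsmul, ha, ih, zpow_add_one₀ hne]
  | pred n ih =>
    have h1 : g ((-(n : ℤ)) • a) = g ((-(n : ℤ) - 1) • a) * g a := by
      rw [← ha, sub_zsmul, one_zsmul, neg_add_cancel_right]
    rw [zpow_sub_one₀ hne, ← ih, h1, mul_assoc, mul_inv_cancel₀ hne, mul_one]

theorem zpow_inj_val {a b : L} {e : ℤ} (he : e ≠ 0)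
    (h : O.valuation a ^ e = O.valuation b ^ e) : O.valuation a = O.valuation b := by
  obtain ⟨n, hn⟩ := Int.eq_nat_or_neg e
  have hn0 : n ≠ 0 := by rintro rfl; simp at hn; exact he hn
  rcases hn with rfl | rfl
  · rw [zpow_natCast, zpow_natCast] at h
    exact (pow_left_inj₀ zero_le zero_le hn0).1 h
  · rw [zpow_neg, zpow_neg, zpow_natCast, zpow_natCast, inv_inj] at h
    exact (pow_left_inj₀ zero_le zero_le hn0).1 h

theorem exists_chi [IsAlgClosed L] {r : ℕ} {x : Fin r → L} (hx : Indep O x)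
    (hmax : ∀ y : Fin (r + 1) → L, ¬ Indep O y) :
    ∃ χ : (Fin r → ℚ) → L, Chi O χ ∧ (∀ a, ∃ n : ℕ, n ≠ 0 ∧ ∃ e : Fin r → ℤ,
      χ a ^ n = ∏ i, x i ^ e i) ∧ ∀ i, ∃ a, χ a = x i := by
  choose ψ hψ1 hψ0 hψa using fun i => exists_psi (x i) (hx.1 i)
  let χ : (Fin r → ℚ) → L := fun a => ∏ i, ψ i (a i)
  have hχ0 : χ 0 = 1 := Finset.prod_eq_one fun i _ => hψ0 i
  have hχa : ∀ a b, χ (a + b) = χ a * χ b := by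
    intro a b
    simp only [χ]
    rw [← Finset.prod_mul_distrib]
    exact Finset.prod_congr rfl fun i _ => hψa i _ _
  have hχz := zpow_of_add hχ0 hχa
  have hχe : ∀ e : Fin r → ℤ, χ (fun i => (e i : ℚ)) = ∏ i, x i ^ e i := by
    intro e
    refine Finset.prod_congr rfl fun i _ => ?_
    have := zpow_of_add (hψ0 i) (hψa i) 1 (e i)
    rw [hψ1] at this
    rw [← this]; simp
  have hχne : ∀ a, χ a ≠ 0 := by
    intro a h
    have := hχa a (-a)
    rw [add_neg_cancel, hχ0, h, zero_mul] at this
    exact one_ne_zero this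
  have hden : ∀ a : Fin r → ℚ, ∃ n : ℕ, n ≠ 0 ∧ ∃ e : Fin r → ℤ, (n : ℤ) • a = fun i => (e i : ℚ) := by
    intro a
    refine ⟨∏ i, (a i).den, Finset.prod_ne_zero_iff.2 fun i _ => (a i).den_nz, ?_⟩
    have : ∀ i, ∃ e : ℤ, ((∏ i, (a i).den : ℕ) : ℚ) * a i = e := by
      intro i
      obtain ⟨c, hc⟩ := Finset.dvd_prod_of_mem (fun i => (a i).den) (Finset.mem_univ i)
      refine ⟨(a i).num * c, ?_⟩
      rw [hc]
      push_cast
      rw [← Rat.mul_den_eq_num (a i)]; ring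
    choose e he using this
    refine ⟨e, funext fun i => ?_⟩
    rw [← he i]
    simp
  refine ⟨χ, ⟨hχ0, hχa, ?_, ?_⟩, ?_, ?_⟩
  · intro a ha
    obtain ⟨n, hn, e, he⟩ := hden a
    have h1 := hx.2 e (by rw [← hχe, ← he, hχz, map_zpow₀, ha, one_zpow])
    subst h1
    ext i
    have := congrFun he i
    simp at this
    exact this.resolve_left hn
  · intro z hz
    have := hmax (Fin.cons z x)
    rw [Indep, not_and] at this
    have := this (Fin.cases hz hx.1)
    push Not at this
    obtain ⟨e, h1, hne⟩ := this
    rw [Fin.prod_univ_succ] at h1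
    simp only [Fin.cons_zero, Fin.cons_succ] at h1
    have he0 : e 0 ≠ 0 := by
      intro h
      rw [h, zpow_zero, one_mul] at h1
      have h2 := hx.2 (fun i => e i.succ) h1
      exact hne (funext (Fin.cases h (fun i => congrFun h2 i)))
    refine ⟨fun i => -(e i.succ : ℚ) / e 0, ?_⟩
    refine zpow_inj_val he0 ?_
    rw [← map_zpow₀, ← hχz]
    have h3 : (e 0 • fun i : Fin r => -(e i.succ : ℚ) / e 0) = fun i => ((-(e i.succ) : ℤ) : ℚ) := by
      ext i
      have : (e 0 : ℚ) ≠ 0 := by exact_mod_cast he0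
      simp
      field_simp
    rw [h3, hχe]
    rw [← map_zpow₀]
    have h4 : (∏ i, x i ^ (-(e i.succ))) = (∏ i, x i ^ e i.succ)⁻¹ := by
      rw [← Finset.prod_inv_distrib]
      exact Finset.prod_congr rfl fun i _ => zpow_neg _ _
    rw [h4, map_inv₀]
    rw [map_mul] at h1
    exact (eq_inv_of_mul_eq_one_left h1).symm
  · intro a
    obtain ⟨n, hn, e, he⟩ := hden a
    exact ⟨n, hn, e, by rw [← hχe, ← he, hχz, zpow_natCast]⟩
  · intro i
    refine ⟨fun j => ((Pi.single i 1 : Fin r → ℤ) j : ℚ), ?_⟩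
    rw [hχe, Finset.prod_eq_single i]
    · simp
    · intro j _ hj; simp [hj]
    · simp

theorem alg_mono {A B : Subfield L} (h : A ≤ B) {z : L} (hz : IsAlgebraic ↥A z) : IsAlgebraic ↥B z := by
  obtain ⟨f, hf, h0⟩ := hz
  refine ⟨f.map (Subfield.inclusion h), (Polynomial.map_ne_zero_iff (Subfield.inclusion h).injective).2 hf, ?_⟩
  rw [aeval_def, eval₂_map]
  exact h0

theorem trdeg_tower {K : Type*} [Field K] [Algebra K L] (B : IntermediateField K L) :
    Algebra.trdeg K ↥B + Algebra.trdeg ↥B L = Algebra.trdeg K L :=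
  trdeg_add_eq K ↥B (A := L)

def Good (O : ValuationSubring L) (k B : Subfield L) (n : ℕ) : Prop :=
  ∀ Z : Finset L, (∀ z ∈ Z, z ∈ B ∧ z ∈ O) → ∃ t : Finset L, (t : Set L) ⊆ O ∧ t.card ≤ n ∧
    (Z : Set L) ⊆ Et O (Subring.closure ((k : Set L) ∪ t))

theorem Good.step [IsAlgClosed L] {k B B' : Subfield L} {n : ℕ} (hG : Good O k B n)
    (hC : Ctx O k) (hB : Base O k B) {t0 : L} (ht0 : t0 ∉ B)
    (hB' : ∀ z ∈ B', IsAlgebraic ↥(Subfield.closure ((B : Set L) ∪ {t0})) z) :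
    Good O k B' (n + 1) := by
  classical
  intro Z hZ
  obtain ⟨x, hxO, hx⟩ := hB.immediate hC ht0 Z (fun z hz => (hZ z hz).2) (fun z hz => hB' z (hZ z hz).1)
  obtain ⟨A, hA, hZA⟩ := Et_finite_gen Z hx
  obtain ⟨t, htO, htc, hAt⟩ := hG A (fun z hz => hA hz)
  refine ⟨insert x t, ?_, (Finset.card_insert_le _ _).trans (by omega), ?_⟩
  · rw [Finset.coe_insert, Set.insert_subset_iff]
    exact ⟨hxO, htO⟩
  · have h1 : Subring.closure ((A : Set L) ∪ {x}) ≤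
        Et O (Subring.closure ((k : Set L) ∪ (insert x t : Finset L))) := by
      rw [Subring.closure_le]
      rintro z (hz | hz)
      · refine Et_mono (Subring.closure_mono (Set.union_subset_union_right _ ?_)) (hAt hz)
        rw [Finset.coe_insert]; exact Set.subset_insert _ _
      · refine le_Et _ _ (Subring.subset_closure (Or.inr ?_))
        rw [Finset.coe_insert]; exact Or.inl hz
    exact hZA.trans (Et_le_of_le_Et h1)

theorem Good.chain [IsAlgClosed L] {k : Subfield L} (hC : Ctx O k) : ∀ (m n : ℕ) (B : Subfield L),
    Base O k B → Good O k B n → Algebra.trdeg ↥B L ≤ m → Good O k ⊤ (n + m) := by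
  intro m
  induction m with
  | zero =>
    intro n B hB hG htr
    have h0 : Algebra.trdeg ↥B L = 0 := by simpa using htr
    rw [trdeg_eq_zero_iff] at h0
    have : B = ⊤ := by
      rw [eq_top_iff]; intro z _; exact hB.alg z (h0.isAlgebraic z)
    rw [← this]; exact hG
  | succ m ih =>
    intro n B hB hG htr
    by_cases hT : B = ⊤
    · subst hT
      intro Z hZ
      obtain ⟨t, h1, h2, h3⟩ := hG Z hZ
      exact ⟨t, h1, by omega, h3⟩
    obtain ⟨t0, ht0⟩ : ∃ t0, t0 ∉ B := by
      by_contra h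
      push Not at h
      exact hT (eq_top_iff.2 fun z _ => h z)
    let M := IntermediateField.adjoin ↥B {t0}
    let B' : IntermediateField ↥B L := (algebraicClosure ↥M L).restrictScalars ↥B
    have hMB : ∀ z ∈ M, z ∈ B' := fun z hz =>
      mem_algebraicClosure_iff.2 (isAlgebraic_algebraMap (⟨z, hz⟩ : ↥M))
    have hBB : ∀ z ∈ B, z ∈ B' := fun z hz => B'.algebraMap_mem ⟨z, hz⟩
    have ht0' : t0 ∈ B' := hMB _ (IntermediateField.mem_adjoin_simple_self _ _)
    have hadd := trdeg_tower B'
    have hne : Algebra.trdeg ↥B ↥B' ≠ 0 := by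
      intro h
      rw [trdeg_eq_zero_iff] at h
      have h1 := h.isAlgebraic (⟨t0, ht0'⟩ : ↥B')
      have h2 := h1.algebraMap (A := L)
      exact ht0 (hB.alg t0 h2)
    have h1 := Cardinal.one_le_iff_ne_zero.2 hne
    have htr' : Algebra.trdeg ↥B' L ≤ m := by
      have h2 : Algebra.trdeg ↥B' L + 1 ≤ (m : Cardinal) + 1 := by
        calc _ ≤ Algebra.trdeg ↥B' L + Algebra.trdeg ↥B ↥B' := by gcongr
          _ = Algebra.trdeg ↥B L := by rw [add_comm, hadd]
          _ ≤ _ := by simpa using htr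
      exact Cardinal.add_one_le_add_one_iff.1 h2
    have hM : M.toSubfield = Subfield.closure ((B : Set L) ∪ {t0}) := by
      change Subfield.closure (Set.range (algebraMap ↥B L) ∪ {t0}) = _
      congr 2
      ext z; constructor
      · rintro ⟨c, rfl⟩; exact c.2
      · intro hz; exact ⟨⟨z, hz⟩, rfl⟩
    have hbase : Base O k B'.toSubfield := by
      refine ⟨fun z hz => hBB z (hB.hkB hz), ?_, ?_⟩
      · intro z hz
        have hz : IsAlgebraic ↥(algebraicClosure ↥M L) z := hz
        exact mem_algebraicClosure_iff.2 (IsAlgebraic.restrictScalars ↥M hz)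
      · intro z hz
        obtain ⟨c, h1, h2, h3⟩ := hB.vals z hz
        exact ⟨c, hBB c h1, h2, h3⟩
    have := ih (n + 1) B'.toSubfield hbase (hG.step hC hB ht0 (by
      intro z hz
      have := mem_algebraicClosure_iff.1 (show z ∈ algebraicClosure ↥M L from hz)
      rw [← hM]; exact this)) htr'
    rw [show n + (m + 1) = n + 1 + m by ring]
    exact this

theorem rank_one [IsAlgClosed L] {k : Subfield L} (hC : Ctx O k)
    (hkp : ∀ p : ℕ, p ≠ 0 → ∀ z, z ^ p ∈ k → z ∈ k) (d : ℕ) (hd : Algebra.trdeg ↥k L = d) :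
    Good O k ⊤ d := by
  classical
  have hbd : ∀ r, (∃ x : Fin r → L, Indep O x) → r ≤ d := by
    rintro r ⟨x, hx⟩
    have := (hx.algInd (k0 := ↥k) (fun c => hC.hk _ c.2)).lift_cardinalMk_le_trdeg
    rw [hd] at this
    simpa using this
  have hex : ∃ x : Fin (Nat.findGreatest (fun r => ∃ x : Fin r → L, Indep O x) d) → L, Indep O x :=
    Nat.findGreatest_spec (P := fun r => ∃ x : Fin r → L, Indep O x) (Nat.zero_le d)
      ⟨Fin.elim0, fun i => i.elim0, fun e _ => Subsingleton.elim _ _⟩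
  generalize hr : Nat.findGreatest (fun r => ∃ x : Fin r → L, Indep O x) d = r at hex
  obtain ⟨x, hx⟩ := hex
  have hmax : ∀ y : Fin (r + 1) → L, ¬ Indep O y := by
    intro y hy
    exact Nat.findGreatest_is_greatest (P := fun r => ∃ x : Fin r → L, Indep O x) (n := d) (k := r + 1)
      (by omega) (hbd _ ⟨y, hy⟩) ⟨y, hy⟩
  obtain ⟨χ, hχ, hχx, hχi⟩ := exists_chi hx hmax
  let M := IntermediateField.adjoin ↥k (Set.range x)
  let B : IntermediateField ↥k L := (algebraicClosure ↥M L).restrictScalars ↥k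
  have hMB : ∀ z ∈ M, z ∈ B := fun z hz =>
    mem_algebraicClosure_iff.2 (isAlgebraic_algebraMap (⟨z, hz⟩ : ↥M))
  have hkB : ∀ z ∈ k, z ∈ B := fun z hz => B.algebraMap_mem ⟨z, hz⟩
  have hBalg : ∀ z : L, IsAlgebraic ↥B z → z ∈ B := by
    intro z hz
    have hz : IsAlgebraic ↥(algebraicClosure ↥M L) z := hz
    exact mem_algebraicClosure_iff.2 (IsAlgebraic.restrictScalars ↥M hz)
  have hxM : ∀ i, x i ∈ M := fun i => IntermediateField.subset_adjoin _ _ ⟨i, rfl⟩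
  have hχB : ∀ a, χ a ∈ B := by
    intro a
    obtain ⟨n, hn, e, he⟩ := hχx a
    have h1 : χ a ^ n ∈ M := by rw [he]; exact prod_mem fun i _ => zpow_mem (hxM i) _
    refine mem_algebraicClosure_iff.2 (IsAlgebraic.of_pow (Nat.pos_of_ne_zero hn) ?_)
    exact isAlgebraic_algebraMap (⟨_, h1⟩ : ↥M)
  have hbase : Base O k B.toSubfield := by
    refine ⟨hkB, hBalg, ?_⟩
    intro z hz
    obtain ⟨a, ha⟩ := hχ.surj z hz
    exact ⟨χ a, hχB a, hχ.ne_zero a, ha⟩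
  have hMle : M.toSubfield ≤ Subfield.closure ((k : Set L) ∪ Set.range χ) := by
    change Subfield.closure (Set.range (algebraMap ↥k L) ∪ Set.range x) ≤ _
    rw [Subfield.closure_le]
    rintro z (⟨c, rfl⟩ | ⟨i, rfl⟩)
    · exact Subfield.subset_closure (Or.inl c.2)
    · obtain ⟨a, ha⟩ := hχi i
      exact Subfield.subset_closure (Or.inr ⟨a, ha⟩)
  have hG : Good O k B.toSubfield r := by
    intro Z hZ
    have := hχ.abhyankar hC hkp Z (fun z hz => (hZ z hz).2) (by
      intro z hz
      have := mem_algebraicClosure_iff.1 (show z ∈ algebraicClosure ↥M L from (hZ z hz).1)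
      exact alg_mono (A := M.toSubfield) hMle this)
    rw [Module.finrank_fin_fun] at this
    exact this
  have hadd := trdeg_tower B
  have hrB : (r : Cardinal) ≤ Algebra.trdeg ↥k ↥B := by
    have h1 : AlgebraicIndependent ↥k x := hx.algInd (k0 := ↥k) (fun c => hC.hk _ c.2)
    have h2 : AlgebraicIndependent ↥k (fun i => (⟨x i, hMB _ (hxM i)⟩ : ↥B)) :=
      AlgebraicIndependent.of_comp B.val h1
    have := h2.lift_cardinalMk_le_trdeg
    simpa using this
  have hfin : Algebra.trdeg ↥B L ≤ (d : Cardinal) := by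
    rw [← hd, ← hadd]; exact le_add_self
  obtain ⟨m, hmd, hm⟩ := Cardinal.exists_nat_eq_of_le_nat hfin
  have hfin2 : Algebra.trdeg ↥k ↥B ≤ (d : Cardinal) := by
    rw [← hd, ← hadd]; exact le_self_add
  obtain ⟨r', hr'd, hr'⟩ := Cardinal.exists_nat_eq_of_le_nat hfin2
  rw [hm, hr', hd] at hadd
  rw [hr'] at hrB
  have e1 : r' + m = d := by exact_mod_cast hadd
  have e2 : r ≤ r' := by exact_mod_cast hrB
  intro Z hZ
  obtain ⟨t, h1, h2, h3⟩ := Good.chain hC m r B.toSubfield hbase hG hm.le Z hZ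
  exact ⟨t, h1, by omega, h3⟩

end LU

namespace LU

theorem main_S.{u} (d : ℕ) : ∀ (k0 L : Type u) [Field k0] [Field L] [Algebra k0 L] [IsAlgClosed L]
    (O : ValuationSubring L), (∀ c : k0, algebraMap k0 L c ∈ O) →
    (∀ z : L, IsAlgebraic k0 z → z ∈ Set.range (algebraMap k0 L)) →
    Algebra.trdeg k0 L = d → ∀ Z : Finset L, (Z : Set L) ⊆ O →
    ∃ t : Finset L, (t : Set L) ⊆ O ∧ t.card ≤ d ∧
      (Z : Set L) ⊆ Et O (Subring.closure (Set.range (algebraMap k0 L) ∪ t)) := by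
  classical
  induction d using Nat.strong_induction_on with
  | _ d ih =>
  intro k0 L _ _ _ _ O hk halg htr Z hZ
  let k : Subfield L := (⊥ : IntermediateField k0 L).toSubfield
  have hkr : (k : Set L) = Set.range (algebraMap k0 L) := IntermediateField.coe_bot
  have hkO : ∀ c ∈ k, c ∈ O := by
    intro c hc
    rw [← SetLike.mem_coe, hkr] at hc
    obtain ⟨c, rfl⟩ := hc; exact hk c
  have hkp : ∀ p : ℕ, p ≠ 0 → ∀ z, z ^ p ∈ k → z ∈ k := by
    intro p hp z hz
    rw [← SetLike.mem_coe, hkr] at hz ⊢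
    refine halg z (IsAlgebraic.of_pow (Nat.pos_of_ne_zero hp) ?_)
    obtain ⟨c, hc⟩ := hz
    rw [← hc]; exact isAlgebraic_algebraMap c
  have htrk : Algebra.trdeg ↥k L = d := by
    have h0 : Algebra.trdeg k0 ↥(⊥ : IntermediateField k0 L) = 0 := trdeg_eq_zero
    have h1 := trdeg_tower (⊥ : IntermediateField k0 L)
    rw [h0, zero_add, htr] at h1
    exact h1
  by_cases hO : O = ⊤
  · subst hO
    obtain ⟨s, hs⟩ := exists_isTranscendenceBasis k0 L
    have hcard := hs.cardinalMk_eq_trdeg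
    rw [htr] at hcard
    have hfin : s.Finite := Cardinal.lt_aleph0_iff_set_finite.1 (by rw [hcard]; exact Cardinal.natCast_lt_aleph0)
    have hc : hfin.toFinset.card = d := by
      have : (Nat.card s : Cardinal) = d := by
        rw [← hcard]; haveI := hfin.to_subtype; exact Nat.cast_card
      have h1 : Nat.card s = d := by exact_mod_cast this
      rw [← h1, Nat.card_coe_set_eq, Set.ncard_eq_toFinset_card _ hfin]
    obtain ⟨t, ht, hZt⟩ := top_case k hkp hfin.toFinset (by
      intro z
      have h1 := hs.isAlgebraic_field.isAlgebraic z
      refine alg_mono (A := (IntermediateField.adjoin k0 (Set.range ((↑) : s → L))).toSubfield) ?_ h1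
      change Subfield.closure _ ≤ _
      rw [hkr, hfin.coe_toFinset, Subtype.range_coe]) Z
    rw [hkr] at hZt
    exact ⟨t, fun _ _ => ValuationSubring.mem_top _, ht.trans hc.le, hZt⟩
  by_cases hex : ∃ Ow : ValuationSubring L, O ≤ Ow ∧ Ow ≠ ⊤ ∧ ∃ κ : IntermediateField k0 L, κ ≠ ⊥ ∧
      (∀ c ∈ κ, c ∈ Ow) ∧ (∀ z : L, IsAlgebraic ↥κ z → z ∈ κ) ∧ ∀ z ∈ Ow, ∃ c ∈ κ, Ow.valuation (z - c) < 1
  · obtain ⟨Ow, hOw, hne, κ, hκne, hκO, hκalg, hκres⟩ := hex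
    have hadd := trdeg_tower κ
    have hd1 : Algebra.trdeg k0 ↥κ ≤ (d : Cardinal) := by rw [← htr, ← hadd]; exact le_self_add
    have hd2 : Algebra.trdeg ↥κ L ≤ (d : Cardinal) := by rw [← htr, ← hadd]; exact le_add_self
    obtain ⟨d1, -, hd1⟩ := Cardinal.exists_nat_eq_of_le_nat hd1
    obtain ⟨d2, -, hd2⟩ := Cardinal.exists_nat_eq_of_le_nat hd2
    rw [hd1, hd2, htr] at hadd
    have e1 : d1 + d2 = d := by exact_mod_cast hadd
    have hd1ne : d1 ≠ 0 := by
      rintro rfl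
      rw [Nat.cast_zero, trdeg_eq_zero_iff] at hd1
      apply hκne
      rw [eq_bot_iff]
      intro z hz
      have := (hd1.isAlgebraic (⟨z, hz⟩ : ↥κ)).algebraMap (A := L)
      exact IntermediateField.mem_bot.2 (halg z this)
    have hd2ne : d2 ≠ 0 := by
      rintro rfl
      rw [Nat.cast_zero, trdeg_eq_zero_iff] at hd2
      apply hne
      rw [eq_top_iff]
      intro z _
      exact hκO z (hκalg z (hd2.isAlgebraic z))
    haveI : IsAlgClosed ↥κ := algClosed_of (B := κ.toSubfield) hκalg
    have hκr : Set.range (algebraMap ↥κ L) = (κ.toSubfield : Set L) := by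
      ext z; constructor
      · rintro ⟨c, rfl⟩; exact c.2
      · intro hz; exact ⟨⟨z, hz⟩, rfl⟩
    obtain ⟨t, htO, htc, hZt⟩ := ih d2 (by omega) ↥κ L Ow (fun c => hκO _ c.2)
      (fun z hz => ⟨⟨z, hκalg z hz⟩, rfl⟩) hd2 Z (fun z hz => hOw (hZ hz))
    rw [hκr] at hZt
    obtain ⟨t', A, ht'O, ht'c, hA, hZA⟩ := composition hOw (κ := κ.toSubfield) hκO hκres t htO Z hZ hZt
    let φ : ↥κ →+* L := algebraMap ↥κ L
    obtain ⟨t1, ht1O, ht1c, hAt⟩ := ih d1 (by omega) k0 ↥κ (O.comap φ) (fun c => hk c) (by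
      intro z hz
      obtain ⟨c, hc⟩ := halg _ (hz.algebraMap (A := L))
      exact ⟨c, Subtype.ext hc⟩) hd1 (A.preimage φ φ.injective.injOn) (by
      intro z hz
      rw [Finset.coe_preimage] at hz
      exact (hA _ hz).2)
    refine ⟨t' ∪ t1.image φ, ?_, ?_, ?_⟩
    · rw [Finset.coe_union, Finset.coe_image, Set.union_subset_iff]
      refine ⟨ht'O, ?_⟩
      rintro _ ⟨z, hz, rfl⟩
      exact ht1O hz
    · have := Finset.card_union_le t' (t1.image φ)
      have h2 := Finset.card_image_le (s := t1) (f := φ)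
      omega
    · refine hZA.trans (Et_le_of_le_Et ?_)
      rw [Subring.closure_le]
      rintro z (hz | hz)
      · have h1 : (⟨z, (hA z hz).1⟩ : ↥κ) ∈ Et (O.comap φ) (Subring.closure (Set.range (algebraMap k0 ↥κ) ∪ t1)) :=
          hAt (by rw [Finset.coe_preimage]; exact hz)
        have h2 := Et_map φ _ (Subring.mem_map.2 ⟨_, h1, rfl⟩)
        refine Et_mono ?_ h2
        rw [RingHom.map_closure, Subring.closure_le]
        rintro _ ⟨y, (⟨c, rfl⟩ | hy), rfl⟩
        · exact Subring.subset_closure (Or.inl ⟨c, rfl⟩)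
        · refine Subring.subset_closure (Or.inr ?_)
          rw [Finset.coe_union, Finset.coe_image]
          exact Or.inr ⟨y, hy, rfl⟩
      · refine le_Et _ _ (Subring.subset_closure (Or.inr ?_))
        rw [Finset.coe_union]
        exact Or.inl hz
  · push Not at hex
    have hC : Ctx O k := by
      refine arch_of hkO ?_ hO
      intro Ow hle hne z hz
      obtain ⟨κ, h1, h2, h3⟩ := exists_kappa Ow (fun c => hle (hk c))
      by_cases hb : κ = ⊥
      · subst hb; exact h3 z hz
      · obtain ⟨y, hy, h4⟩ := hex Ow hle hne κ hb h1 h2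
        obtain ⟨c, hc, h5⟩ := h3 y hy
        exact absurd h5 (not_lt.2 (h4 c hc))
    have := rank_one hC hkp d htrk Z (fun z hz => ⟨trivial, hZ hz⟩)
    rw [hkr] at this
    exact this

end LU

namespace LU
variable {L : Type*} [Field L] {O : ValuationSubring L}

def Step (O : ValuationSubring L) (A : Set L) (y : L) : Prop :=
  y ∈ O ∧ ∃ f : L[X], (∀ i, f.coeff i ∈ Subring.closure A) ∧ f.eval y = 0 ∧
    O.valuation (f.derivative.eval y) = 1

theorem Step.mono {A B : Set L} (h : A ⊆ B) {y : L} (hy : Step O A y) : Step O B y := by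
  obtain ⟨h0, f, h1, h2, h3⟩ := hy
  exact ⟨h0, f, fun i => Subring.closure_mono h (h1 i), h2, h3⟩

theorem Step.of_mem {A : Set L} {y : L} (hO : y ∈ O) (hy : y ∈ Subring.closure A) : Step O A y := by
  refine ⟨hO, X - C y, fun i => ?_, by simp, by simp⟩
  rw [coeff_sub, coeff_X, coeff_C]
  refine sub_mem ?_ ?_ <;> split_ifs <;> first | exact one_mem _ | exact zero_mem _ | exact hy

def Tow (O : ValuationSubring L) (A : Set L) : List L → Prop
  | [] => True
  | y :: l => Step O (A ∪ {x | x ∈ l}) y ∧ Tow O A l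

theorem Tow.append {A : Set L} : ∀ {l1 l2 : List L}, Tow O A l1 → Tow O A l2 → Tow O A (l1 ++ l2)
  | [], _, _, h2 => h2
  | y :: l, l2, h1, h2 => ⟨h1.1.mono (Set.union_subset_union_right _ fun x hx =>
      List.mem_append_left _ hx), Tow.append h1.2 h2⟩

def TowE (O : ValuationSubring L) (A : Set L) : Subring L where
  carrier := {z | ∃ l, Tow O A l ∧ z ∈ Subring.closure (A ∪ {x | x ∈ l})}
  zero_mem' := ⟨[], trivial, zero_mem _⟩
  one_mem' := ⟨[], trivial, one_mem _⟩
  neg_mem' := by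
    rintro x ⟨l, h, hx⟩; exact ⟨l, h, neg_mem hx⟩
  add_mem' := by
    rintro x y ⟨l, h, hx⟩ ⟨l', h', hy⟩
    exact ⟨l ++ l', h.append h', add_mem
      (Subring.closure_mono (Set.union_subset_union_right _ fun x hx => List.mem_append_left _ hx) hx)
      (Subring.closure_mono (Set.union_subset_union_right _ fun x hx => List.mem_append_right _ hx) hy)⟩
  mul_mem' := by
    rintro x y ⟨l, h, hx⟩ ⟨l', h', hy⟩
    exact ⟨l ++ l', h.append h', mul_mem
      (Subring.closure_mono (Set.union_subset_union_right _ fun x hx => List.mem_append_left _ hx) hx)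
      (Subring.closure_mono (Set.union_subset_union_right _ fun x hx => List.mem_append_right _ hx) hy)⟩

theorem TowE_finset {A : Set L} (Z : Finset L) (hZ : (Z : Set L) ⊆ TowE O A) :
    ∃ l, Tow O A l ∧ (Z : Set L) ⊆ Subring.closure (A ∪ {x | x ∈ l}) := by
  classical
  induction Z using Finset.induction_on with
  | empty => exact ⟨[], trivial, by simp⟩
  | insert a Z _ ih =>
    rw [Finset.coe_insert, Set.insert_subset_iff] at hZ
    obtain ⟨l, h, hx⟩ := ih hZ.2
    obtain ⟨l', h', hy⟩ := hZ.1
    refine ⟨l ++ l', h.append h', ?_⟩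
    rw [Finset.coe_insert, Set.insert_subset_iff]
    exact ⟨Subring.closure_mono (Set.union_subset_union_right _ fun x hx => List.mem_append_right _ hx) hy,
      hx.trans (Subring.closure_mono (Set.union_subset_union_right _ fun x hx => List.mem_append_left _ hx))⟩

theorem TowE_closed (A : Set L) : EtClosed O (TowE O A) := by
  classical
  intro f hf y hy h0 h1
  obtain ⟨l, hl, hc⟩ := TowE_finset (O := O) (A := A) (f.support.image f.coeff) (by
    intro z hz
    rw [Finset.coe_image] at hz
    obtain ⟨i, _, rfl⟩ := hz
    exact hf i)
  refine ⟨y :: l, ⟨⟨hy, f, fun i => ?_, h0, h1⟩, hl⟩, Subring.subset_closure (Or.inr (by simp))⟩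
  by_cases hi : f.coeff i = 0
  · rw [hi]; exact zero_mem _
  · exact hc (Finset.mem_image_of_mem _ (mem_support_iff.2 hi))

theorem Tow.seq {A : Set L} : ∀ {l : List L}, Tow O A l → ∃ (n : ℕ) (η : ℕ → L),
    (∀ i < n, Step O (A ∪ η '' Set.Iio i) (η i)) ∧ ∀ x, x ∈ l ↔ x ∈ η '' Set.Iio n
  | [], _ => ⟨0, fun _ => 0, by simp, by simp⟩
  | y :: l, h => by
    obtain ⟨n, η, h1, h2⟩ := Tow.seq h.2
    have hlt : ∀ i ≤ n, Function.update η n y '' Set.Iio i = η '' Set.Iio i := by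
      intro i hi
      refine Set.image_congr fun j hj => Function.update_of_ne ?_ _ _
      have : j < i := hj
      omega
    refine ⟨n + 1, Function.update η n y, ?_, ?_⟩
    · intro i hi
      rcases Nat.lt_succ_iff_lt_or_eq.1 hi with hi' | rfl
      · rw [hlt i hi'.le, Function.update_of_ne hi'.ne]; exact h1 i hi'
      · rw [hlt i le_rfl, Function.update_self]
        refine h.1.mono (Set.union_subset_union_right _ fun x hx => (h2 x).1 hx)
    · intro x
      rw [show Set.Iio (n + 1) = insert n (Set.Iio n) by ext i; simp,
        Set.image_insert_eq, hlt n le_rfl, Function.update_self, List.mem_cons, Set.mem_insert_iff, h2]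

theorem exists_tower {A : Set L} (Z : Finset L) (hO : (Z : Set L) ⊆ O)
    (hZ : (Z : Set L) ⊆ Et O (Subring.closure A)) :
    ∃ (n : ℕ) (η : ℕ → L), (∀ i < n, Step O (A ∪ η '' Set.Iio i) (η i)) ∧
      ∀ z ∈ Z, ∃ i < n, η i = z := by
  obtain ⟨l, hl, hc⟩ := TowE_finset (O := O) (A := A) Z (hZ.trans (Et_min (by
    rw [Subring.closure_le]
    intro x hx
    exact ⟨[], trivial, Subring.subset_closure (Or.inl hx)⟩) (TowE_closed A)))
  have h1 : ∀ l' : List L, (∀ z ∈ l', z ∈ Z) → Tow O A (l' ++ l) := by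
    intro l'
    induction l' with
    | nil => intro _; exact hl
    | cons y l' ih =>
      intro h
      refine ⟨Step.of_mem (hO (h y (by simp))) ?_, ih fun z hz => h z (by simp [hz])⟩
      exact Subring.closure_mono (Set.union_subset_union_right _ fun x hx => List.mem_append_right _ hx)
        (hc (h y (by simp)))
  obtain ⟨n, η, h2, h3⟩ := (h1 Z.toList (by simp)).seq
  refine ⟨n, η, h2, fun z hz => ?_⟩
  obtain ⟨i, hi, e⟩ := (h3 z).1 (List.mem_append_left _ (Finset.mem_toList.2 hz))
  exact ⟨i, hi, e⟩

theorem Step.descend {M : Type*} [Field M] (φ : M →+* L) {A : Set M} {y : M}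
    (h : Step O (φ '' A) (φ y)) : Step (O.comap φ) A y := by
  obtain ⟨h0, f, h1, h2, h3⟩ := h
  have h1' : ∀ i, ∃ c ∈ Subring.closure A, φ c = f.coeff i := by
    intro i
    have := h1 i
    rw [← RingHom.map_closure] at this
    exact this
  obtain ⟨g, rfl⟩ := (mem_lifts f).1 ((lifts_iff_coeff_lifts f).2 fun i => by
    obtain ⟨c, _, hc⟩ := h1' i; exact ⟨c, hc⟩)
  refine ⟨h0, g, fun i => ?_, ?_, ?_⟩
  · obtain ⟨c, hc, e⟩ := h1' i
    rw [coeff_map] at e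
    rw [← φ.injective e]; exact hc
  · rw [eval_map_apply] at h2
    exact (map_eq_zero φ).1 h2
  · rw [derivative_map, eval_map_apply, v_eq_one_iff] at h3
    rw [v_eq_one_iff]
    refine ⟨fun e => h3.1 (by rw [e, map_zero]), h3.2.1, ?_⟩
    rw [← map_inv₀] at h3
    exact h3.2.2

theorem Step.algebraic {A : Set L} {y : L} (h : Step O A y) {N : Subfield L}
    (hA : A ⊆ N) : IsAlgebraic ↥N y := by
  obtain ⟨h0, f, h1, h2, h3⟩ := h
  have hcl : Subring.closure A ≤ N.toSubring := Subring.closure_le.2 hA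
  obtain ⟨g, rfl⟩ := (mem_lifts f).1 ((lifts_iff_coeff_lifts (f := algebraMap ↥N L) f).2 fun i =>
    ⟨⟨_, hcl (h1 i)⟩, rfl⟩)
  refine ⟨g, ?_, ?_⟩
  · rintro rfl
    simp at h3
  · rwa [eval_map_algebraMap] at h2

section Mv
open MvPolynomial (C X pderiv degreeOf)

noncomputable def PR {n : ℕ} (A : Set L) (T : Set (Fin n)) : Subring (MvPolynomial (Fin n) L) :=
  Subring.closure (C '' A ∪ X '' T)

theorem PR_coeff {n : ℕ} {A : Set L} {T : Set (Fin n)} {P : MvPolynomial (Fin n) L}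
    (hP : P ∈ PR A T) (m : Fin n →₀ ℕ) : P.coeff m ∈ Subring.closure A := by
  classical
  induction hP using Subring.closure_induction generalizing m with
  | mem x hx =>
    rcases hx with ⟨a, ha, rfl⟩ | ⟨i, -, rfl⟩
    · rw [MvPolynomial.coeff_C]
      split_ifs
      · exact Subring.subset_closure ha
      · exact zero_mem _
    · rw [MvPolynomial.coeff_X']
      split_ifs
      · exact one_mem _
      · exact zero_mem _
  | zero => exact zero_mem _
  | one =>
    rw [MvPolynomial.coeff_one]
    split_ifs
    · exact one_mem _
    · exact zero_mem _
  | add x y _ _ hx hy => rw [MvPolynomial.coeff_add]; exact add_mem (hx m) (hy m)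
  | neg x _ hx => rw [MvPolynomial.coeff_neg]; exact neg_mem (hx m)
  | mul x y _ _ hx hy =>
    rw [MvPolynomial.coeff_mul]
    exact sum_mem fun i _ => mul_mem (hx _) (hy _)

theorem PR_deg {n : ℕ} {A : Set L} {T : Set (Fin n)} {P : MvPolynomial (Fin n) L}
    (hP : P ∈ PR A T) {j : Fin n} (hj : j ∉ T) : degreeOf j P = 0 ∧ pderiv j P = 0 := by
  classical
  induction hP using Subring.closure_induction with
  | mem x hx =>
    rcases hx with ⟨a, ha, rfl⟩ | ⟨i, hi, rfl⟩
    · simp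
    · have : j ≠ i := by rintro rfl; exact hj hi
      refine ⟨?_, ?_⟩
      · rw [MvPolynomial.degreeOf_X, if_neg this]
      · rw [MvPolynomial.pderiv_X_of_ne this.symm]
  | zero => simp
  | one => rw [← MvPolynomial.C_1]; simp only [MvPolynomial.degreeOf_C, MvPolynomial.pderiv_C, and_self]
  | add x y _ _ hx hy =>
    refine ⟨?_, by rw [map_add, hx.2, hy.2, add_zero]⟩
    have := MvPolynomial.degreeOf_add_le j x y
    rw [hx.1, hy.1] at this
    simpa using this
  | neg x _ hx =>
    refine ⟨?_, by rw [map_neg, hx.2, neg_zero]⟩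
    have := MvPolynomial.degreeOf_C_mul_le x j (-1 : L)
    rw [hx.1] at this
    simpa using this
  | mul x y _ _ hx hy =>
    refine ⟨?_, by rw [Derivation.leibniz, hx.2, hy.2, smul_zero, smul_zero, add_zero]⟩
    have := MvPolynomial.degreeOf_mul_le j x y
    rw [hx.1, hy.1] at this
    simpa using this

theorem mv_step {n : ℕ} {A : Set L} {η : Fin n → L} (i : Fin n)
    (h : Step O (A ∪ η '' Set.Iio i) (η i)) :
    ∃ P ∈ PR A (Set.Iic i), MvPolynomial.eval η P = 0 ∧
      O.valuation (MvPolynomial.eval η (pderiv i P)) = 1 := by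
  obtain ⟨h0, f, h1, h2, h3⟩ := h
  have h1' : ∀ m, ∃ P ∈ PR A (Set.Iio i), MvPolynomial.eval η P = f.coeff m := by
    intro m
    have := h1 m
    have e : A ∪ η '' Set.Iio i = MvPolynomial.eval η '' (C '' A ∪ X '' Set.Iio i) := by
      rw [Set.image_union, Set.image_image, Set.image_image]
      simp
    rw [e, ← RingHom.map_closure] at this
    exact this
  choose P hP hPe using h1'
  have hle : PR A (Set.Iio i) ≤ PR (L := L) A (Set.Iic i) :=
    Subring.closure_mono (Set.union_subset_union_right _ (Set.image_mono Set.Iio_subset_Iic_self))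
  refine ⟨∑ m ∈ f.support, P m * X i ^ m, ?_, ?_, ?_⟩
  · refine sum_mem fun m _ => mul_mem (hle (hP m)) (pow_mem ?_ _)
    exact Subring.subset_closure (Or.inr ⟨i, Set.mem_Iic.2 le_rfl, rfl⟩)
  · rw [map_sum]
    rw [Polynomial.eval_eq_sum, Polynomial.sum_def] at h2
    simpa [hPe] using h2
  · rw [Polynomial.derivative_eval, Polynomial.sum_def] at h3
    rw [← h3, map_sum, map_sum]
    congr 1
    refine Finset.sum_congr rfl fun m _ => ?_
    rw [Derivation.leibniz, (PR_deg (hP m) (j := i) (by simp)).2, smul_zero, add_zero, Derivation.leibniz_pow,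
      MvPolynomial.pderiv_X_self]
    simp [hPe]
    ring

theorem mv_conv {n : ℕ} {A : Set L} {η : Fin n → L}
    (h : ∀ i, Step O (A ∪ η '' Set.Iio i) (η i)) :
    ∃ f : Fin n → MvPolynomial (Fin n) L, (∀ i m, (f i).coeff m ∈ Subring.closure A) ∧
      (∀ i j, i < j → degreeOf j (f i) = 0) ∧ (∀ i, MvPolynomial.eval η (f i) = 0) ∧
      O.valuation (Matrix.det (Matrix.of fun i j => MvPolynomial.eval η (pderiv j (f i)))) = 1 := by
  choose f hf h0 h1 using fun i => mv_step i (h i)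
  refine ⟨f, fun i m => PR_coeff (hf i) m, fun i j hij => (PR_deg (hf i) (by simpa using hij)).1, h0, ?_⟩
  rw [Matrix.det_of_lowerTriangular]
  · rw [map_prod]
    exact Finset.prod_eq_one fun i _ => h1 i
  · intro i j hij
    have hij : i < j := hij
    rw [Matrix.of_apply, (PR_deg (hf i) (j := j) (by simpa using hij)).2, map_zero]

end Mv
end LU

namespace LU

theorem exists_ext_val {F Ω : Type*} [Field F] [Field Ω] (φ : F →+* Ω) (O : ValuationSubring F) :
    ∃ O' : ValuationSubring Ω, O'.comap φ = O := by
  obtain ⟨B, hB⟩ := LocalSubring.exists_le_valuationSubring (LocalSubring.map φ O.toLocalSubring)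
  refine ⟨B, ?_⟩
  obtain ⟨h1, h2⟩ := hB
  have hle : ∀ x ∈ O, φ x ∈ B := fun x hx => h1 ⟨x, hx, rfl⟩
  ext x
  rw [ValuationSubring.mem_comap]
  refine ⟨fun hx => ?_, hle x⟩
  by_contra hxO
  have hx0 : x ≠ 0 := by rintro rfl; exact hxO O.zero_mem
  have hxi : x⁻¹ ∈ O := (O.mem_or_inv_mem x).resolve_left hxO
  have hm : φ x⁻¹ ∈ (LocalSubring.map φ O.toLocalSubring).toSubring := ⟨x⁻¹, hxi, rfl⟩
  have hu : IsUnit (Subring.inclusion h1 ⟨φ x⁻¹, hm⟩) :=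
    isUnit_iff_exists_inv.mpr ⟨⟨φ x, hx⟩, Subtype.ext (by
      show φ x⁻¹ * φ x = 1
      rw [← map_mul, inv_mul_cancel₀ hx0, map_one])⟩
  obtain ⟨⟨y, z, hz, hzy⟩, hy⟩ := isUnit_iff_exists_inv.mp (h2.1 _ hu)
  have h3 : φ x⁻¹ * y = 1 := congrArg Subtype.val hy
  apply hxO
  have : φ (x⁻¹ * z) = φ 1 := by rw [map_mul, map_one, ← h3, ← hzy]
  have h4 := φ.injective this
  have : z = x := by rw [← mul_one x, ← h4, mul_inv_cancel_left₀ hx0]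
  exact this ▸ hz

theorem main_P {K Ω : Type*} [Field K] [Field Ω] [Algebra K Ω] [IsAlgClosed Ω]
    (O : ValuationSubring Ω) (hK : ∀ c : K, algebraMap K Ω c ∈ O) (d : ℕ)
    (hd : Algebra.trdeg (algebraicClosure K Ω) Ω = d) (Z : Finset Ω) (hZ : (Z : Set Ω) ⊆ O) :
    ∃ (A t : Finset Ω), (∀ a ∈ A, a ∈ perfectClosure K Ω) ∧ (t : Set Ω) ⊆ O ∧ t.card ≤ d ∧
      (Z : Set Ω) ⊆ Et O (Subring.closure ((A : Set Ω) ∪ t)) := by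
  classical
  let κ : Subfield Ω := (algebraMap K Ω).fieldRange
  have hκ : ∀ c ∈ κ, c ∈ O := by rintro _ ⟨c, rfl⟩; exact hK c
  have hκa : ∀ z : Ω, IsAlgebraic K z → IsAlgebraic ↥κ z := by
    rintro z ⟨f, hf0, hf⟩
    refine ⟨f.map (algebraMap K Ω).rangeRestrictField, ?_, ?_⟩
    · rwa [Ne, Polynomial.map_eq_zero]
    · rw [Polynomial.aeval_def, Polynomial.eval₂_map]
      rw [Polynomial.aeval_def] at hf
      exact hf
  have hk0 : ∀ z : Ω, z ∈ algebraicClosure K Ω → IsAlgebraic ↥κ z := fun z hz =>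
    hκa z (mem_algebraicClosure_iff.1 hz)
  obtain ⟨t, ht, htc, hZt⟩ := main_S d (algebraicClosure K Ω) Ω O
    (fun c => alg_in_O hκ (hk0 _ c.2))
    (fun z hz => by
      haveI : Algebra.IsAlgebraic K (algebraicClosure K Ω) := algebraicClosure.isAlgebraic K Ω
      exact ⟨⟨z, mem_algebraicClosure_iff.2 (hz.restrictScalars K)⟩, rfl⟩) hd Z hZ
  obtain ⟨A0, hA0, hZ0⟩ := Et_finite_gen Z hZt
  obtain ⟨p, hpe⟩ := ExpChar.exists K
  haveI := hpe
  haveI : ExpChar Ω p := expChar_of_injective_algebraMap (algebraMap K Ω).injective p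
  let R : Subring Ω := (perfectClosure K Ω).toSubalgebra.toSubring
  have hR : ∀ z, z ∈ R ↔ ∃ n : ℕ, z ^ p ^ n ∈ (algebraMap K Ω).range := fun z =>
    mem_perfectClosure_iff_pow_mem p
  have hRperf : ∀ z, z ^ p ∈ R → z ∈ R := by
    intro z hz
    obtain ⟨n, hn⟩ := (hR _).1 hz
    exact (hR _).2 ⟨n + 1, by rw [pow_succ', pow_mul]; exact hn⟩
  let E := Uof O R
  have hEc : EtClosed O E := Et_closed _ _
  have hκE : ∀ c ∈ κ, c ∈ E := by
    intro c hc
    refine le_Uof (R := R) ((hR c).2 ⟨0, ?_⟩) (hκ c hc)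
    rw [pow_zero, pow_one]; exact hc
  have hall : (A0 : Set Ω) ⊆ Et O (Subring.closure ((perfectClosure K Ω : Set Ω) ∪ ∅)) := by
    intro z hz
    obtain ⟨c, hc⟩ := hA0 hz
    have hzk : z ∈ algebraicClosure K Ω := hc ▸ c.2
    obtain ⟨n, hn⟩ := sep_mem p hEc hκE hκ (hk0 z hzk)
    have h1 : z ∈ E := perf_pow (S := (E : Set Ω)) (fun z hz => Uof_perf p hRperf hz) n z hn
    refine Et_mono ?_ h1
    intro x hx
    exact Subring.subset_closure (Or.inl hx.1)
  obtain ⟨A1, hA1, hA01⟩ := Et_finite_gen A0 hall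
  refine ⟨A1, t, fun a ha => hA1 ha, ht, htc, fun z hz => ?_⟩
  refine Et_le_of_le_Et ?_ (hZ0 hz)
  rw [Subring.closure_le]
  rintro x (hx | hx)
  · refine Et_mono ?_ (hA01 hx)
    exact Subring.closure_mono (by intro y hy; simp at hy; exact Or.inl hy)
  · exact le_Et _ _ (Subring.subset_closure (Or.inr hx))

end LU

namespace LU
open LocalUnif

theorem assemble {M : Type*} [Field M] (𝓚 : Subfield M) (Q : ValuationSubring M)
    (hKQ : ∀ c ∈ 𝓚, c ∈ Q) {s n : ℕ} (t : Fin s → M) (ht : ∀ i, t i ∈ Q) (η : Fin n → M)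
    (hη : ∀ i, Step Q (((𝓚 : Set M) ∪ Set.range t) ∪ η '' Set.Iio i) (η i))
    (hgen : Subfield.closure ((𝓚 : Set M) ∪ Set.range t ∪ Set.range η) = ⊤)
    (hs : (s : Cardinal) ≤ Algebra.trdeg ↥𝓚 M) :
    UnifData (F := M) ⊤ 𝓚 Q t η := by
  classical
  let B := IntermediateField.adjoin ↥𝓚 (Set.range t)
  let C := (algebraicClosure ↥B M)
  have hC : ∀ z, z ∈ C ↔ IsAlgebraic ↥B z := fun z => mem_algebraicClosure_iff
  have hBC : ∀ z ∈ B, z ∈ C := fun z hz => C.algebraMap_mem ⟨z, hz⟩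
  have hKC : ∀ z ∈ 𝓚, z ∈ C := fun z hz => hBC z (B.algebraMap_mem ⟨z, hz⟩)
  have htC : ∀ i, t i ∈ C := fun i => hBC _ (IntermediateField.subset_adjoin _ _ ⟨i, rfl⟩)
  have hηC : ∀ k : ℕ, ∀ i : Fin n, (i : ℕ) < k → η i ∈ C := by
    intro k
    induction k with
    | zero => intro i hi; omega
    | succ k ih =>
      intro i hi
      have h1 : IsAlgebraic ↥C.toSubfield (η i) := by
        refine (hη i).algebraic ?_
        rintro x ((hx | ⟨j, rfl⟩) | ⟨j, hj, rfl⟩)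
        · exact hKC x hx
        · exact htC j
        · exact ih j (by have : (j : ℕ) < i := hj; omega)
      have h2 : IsAlgebraic ↥C (η i) := h1
      rw [hC]
      haveI : Algebra.IsAlgebraic ↥B ↥C := algebraicClosure.isAlgebraic _ _
      exact h2.restrictScalars ↥B
  have hall : ∀ z : M, z ∈ C := by
    intro z
    have h1 : Subfield.closure ((𝓚 : Set M) ∪ Set.range t ∪ Set.range η) ≤ C.toSubfield := by
      rw [Subfield.closure_le]
      rintro x ((hx | ⟨j, rfl⟩) | ⟨j, rfl⟩)
      · exact hKC x hx
      · exact htC j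
      · exact hηC n j j.2
    rw [hgen] at h1
    exact h1 (Subfield.mem_top z)
  have halg : Algebra.IsAlgebraic ↥B M := ⟨fun z => (hC z).1 (hall z)⟩
  have halg' : Algebra.IsAlgebraic ↥(Algebra.adjoin ↥𝓚 (Set.range t)) M :=
    IntermediateField.isAlgebraic_adjoin_iff_top.1 halg
  have hind : IsTranscendenceBasis ↥𝓚 t := by
    refine Algebra.IsAlgebraic.isTranscendenceBasis_of_lift_le_trdeg_of_finite ↥𝓚 t ?_
    simpa using hs
  obtain ⟨f, hf1, hf2, hf3, hf4⟩ := mv_conv hη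
  have hle : Subring.closure ((𝓚 : Set M) ∪ Set.range t) ≤
      Subring.closure ((↑(𝓚.toSubring ⊓ Q.toSubring) : Set M) ∪ Set.range t) := by
    refine Subring.closure_mono ?_
    rintro x (hx | hx)
    · exact Or.inl ⟨hx, hKQ x hx⟩
    · exact Or.inr hx
  refine ⟨fun i => ⟨Subfield.mem_top _, ht i⟩, fun i => ⟨Subfield.mem_top _, (hη i).1⟩, hind.1,
    fun z _ => halg.1 z, hgen, f, fun i m => hle (hf1 i m), fun i j hij => hf2 i j hij, hf3,
    v_eq_one_iff.1 hf4⟩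

end LU

namespace LU

theorem trdeg_fin {F : Type*} [Field F] (K : Subfield F) (S : Finset F)
    (hS : IntermediateField.adjoin ↥K (S : Set F) = ⊤) : ∃ d : ℕ, Algebra.trdeg ↥K F = d := by
  haveI : Algebra.EssFiniteType ↥K F := IntermediateField.fg_top_iff.1 ⟨S, hS⟩
  exact Cardinal.lt_aleph0.1 (trdeg_lt_aleph0 ↥K F)

theorem trdeg_ac {K F Ω : Type*} [Field K] [Field F] [Field Ω] [Algebra K F] [Algebra F Ω]
    [Algebra K Ω] [IsScalarTower K F Ω] [Algebra.IsAlgebraic F Ω] (d : ℕ)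
    (hd : Algebra.trdeg K F = d) : Algebra.trdeg ↥(algebraicClosure K Ω) Ω = d := by
  have h1 := trdeg_tower (L := Ω) (algebraicClosure K Ω)
  haveI := algebraicClosure.isAlgebraic K Ω
  have h2 := lift_trdeg_add_eq K F Ω
  rw [trdeg_eq_zero_iff.2 (inferInstance : Algebra.IsAlgebraic F (Ω)), hd] at h2
  rw [trdeg_eq_zero_iff.2 (inferInstance : Algebra.IsAlgebraic K (↥(algebraicClosure K Ω))), zero_add] at h1
  rw [h1]
  simpa using h2.symm

theorem trdeg_mid {K F M : Type*} [Field K] [Field F] [Field M] [Algebra K F] [Algebra F M]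
    [Algebra K M] [IsScalarTower K F M] [Algebra.IsAlgebraic F M] (d : ℕ)
    (hd : Algebra.trdeg K F = d) (B : IntermediateField K M) [FiniteDimensional K B] :
    Algebra.trdeg ↥B M = d := by
  have h1 := trdeg_tower (L := M) B
  have h2 := lift_trdeg_add_eq K F M
  rw [trdeg_eq_zero_iff.2 (inferInstance : Algebra.IsAlgebraic F (M)), hd] at h2
  rw [trdeg_eq_zero_iff.2 (inferInstance : Algebra.IsAlgebraic K (↥B)), zero_add] at h1
  rw [h1]
  simpa using h2.symm

theorem rexp_pos (K : Type*) [Field K] : 0 < ringExpChar K := by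
  obtain ⟨p, hp⟩ := ExpChar.exists K
  haveI := hp
  rw [ringExpChar.eq K p]; exact expChar_pos K p

theorem isAlg_of_perf {K M : Type*} [Field K] [Field M] [Algebra K M] {x : M}
    (h : x ∈ perfectClosure K M) : IsAlgebraic K x := by
  obtain ⟨n, y, hy⟩ := mem_perfectClosure_iff.1 h
  refine IsAlgebraic.of_pow (pow_pos (LU.rexp_pos K) n) ?_
  rw [← hy]; exact isAlgebraic_algebraMap y

theorem fd_sub {K M : Type*} [Field K] [Field M] [Algebra K M] (Ki : IntermediateField K M)
    [hfd : FiniteDimensional K ↥Ki] (K2 : Subfield M) (hK2 : ∀ c, algebraMap K M c ∈ K2)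
    (hle : K2 ≤ Ki.toSubfield) :
    letI : Algebra ↥K2 ↥Ki.toSubfield := (Subfield.inclusion hle).toAlgebra
    FiniteDimensional ↥K2 ↥Ki.toSubfield := by
  letI a1 : Algebra ↥K2 ↥Ki.toSubfield := (Subfield.inclusion hle).toAlgebra
  letI a2 : Algebra ↥K2 ↥Ki := (Subfield.inclusion hle).toAlgebra
  letI a3 : Algebra K ↥K2 := ((algebraMap K M).codRestrict K2 hK2).toAlgebra
  haveI : IsScalarTower K ↥K2 ↥Ki := IsScalarTower.of_algebraMap_eq (fun _ => rfl)
  have h : FiniteDimensional ↥K2 ↥Ki := Module.Finite.of_restrictScalars_finite K ↥K2 ↥Ki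
  exact h

end LU

end

set_option synthInstance.maxHeartbeats 400000 in
set_option maxHeartbeats 1000000 in
open LocalUnif in
/-- Theorem 1.3 of the paper. Let `F|K` be an algebraic function
field and `P` a place of `F|K`, with valuation ring `O`. For any `ζ₁, …, ζ_m ∈ 𝓞_F`
there exist a finite extension `𝓕` of `F` (inside a fixed algebraic closure),
an extension `Q` of the valuation to `𝓕`, and a finite purely inseparable extension
`𝓚` of `K` inside `𝓕`, such that `(𝓕|𝓚, P)` is uniformizable with respect to
`ζ₁, …, ζ_m`. -/
theorem statement_0
    (F : Type*) [Field F] (K : Subfield F) (O : ValuationSubring F)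
    (hff : IsFunctionField K) (htriv : TrivialOn O K)
    (m : ℕ) (ζ : Fin m → F) (hζ : ∀ k, ζ k ∈ O) :
    ∃ (𝓕 : IntermediateField F (AlgebraicClosure F)) (Q : ValuationSubring ↥𝓕)
      (𝓚 : Subfield ↥𝓕),
      FiniteDimensional F ↥𝓕 ∧
      Q.comap (algebraMap F ↥𝓕) = O ∧
      (∃ hle : K.map (algebraMap F ↥𝓕) ≤ 𝓚,
        (letI : Algebra ↥(K.map (algebraMap F ↥𝓕)) ↥𝓚 := (Subfield.inclusion hle).toAlgebra
         FiniteDimensional ↥(K.map (algebraMap F ↥𝓕)) ↥𝓚) ∧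
        ∀ x ∈ 𝓚, ∃ nn : ℕ, x ^ ringExpChar F ^ nn ∈ K.map (algebraMap F ↥𝓕)) ∧
      UnifWrt (F := ↥𝓕) ⊤ 𝓚 Q (fun k => algebraMap F ↥𝓕 (ζ k)) := by
  classical
  obtain ⟨⟨S, hS⟩, -⟩ := hff
  obtain ⟨O', hO'⟩ := LU.exists_ext_val (algebraMap F (AlgebraicClosure F)) O
  have hmO : ∀ x, algebraMap F (AlgebraicClosure F) x ∈ O' ↔ x ∈ O := fun x => by
    rw [← hO', ValuationSubring.mem_comap]
  obtain ⟨d, hd⟩ := LU.trdeg_fin K S hS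
  have hdΩ := LU.trdeg_ac (K := ↥K) (F := F) (Ω := AlgebraicClosure F) d hd
  let gen : F → F := fun s => if s ∈ O then s else s⁻¹
  have hgenO : ∀ s, gen s ∈ O := by
    intro s
    by_cases hs : s ∈ O
    · simp only [gen, if_pos hs]; exact hs
    · simp only [gen, if_neg hs]; exact (O.mem_or_inv_mem s).resolve_left hs
  let Z0 : Finset F := Finset.univ.image ζ ∪ S.image gen
  have hZ0 : ∀ z ∈ Z0, z ∈ O := by
    intro z hz
    rcases Finset.mem_union.1 hz with h | h
    · obtain ⟨k, -, rfl⟩ := Finset.mem_image.1 h; exact hζ k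
    · obtain ⟨k, -, rfl⟩ := Finset.mem_image.1 h; exact hgenO k
  let Z : Finset (AlgebraicClosure F) := Z0.image (algebraMap F (AlgebraicClosure F))
  have hZ : (Z : Set (AlgebraicClosure F)) ⊆ O' := by
    intro z hz
    obtain ⟨w, hw, rfl⟩ := Finset.mem_image.1 (Finset.mem_coe.1 hz)
    exact (hmO w).2 (hZ0 w hw)
  have hKO : ∀ c : ↥K, algebraMap ↥K (AlgebraicClosure F) c ∈ O' := by
    intro c
    rw [IsScalarTower.algebraMap_apply ↥K F (AlgebraicClosure F)]
    exact (hmO _).2 (htriv _ c.2).1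
  obtain ⟨A1, t0, hA1, ht0, ht0c, hZt⟩ := LU.main_P O' hKO d hdΩ Z hZ
  obtain ⟨n, η, hη, hηZ⟩ := LU.exists_tower Z hZ hZt
  let G : Set (AlgebraicClosure F) := (↑A1 ∪ ↑t0) ∪ η '' Set.Iio n
  have hGf : G.Finite := ((A1.finite_toSet.union t0.finite_toSet)).union ((Set.finite_Iio n).image η)
  let 𝓕 : IntermediateField F (AlgebraicClosure F) := IntermediateField.adjoin F G
  have hG𝓕 : ∀ x ∈ G, x ∈ 𝓕 := fun x hx => IntermediateField.subset_adjoin F G hx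
  haveI hfd𝓕 : FiniteDimensional F ↥𝓕 := by
    haveI : Finite G := hGf
    exact IntermediateField.finiteDimensional_adjoin
      (fun x _ => (Algebra.IsAlgebraic.isAlgebraic (R := F) x).isIntegral)
  let φ : ↥𝓕 →+* AlgebraicClosure F := algebraMap ↥𝓕 (AlgebraicClosure F)
  have hφ : ∀ x : ↥𝓕, φ x = x := fun x => rfl
  let Q : ValuationSubring ↥𝓕 := O'.comap φ
  have hQF : ∀ x, algebraMap F ↥𝓕 x ∈ Q ↔ x ∈ O := fun x => hmO x
  let A1' : Set ↥𝓕 := φ ⁻¹' ↑A1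
  have hA1img : ∀ a ∈ A1, ∃ b ∈ A1', φ b = a := fun a ha =>
    ⟨⟨a, hG𝓕 a (Or.inl (Or.inl ha))⟩, ha, rfl⟩
  let Ki : IntermediateField ↥K ↥𝓕 := IntermediateField.adjoin ↥K A1'
  have hA1Ki : ∀ x ∈ A1', x ∈ Ki := fun x hx => IntermediateField.subset_adjoin ↥K A1' hx
  have hperfA : ∀ x ∈ A1', x ∈ perfectClosure ↥K ↥𝓕 := by
    intro x hx
    obtain ⟨nn, y, hy⟩ := mem_perfectClosure_iff.1 (hA1 _ hx)
    refine mem_perfectClosure_iff.2 ⟨nn, y, φ.injective ?_⟩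
    rw [map_pow, ← hy]; rfl
  have hKip : Ki ≤ perfectClosure ↥K ↥𝓕 := IntermediateField.adjoin_le_iff.2 hperfA
  haveI hKifd : FiniteDimensional ↥K ↥Ki := by
    haveI : Finite A1' := A1.finite_toSet.preimage φ.injective.injOn
    exact IntermediateField.finiteDimensional_adjoin (fun x hx =>
      (LU.isAlg_of_perf (hperfA x hx)).isIntegral)
  have hle : K.map (algebraMap F ↥𝓕) ≤ Ki.toSubfield := by
    rintro _ ⟨k, hk, rfl⟩
    exact Ki.algebraMap_mem ⟨k, hk⟩
  have hexp : ringExpChar ↥K = ringExpChar F := by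
    obtain ⟨p, hp⟩ := ExpChar.exists ↥K
    haveI := hp
    haveI : ExpChar F p := expChar_of_injective_algebraMap (algebraMap ↥K F).injective p
    rw [ringExpChar.eq ↥K p, ringExpChar.eq F p]
  have hKpow : ∀ x ∈ Ki, ∃ nn : ℕ, x ^ ringExpChar F ^ nn ∈ K.map (algebraMap F ↥𝓕) := by
    intro x hx
    obtain ⟨nn, y, hy⟩ := mem_perfectClosure_iff.1 (hKip hx)
    rw [hexp] at hy
    exact ⟨nn, y, y.2, hy⟩
  have hKQ : ∀ c ∈ Ki.toSubfield, c ∈ Q := by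
    intro c hc
    obtain ⟨nn, y, hy, hxy⟩ := hKpow c hc
    have h1 : c ^ ringExpChar F ^ nn ∈ Q := by
      rw [← hxy]; exact (hQF y).2 (htriv y hy).1
    have hpos : 0 < ringExpChar F ^ nn := pow_pos (LU.rexp_pos F) _
    rw [LU.vle, map_pow] at h1
    rw [LU.vle]
    exact (pow_le_one_iff hpos.ne').1 h1
  let s := t0.card
  let e : Fin s ≃ t0 := t0.equivFin.symm
  let t : Fin s → ↥𝓕 := fun i => ⟨(e i : AlgebraicClosure F), hG𝓕 _ (Or.inl (Or.inr (e i).2))⟩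
  have htQ : ∀ i, t i ∈ Q := fun i => ht0 (e i).2
  have htr : ∀ x ∈ t0, ∃ i, φ (t i) = x := fun x hx => ⟨e.symm ⟨x, hx⟩, by simp [t, φ]⟩
  let η' : Fin n → ↥𝓕 := fun i => ⟨η i, hG𝓕 _ (Or.inr ⟨i, i.2, rfl⟩)⟩
  have hη' : ∀ i, LU.Step Q (((Ki.toSubfield : Set ↥𝓕) ∪ Set.range t) ∪ η' '' Set.Iio i) (η' i) := by
    intro i
    refine LU.Step.descend φ ?_
    refine LU.Step.mono ?_ (hη i i.2)
    rintro x ((hx | hx) | ⟨j, hj, rfl⟩)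
    · obtain ⟨b, hb, rfl⟩ := hA1img x hx
      exact ⟨b, Or.inl (Or.inl (hA1Ki b hb)), rfl⟩
    · obtain ⟨j, rfl⟩ := htr x hx
      exact ⟨t j, Or.inl (Or.inr ⟨j, rfl⟩), rfl⟩
    · have hj' : j < (i : ℕ) := hj
      exact ⟨η' ⟨j, hj'.trans i.2⟩, Or.inr ⟨⟨j, hj'.trans i.2⟩, hj', rfl⟩, rfl⟩
  have hηF : ∀ z ∈ Z0, ∃ i, η' i = algebraMap F ↥𝓕 z := by
    intro z hz
    obtain ⟨i, hi, hiz⟩ := hηZ _ (Finset.mem_image_of_mem (algebraMap F (AlgebraicClosure F)) hz)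
    exact ⟨⟨i, hi⟩, φ.injective hiz⟩
  have hgen : Subfield.closure ((Ki.toSubfield : Set ↥𝓕) ∪ Set.range t ∪ Set.range η') = ⊤ := by
    rw [eq_top_iff]
    set N := Subfield.closure ((Ki.toSubfield : Set ↥𝓕) ∪ Set.range t ∪ Set.range η') with hN
    have hsub : ((Ki.toSubfield : Set ↥𝓕) ∪ Set.range t ∪ Set.range η') ⊆ N := Subfield.subset_closure
    let NF : IntermediateField ↥K F := (N.comap (algebraMap F ↥𝓕)).toIntermediateField (by
      intro k
      exact hsub (Or.inl (Or.inl (hle ⟨k, k.2, rfl⟩))))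
    have hNF : ∀ x : F, algebraMap F ↥𝓕 x ∈ N := by
      have h1 : IntermediateField.adjoin ↥K (S : Set F) ≤ NF := by
        rw [IntermediateField.adjoin_le_iff]
        intro x hx
        show algebraMap F ↥𝓕 x ∈ N
        obtain ⟨i, hi⟩ := hηF (gen x) (Finset.mem_union_right _ (Finset.mem_image_of_mem gen hx))
        have h2 : algebraMap F ↥𝓕 (gen x) ∈ N := hi ▸ hsub (Or.inr ⟨i, rfl⟩)
        by_cases hxO : x ∈ O
        · simpa only [gen, if_pos hxO] using h2
        · simp only [gen, if_neg hxO] at h2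
          rw [map_inv₀] at h2
          exact inv_inv (algebraMap F ↥𝓕 x) ▸ N.inv_mem h2
      intro x
      have h3 : x ∈ IntermediateField.adjoin ↥K (S : Set F) := by rw [hS]; trivial
      exact h1 h3
    let NΩ : IntermediateField F (AlgebraicClosure F) := (N.map φ).toIntermediateField (by
      intro x
      exact ⟨algebraMap F ↥𝓕 x, hNF x, rfl⟩)
    have hle2 : 𝓕 ≤ NΩ := by
      refine IntermediateField.adjoin_le_iff.2 ?_
      rintro x ((hx | hx) | ⟨j, hj, rfl⟩)
      · obtain ⟨b, hb, rfl⟩ := hA1img x hx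
        exact ⟨b, hsub (Or.inl (Or.inl (hA1Ki b hb))), rfl⟩
      · obtain ⟨j, rfl⟩ := htr x hx
        exact ⟨t j, hsub (Or.inl (Or.inr ⟨j, rfl⟩)), rfl⟩
      · exact ⟨η' ⟨j, hj⟩, hsub (Or.inr ⟨⟨j, hj⟩, rfl⟩), rfl⟩
    intro x _
    obtain ⟨y, hy, hyx⟩ := hle2 x.2
    have : y = x := φ.injective hyx
    exact this ▸ hy
  have hs : (s : Cardinal) ≤ Algebra.trdeg ↥Ki.toSubfield ↥𝓕 := by
    have h1 : Algebra.trdeg ↥Ki ↥𝓕 = d := LU.trdeg_mid d hd Ki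
    have h2 : (s : Cardinal) ≤ Algebra.trdeg ↥Ki ↥𝓕 := by rw [h1]; exact_mod_cast ht0c
    exact h2
  have hfin := LU.assemble Ki.toSubfield Q hKQ t htQ η' hη' hgen hs
  refine ⟨𝓕, Q, Ki.toSubfield, hfd𝓕, ?_, ⟨hle, ?_, hKpow⟩, s, n, t, η', hfin, ?_⟩
  · ext x; exact hQF x
  · exact LU.fd_sub Ki (K.map (algebraMap F ↥𝓕)) (fun c => ⟨c, c.2, rfl⟩) hle
  · choose σ hσ using fun k => hηF (ζ k)
      (Finset.mem_union_left _ (Finset.mem_image_of_mem ζ (Finset.mem_univ k)))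
    exact ⟨σ, hσ⟩
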